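/- Anderson localization in the supercritical region: Let t ∈ (−1,1), λ₁, λ₂ ∈ (0,1) with λ₁ < (1−t²)/(1+t²) and λ₁ < λ₂. Suppose Φ satisfies the Diophantine condition with exponent τ > 1 and θ is non-resonant with respect to Φ. Then the quantum-walk operator W = W_{λ₁,λ₂,Φ,θ} has pure point spectrum with exponentially decaying eigenvectors: there exists a Hilbert (complete orthonormal) basis of ℓ²(ℤ; ℂ²) consisting of eigenvectors of W, and each basis element ψ satisfies ‖ψₙ‖_{ℂ²} ≤ C e^{−c|n|} for all n ∈ ℤ, for some constants C, c > 0 depending on ψ. -/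

import Mathlib

open MeasureTheory

noncomputable section

/-- `λ' = √(1 - λ²)`. -/
def sq1 (l : ℝ) : ℝ := Real.sqrt (1 - l ^ 2)

/-- The sampling function `f(x) = (1/k)(2 t λ₂ cos(2πx) + (t²−1) λ₂′)` with `k = −(1+t²)`. -/
def fS (t l x : ℝ) : ℝ :=
  (1 / (-(1 + t ^ 2))) * (2 * t * l * Real.cos (2 * Real.pi * x) + (t ^ 2 - 1) * sq1 l)

/-- The sampling function `g(x) = (1/k)(−t² λ₂ e^{2πix} + λ₂ e^{−2πix} + 2 t λ₂′)`. -/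
def gS (t l x : ℝ) : ℂ :=
  ((1 / (-(1 + t ^ 2)) : ℝ) : ℂ) *
    (-(((t ^ 2 * l : ℝ)) : ℂ) * Complex.exp (2 * Real.pi * x * Complex.I)
      + ((l : ℝ) : ℂ) * Complex.exp (-(2 * Real.pi * x) * Complex.I)
      + ((2 * t * sq1 l : ℝ) : ℂ))

/-- The Hilbert space `ℓ²(ℤ; ℂ²)`. -/
abbrev H2 := lp (fun _ : ℤ => EuclideanSpace ℂ (Fin 2)) 2

/-- The `+` component of `W ψ = S_{λ₁} Q ψ` at site `n`. -/
def wPlus (t l1 l2 Φ θ : ℝ) (ψ : ℤ → EuclideanSpace ℂ (Fin 2)) (n : ℤ) : ℂ :=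
  (l1 : ℂ) * ((fS t l2 (θ + ((n : ℝ) - 1) * Φ) : ℂ) * ψ (n - 1) 0
      - gS t l2 (θ + ((n : ℝ) - 1) * Φ) * ψ (n - 1) 1)
    - (sq1 l1 : ℂ) * ((starRingEnd ℂ) (gS t l2 (θ + (n : ℝ) * Φ)) * ψ n 0
      + (fS t l2 (θ + (n : ℝ) * Φ) : ℂ) * ψ n 1)

/-- The `−` component of `W ψ = S_{λ₁} Q ψ` at site `n`. -/
def wMinus (t l1 l2 Φ θ : ℝ) (ψ : ℤ → EuclideanSpace ℂ (Fin 2)) (n : ℤ) : ℂ :=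
  (l1 : ℂ) * ((starRingEnd ℂ) (gS t l2 (θ + ((n : ℝ) + 1) * Φ)) * ψ (n + 1) 0
      + (fS t l2 (θ + ((n : ℝ) + 1) * Φ) : ℂ) * ψ (n + 1) 1)
    + (sq1 l1 : ℂ) * ((fS t l2 (θ + (n : ℝ) * Φ) : ℂ) * ψ n 0
      - gS t l2 (θ + (n : ℝ) * Φ) * ψ n 1)

/-- `ψ` is a (generalized) eigenvector of `W_{λ₁,λ₂,Φ,θ}` with eigenvalue `z`. -/
def IsEigen (t l1 l2 Φ θ : ℝ) (z : ℂ) (ψ : ℤ → EuclideanSpace ℂ (Fin 2)) : Prop :=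
  ∀ n : ℤ, wPlus t l1 l2 Φ θ ψ n = z * ψ n 0 ∧ wMinus t l1 l2 Φ θ ψ n = z * ψ n 1

/-- `ω` is a point of the unit circle whose powers satisfy a Diophantine lower bound. -/
def DioUnit (ω : ℂ) (κ τ : ℝ) : Prop :=
  ‖ω‖ = 1 ∧ 0 < κ ∧ 1 < τ ∧ ∀ m : ℕ, 0 < m → κ / (m : ℝ) ^ τ ≤ ‖1 - ω ^ m‖

lemma hasSum_log_norm_one_sub {u : ℂ} (hu : ‖u‖ < 1) :
    HasSum (fun m : ℕ => -(u ^ m / m).re) (Real.log ‖1 - u‖) := by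
  have h := Complex.hasSum_re (Complex.hasSum_taylorSeries_neg_log hu)
  have h2 := h.neg
  simpa [Complex.log_re] using h2

lemma norm_geom_sum_le {ω : ℂ} (hω : ‖ω‖ = 1) (h1 : ω ≠ 1) (n : ℕ) :
    ‖∑ j ∈ Finset.range n, ω ^ j‖ ≤ 2 / ‖1 - ω‖ := by
  have hne : ω - 1 ≠ 0 := sub_ne_zero.2 h1
  rw [geom_sum_eq h1, norm_div, norm_sub_rev ω 1]
  gcongr
  calc ‖ω ^ n - 1‖ ≤ ‖ω ^ n‖ + ‖(1 : ℂ)‖ := norm_sub_le _ _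
    _ = 2 := by rw [norm_pow, hω]; norm_num

lemma DioUnit.pow_ne_one {ω : ℂ} {κ τ : ℝ} (h : DioUnit ω κ τ) {m : ℕ} (hm : 0 < m) :
    ω ^ m ≠ 1 := by
  intro h1
  have hlow := h.2.2.2 m hm
  have hκ := h.2.1
  have hm' : (0 : ℝ) < m := by exact_mod_cast hm
  have hpos : 0 < κ / (m : ℝ) ^ τ := by positivity
  rw [h1, sub_self, norm_zero] at hlow
  linarith

lemma DioUnit.abs_sum_term_le {ω : ℂ} {κ τ : ℝ} (h : DioUnit ω κ τ) {N : ℕ} (hN : τ ≤ N)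
    (q w : ℂ) (hw : ‖w‖ = 1) (n m : ℕ) :
    |∑ j ∈ Finset.range n, -((q * (w * ω ^ j)) ^ m / m).re| ≤
      (2 / κ) * ((m : ℝ) ^ N * ‖q‖ ^ m) := by
  have hκ := h.2.1
  rcases Nat.eq_zero_or_pos m with rfl | hm
  · simp only [Nat.cast_zero, div_zero, Complex.zero_re, neg_zero, Finset.sum_const_zero, abs_zero]
    positivity
  have hm1 : (1 : ℝ) ≤ m := by exact_mod_cast hm
  have hlow := h.2.2.2 m hm
  have hpos : 0 < κ / (m : ℝ) ^ τ := by positivity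
  have e1 : ∑ j ∈ Finset.range n, -((q * (w * ω ^ j)) ^ m / m).re
      = -((q * w) ^ m / m * ∑ j ∈ Finset.range n, (ω ^ m) ^ j).re := by
    rw [Finset.sum_neg_distrib, ← Complex.re_sum, Finset.mul_sum]
    congr 2
    refine Finset.sum_congr rfl fun j _ => ?_
    rw [← pow_mul, mul_comm m j, pow_mul]; ring
  rw [e1, abs_neg]
  refine (Complex.abs_re_le_norm _).trans ?_
  rw [norm_mul, norm_div, norm_pow, norm_mul, hw, mul_one, Complex.norm_natCast]
  have h2 := norm_geom_sum_le (by rw [norm_pow, h.1, one_pow]) (h.pow_ne_one hm) n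
  have h3 : 2 / ‖1 - ω ^ m‖ ≤ 2 / (κ / (m : ℝ) ^ τ) := by gcongr
  have h4 : (m : ℝ) ^ τ ≤ (m : ℝ) ^ N := by
    rw [← Real.rpow_natCast]; exact Real.rpow_le_rpow_of_exponent_le hm1 hN
  calc ‖q‖ ^ m / m * ‖∑ j ∈ Finset.range n, (ω ^ m) ^ j‖
      ≤ ‖q‖ ^ m / 1 * (2 / (κ / (m : ℝ) ^ τ)) := by
        gcongr; exact h2.trans h3
    _ = (2 / κ) * ((m : ℝ) ^ τ * ‖q‖ ^ m) := by field_simp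
    _ ≤ _ := by gcongr

/-- Birkhoff sums of `log |1 - q ·|` over a Diophantine rotation are bounded when `|q| < 1`. -/
lemma DioUnit.exists_abs_sum_log_le {ω : ℂ} {κ τ : ℝ} (h : DioUnit ω κ τ) {q : ℂ} (hq : ‖q‖ < 1) :
    ∃ B : ℝ, 0 ≤ B ∧ ∀ (w : ℂ), ‖w‖ = 1 → ∀ n : ℕ,
      |∑ j ∈ Finset.range n, Real.log ‖1 - q * (w * ω ^ j)‖| ≤ B := by
  have hκ := h.2.1
  obtain ⟨N, hN⟩ := exists_nat_ge τ
  have hs : Summable (fun m : ℕ => (2 / κ) * ((m : ℝ) ^ N * ‖q‖ ^ m)) :=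
    by
    have := summable_pow_mul_geometric_of_norm_lt_one N (r := ‖q‖) (by rwa [norm_norm])
    exact this.mul_left (2 / κ)
  have hnn : ∀ m : ℕ, 0 ≤ (2 / κ) * ((m : ℝ) ^ N * ‖q‖ ^ m) := fun m => by positivity
  refine ⟨∑' m : ℕ, (2 / κ) * ((m : ℝ) ^ N * ‖q‖ ^ m), tsum_nonneg hnn, ?_⟩
  intro w hw n
  have hu : ∀ j : ℕ, ‖q * (w * ω ^ j)‖ < 1 := by
    intro j; rw [norm_mul, norm_mul, norm_pow, hw, h.1]; simpa using hq
  have hsum : HasSum (fun m : ℕ => ∑ j ∈ Finset.range n, -((q * (w * ω ^ j)) ^ m / m).re)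
      (∑ j ∈ Finset.range n, Real.log ‖1 - q * (w * ω ^ j)‖) :=
    hasSum_sum (fun j _ => hasSum_log_norm_one_sub (hu j))
  rw [← hsum.tsum_eq, ← Real.norm_eq_abs]
  refine tsum_of_norm_bounded hs.hasSum fun m => ?_
  rw [Real.norm_eq_abs]
  exact h.abs_sum_term_le hN q w hw n m

lemma DioUnit.exists_prod_bounds {ω : ℂ} {κ τ : ℝ} (h : DioUnit ω κ τ) {q : ℂ} (hq : ‖q‖ < 1) :
    ∃ C : ℝ, 1 ≤ C ∧ ∀ (w : ℂ), ‖w‖ = 1 → ∀ n : ℕ,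
      ∏ j ∈ Finset.range n, ‖1 - q * (w * ω ^ j)‖ ≤ C ∧
      C⁻¹ ≤ ∏ j ∈ Finset.range n, ‖1 - q * (w * ω ^ j)‖ := by
  obtain ⟨B, hB0, hB⟩ := h.exists_abs_sum_log_le hq
  refine ⟨Real.exp B, Real.one_le_exp hB0, fun w hw n => ?_⟩
  have hpos : ∀ j ∈ Finset.range n, 0 < ‖1 - q * (w * ω ^ j)‖ := by
    intro j _
    rw [norm_pos_iff, sub_ne_zero]
    intro h1
    have : ‖q * (w * ω ^ j)‖ < 1 := by
      rw [norm_mul, norm_mul, norm_pow, hw, h.1]; simpa using hq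
    rw [← h1] at this; simp at this
  have hP := Finset.prod_pos hpos
  have hl : Real.log (∏ j ∈ Finset.range n, ‖1 - q * (w * ω ^ j)‖) =
      ∑ j ∈ Finset.range n, Real.log ‖1 - q * (w * ω ^ j)‖ :=
    Real.log_prod fun j hj => (hpos j hj).ne'
  have hk := abs_le.1 (hB w hw n)
  rw [← hl] at hk
  constructor
  · rw [← Real.log_le_iff_le_exp hP]; exact hk.2
  · rw [← Real.exp_neg, ← Real.le_log_iff_exp_le hP]; exact hk.1

lemma DioUnit.norm_mul_pow {ω : ℂ} {κ τ : ℝ} (h : DioUnit ω κ τ) {w : ℂ} (hw : ‖w‖ = 1) (j : ℕ) :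
    ‖w * ω ^ j‖ = 1 := by
  rw [norm_mul, norm_pow, hw, h.1, one_pow, one_mul]

lemma DioUnit.exists_far {ω : ℂ} {κ τ : ℝ} (h : DioUnit ω κ τ) {w : ℂ} (hw : ‖w‖ = 1)
    {n l : ℕ} {S : Finset ℕ} (hS : S ⊆ Finset.range n) (hl : 1 ≤ l) (hc : S.card = l + 1) :
    ∃ j ∈ S, κ / 2 * ((l : ℝ) / n) ^ τ ≤ ‖1 - w * ω ^ j‖ := by
  obtain ⟨hω, hκ, hτ, hD⟩ := h
  have hn : 0 < n := by
    rcases Nat.eq_zero_or_pos n with rfl | h0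
    · simp at hS; subst hS; simp at hc
    · exact h0
  have hmaps : ∀ j ∈ S, j * l / n ∈ Finset.range l := by
    intro j hj
    have := Finset.mem_range.1 (hS hj)
    rw [Finset.mem_range, Nat.div_lt_iff_lt_mul hn, mul_comm j l]
    exact Nat.mul_lt_mul_of_pos_left this hl
  obtain ⟨x, hx, y, hy, hxy, hf⟩ := Finset.exists_ne_map_eq_of_card_lt_of_maps_to
    (by rw [Finset.card_range, hc]; omega) hmaps
  wlog hlt : x < y generalizing x y
  · exact this y hy x hx (Ne.symm hxy) hf.symm (lt_of_le_of_ne (not_lt.1 hlt) (Ne.symm hxy))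
  obtain ⟨m, rfl⟩ := Nat.exists_eq_add_of_lt hlt
  have hm : (m + 1) * l < n := by
    have h1 := Nat.div_add_mod (x * l) n
    have h2 := Nat.div_add_mod ((x + m + 1) * l) n
    have h3 := Nat.mod_lt ((x + m + 1) * l) hn
    rw [← hf] at h2
    have : (x + m + 1) * l = x * l + (m + 1) * l := by ring
    omega
  have hd := hD (m + 1) (Nat.succ_pos _)
  have hle : κ * ((l : ℝ) / n) ^ τ ≤ ‖1 - ω ^ (m + 1)‖ := by
    refine le_trans ?_ hd
    have h1 : (0 : ℝ) < ((m + 1 : ℕ) : ℝ) := by positivity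
    rw [div_eq_mul_inv κ, ← Real.inv_rpow h1.le]
    gcongr
    rw [div_le_iff₀ (by exact_mod_cast hn), inv_mul_eq_div, le_div_iff₀ h1]
    rw [mul_comm]; exact_mod_cast hm.le
  have htri : ‖1 - ω ^ (m + 1)‖ ≤ ‖1 - w * ω ^ x‖ + ‖1 - w * ω ^ (x + m + 1)‖ := by
    have e : w * ω ^ x - w * ω ^ (x + m + 1) = w * ω ^ x * (1 - ω ^ (m + 1)) := by ring
    have e2 : ‖w * ω ^ x - w * ω ^ (x + m + 1)‖ = ‖1 - ω ^ (m + 1)‖ := by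
      rw [e, norm_mul, norm_mul, norm_pow, hw, hω, one_pow, one_mul, one_mul]
    rw [← e2]
    have : w * ω ^ x - w * ω ^ (x + m + 1) =
      (1 - w * ω ^ (x + m + 1)) - (1 - w * ω ^ x) := by ring
    rw [this]
    exact (norm_sub_le _ _).trans (add_comm _ _).le
  by_cases hcase : κ / 2 * ((l : ℝ) / n) ^ τ ≤ ‖1 - w * ω ^ x‖
  · exact ⟨x, hx, hcase⟩
  · exact ⟨_, hy, by linarith [not_le.1 hcase]⟩

lemma DioUnit.sum_rpow_erase_le {ω : ℂ} {κ τ : ℝ} (h : DioUnit ω κ τ) {w : ℂ} (hw : ‖w‖ = 1)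
    {n : ℕ} (hn : 0 < n) (l : ℕ) :
    ∀ S : Finset ℕ, S ⊆ Finset.range n → S.card = l + 1 →
    ∃ j₀ ∈ S, (∀ j ∈ S.erase j₀, 0 < ‖1 - w * ω ^ j‖) ∧
      ∑ j ∈ S.erase j₀, ‖1 - w * ω ^ j‖ ^ (-(1 / (2 * τ))) ≤
        (2 / κ) ^ (1 / (2 * τ)) * √n * (2 * √l) := by
  have hκ := h.2.1
  have hτ := h.2.2.1
  have hn' : (0 : ℝ) < n := by exact_mod_cast hn
  induction l with
  | zero =>
    intro S hS hc
    obtain ⟨a, rfl⟩ := Finset.card_eq_one.1 hc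
    exact ⟨a, by simp, by simp, by simp⟩
  | succ l ih =>
    intro S hS hc
    obtain ⟨j₁, hj₁, hfar⟩ := h.exists_far hw hS (Nat.succ_le_succ (Nat.zero_le l)) hc
    obtain ⟨j₀, hj₀, hpos, hsum⟩ := ih (S.erase j₁) ((Finset.erase_subset _ _).trans hS)
      (by rw [Finset.card_erase_of_mem hj₁, hc]; omega)
    have hne : j₁ ≠ j₀ := fun e => by subst e; simp at hj₀
    have hbase : 0 < κ / 2 * (((l + 1 : ℕ) : ℝ) / n) ^ τ := by positivity
    have hins : S.erase j₀ = insert j₁ ((S.erase j₁).erase j₀) := by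
      rw [Finset.erase_right_comm, Finset.insert_erase]
      exact Finset.mem_erase.2 ⟨hne, hj₁⟩
    refine ⟨j₀, Finset.mem_of_mem_erase hj₀, ?_, ?_⟩
    · intro j hj
      rw [hins, Finset.mem_insert] at hj
      rcases hj with rfl | hj
      · exact hbase.trans_le hfar
      · exact hpos j hj
    · rw [hins, Finset.sum_insert (by simp)]
      have h1 : ‖1 - w * ω ^ j₁‖ ^ (-(1 / (2 * τ))) ≤
          (2 / κ) ^ (1 / (2 * τ)) * √n * (1 / √((l + 1 : ℕ) : ℝ)) := by
        refine (Real.rpow_le_rpow_of_nonpos hbase hfar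
          (by rw [neg_nonpos]; positivity)).trans (le_of_eq ?_)
        rw [Real.rpow_neg hbase.le, Real.mul_rpow (by positivity) (by positivity),
          ← Real.rpow_mul (by positivity), mul_inv, ← Real.inv_rpow (by positivity),
          inv_div, mul_assoc]
        have : τ * (1 / (2 * τ)) = 1 / 2 := by field_simp
        rw [this, ← Real.sqrt_eq_rpow, Real.sqrt_div (by positivity)]
        rw [inv_div]; ring
      have h2 : 1 / √((l + 1 : ℕ) : ℝ) + 2 * √(l : ℝ) ≤ 2 * √((l + 1 : ℕ) : ℝ) := by
        have hb : 0 < √((l + 1 : ℕ) : ℝ) := Real.sqrt_pos.2 (by positivity)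
        have ha := Real.sqrt_nonneg (l : ℝ)
        have hb2 : √((l + 1 : ℕ) : ℝ) ^ 2 = l + 1 := by rw [Real.sq_sqrt (by positivity)]; simp
        have ha2 : √(l : ℝ) ^ 2 = l := Real.sq_sqrt (by positivity)
        rw [div_add' _ _ _ hb.ne', div_le_iff₀ hb]
        nlinarith [sq_nonneg (√((l + 1 : ℕ) : ℝ) - √(l : ℝ))]
      calc _ ≤ (2 / κ) ^ (1 / (2 * τ)) * √n * (1 / √((l + 1 : ℕ) : ℝ)) +
            (2 / κ) ^ (1 / (2 * τ)) * √n * (2 * √l) := add_le_add h1 hsum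
        _ = (2 / κ) ^ (1 / (2 * τ)) * √n * (1 / √((l + 1 : ℕ) : ℝ) + 2 * √(l : ℝ)) := by ring
        _ ≤ _ := by gcongr

lemma one_add_le_exp_rpow {u s : ℝ} (hu : 0 ≤ u) (hs : 0 < s) (hs1 : s ≤ 1) :
    1 + u ≤ Real.exp (1 / s * u ^ s) := by
  have h1 : (1 + u) ^ s ≤ 1 + u ^ s := by
    simpa using Real.rpow_add_le_add_rpow zero_le_one hu hs.le hs1
  have h2 : (1 + u) ^ s ≤ Real.exp (u ^ s) := h1.trans (by linarith [Real.add_one_le_exp (u ^ s)])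
  have h3 := Real.rpow_le_rpow (by positivity) h2 (z := 1 / s) (by positivity)
  rw [← Real.rpow_mul (by positivity), mul_one_div_cancel hs.ne', Real.rpow_one,
    ← Real.exp_mul] at h3
  rwa [mul_comm]

lemma DioUnit.exists_lower_prod {ω : ℂ} {κ τ : ℝ} (h : DioUnit ω κ τ) {ε : ℝ} (hε : 0 < ε) :
    ∃ C : ℝ, 1 ≤ C ∧ ∀ w : ℂ, ‖w‖ = 1 → ∀ n : ℕ, 0 < n → ∃ j₀,
      C⁻¹ * Real.exp (-(ε * n)) ≤ ∏ j ∈ (Finset.range n).erase j₀, ‖1 - w * ω ^ j‖ := by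
  have hκ := h.2.1
  have hτ := h.2.2.1
  set s := 1 / (2 * τ) with hs
  have hs0 : 0 < s := by positivity
  have hs1 : s ≤ 1 := by
    rw [hs, div_le_one (by positivity)]; linarith
  set K := 1 / s * ((2 / κ) ^ s * 2) with hK
  have hK0 : 0 < K := by positivity
  obtain ⟨η, hη0, hη1, hηK⟩ : ∃ η : ℝ, 0 < η ∧ η < 1 ∧ η ^ s * K ≤ ε := by
    refine ⟨min (1 / 2) ((ε / K) ^ (1 / s)), by positivity,
      lt_of_le_of_lt (min_le_left _ _) (by norm_num), ?_⟩
    rw [← le_div_iff₀ hK0]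
    calc _ ≤ ((ε / K) ^ (1 / s)) ^ s := by gcongr; exact min_le_right _ _
      _ = ε / K := by
        rw [← Real.rpow_mul (by positivity), one_div_mul_cancel hs0.ne', Real.rpow_one]
  obtain ⟨C, hC1, hC⟩ := h.exists_prod_bounds (q := ((1 - η : ℝ) : ℂ))
    (by rw [Complex.norm_real, Real.norm_eq_abs, abs_of_pos] <;> linarith)
  refine ⟨2 * C, by linarith, fun w hw n hn => ?_⟩
  obtain ⟨m, rfl⟩ := Nat.exists_eq_add_of_lt hn
  rw [zero_add] at *
  obtain ⟨j₀, hj₀, hpos, hsum⟩ := h.sum_rpow_erase_le hw hn m _ subset_rfl (Finset.card_range _)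
  refine ⟨j₀, ?_⟩
  set S := (Finset.range (m + 1)).erase j₀ with hS
  have hnorm := h.norm_mul_pow hw
  have hfac : ∀ j, ‖1 - ((1 - η : ℝ) : ℂ) * (w * ω ^ j)‖ ≤ ‖1 - w * ω ^ j‖ + η := by
    intro j
    have e : 1 - ((1 - η : ℝ) : ℂ) * (w * ω ^ j) = (1 - w * ω ^ j) + (η : ℂ) * (w * ω ^ j) := by
      push_cast; ring
    rw [e]
    refine (norm_add_le _ _).trans ?_
    rw [norm_mul, hnorm, Complex.norm_real, Real.norm_eq_abs, abs_of_pos hη0, mul_one]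
  have h1 : C⁻¹ / 2 ≤ ∏ j ∈ S, ‖1 - ((1 - η : ℝ) : ℂ) * (w * ω ^ j)‖ := by
    have hl := (hC w hw (m + 1)).2
    rw [← Finset.prod_erase_mul _ _ hj₀, ← hS] at hl
    have h2 : ‖1 - ((1 - η : ℝ) : ℂ) * (w * ω ^ j₀)‖ ≤ 2 := by
      refine (norm_sub_le _ _).trans ?_
      rw [norm_mul, hnorm, Complex.norm_real, Real.norm_eq_abs, abs_of_pos (by linarith)]
      norm_num; linarith
    rw [div_le_iff₀ two_pos]
    exact hl.trans (mul_le_mul_of_nonneg_left h2 (Finset.prod_nonneg fun _ _ => norm_nonneg _))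
  have h2 : ∏ j ∈ S, ‖1 - ((1 - η : ℝ) : ℂ) * (w * ω ^ j)‖ ≤
      (∏ j ∈ S, ‖1 - w * ω ^ j‖) * Real.exp (ε * (m + 1 : ℕ)) := by
    have h3 : ∏ j ∈ S, ‖1 - ((1 - η : ℝ) : ℂ) * (w * ω ^ j)‖ ≤
        ∏ j ∈ S, (‖1 - w * ω ^ j‖ * Real.exp (1 / s * η ^ s * ‖1 - w * ω ^ j‖ ^ (-s))) := by
      refine Finset.prod_le_prod (fun _ _ => norm_nonneg _) fun j hj => (hfac j).trans ?_
      have hd := hpos j hj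
      have := one_add_le_exp_rpow (u := η / ‖1 - w * ω ^ j‖) (by positivity) hs0 hs1
      rw [Real.div_rpow hη0.le hd.le] at this
      rw [Real.rpow_neg hd.le]
      calc ‖1 - w * ω ^ j‖ + η = ‖1 - w * ω ^ j‖ * (1 + η / ‖1 - w * ω ^ j‖) := by field_simp
        _ ≤ _ := by
          rw [mul_assoc (1 / s), ← div_eq_mul_inv]
          exact mul_le_mul_of_nonneg_left this hd.le
    refine h3.trans ?_
    rw [Finset.prod_mul_distrib, ← Real.exp_sum, ← Finset.mul_sum]
    refine mul_le_mul_of_nonneg_left (Real.exp_le_exp.2 ?_)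
      (Finset.prod_nonneg fun _ _ => norm_nonneg _)
    have hsq : √((m + 1 : ℕ) : ℝ) * √(m : ℝ) ≤ ((m + 1 : ℕ) : ℝ) := by
      calc _ ≤ √((m + 1 : ℕ) : ℝ) * √((m + 1 : ℕ) : ℝ) := by gcongr; omega
        _ = _ := Real.mul_self_sqrt (by positivity)
    calc _ ≤ 1 / s * η ^ s * ((2 / κ) ^ s * √((m + 1 : ℕ) : ℝ) * (2 * √(m : ℝ))) := by
          gcongr
      _ = η ^ s * K * (√((m + 1 : ℕ) : ℝ) * √(m : ℝ)) := by rw [hK]; ring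
      _ ≤ ε * (m + 1 : ℕ) := by gcongr
  have h3 := h1.trans h2
  rw [Real.exp_neg, mul_inv, ← div_eq_mul_inv _ (Real.exp _), div_le_iff₀ (Real.exp_pos _)]
  calc _ = C⁻¹ / 2 := by ring
    _ ≤ _ := h3

lemma norm_one_sub_le_mul {z : ℂ} (hz : ‖z‖ = 1) {r : ℝ} (hr : 0 ≤ r) :
    (1 + r) * ‖1 - z‖ ≤ 2 * ‖1 - (r : ℂ) * z‖ := by
  have hz2 : z.re ^ 2 + z.im ^ 2 = 1 := by
    have := Complex.sq_norm z
    rw [hz, Complex.normSq_apply] at this; nlinarith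
  refine (sq_le_sq₀ (by positivity) (by positivity)).1 ?_
  rw [mul_pow, mul_pow, Complex.sq_norm, Complex.sq_norm, Complex.normSq_apply,
    Complex.normSq_apply]
  simp only [Complex.sub_re, Complex.one_re, Complex.sub_im, Complex.one_im, Complex.mul_re,
    Complex.mul_im, Complex.ofReal_re, Complex.ofReal_im]
  nlinarith [mul_nonneg (sq_nonneg (1 - r)) (show 0 ≤ 1 + z.re by nlinarith)]

lemma DioUnit.exists_upper_prod {ω : ℂ} {κ τ : ℝ} (h : DioUnit ω κ τ) {ε : ℝ} (hε : 0 < ε) :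
    ∃ C : ℝ, 1 ≤ C ∧ ∀ w : ℂ, ‖w‖ = 1 → ∀ n i : ℕ,
      ∏ j ∈ (Finset.range n).erase i, ‖1 - w * ω ^ j‖ ≤ C * Real.exp (ε * n) := by
  obtain ⟨r, hr0, hr1, hrε⟩ : ∃ r : ℝ, 0 < r ∧ r < 1 ∧ 2 / (1 + r) ≤ Real.exp ε := by
    have he : 1 < Real.exp ε := by rw [Real.one_lt_exp_iff]; exact hε
    refine ⟨max (1 / 2) (2 / Real.exp ε - 1), by positivity, max_lt (by norm_num) ?_, ?_⟩
    · have : 2 / Real.exp ε < 2 := by rw [div_lt_iff₀ (by positivity)]; linarith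
      linarith
    · have h1 : (0 : ℝ) < 2 / Real.exp ε := by positivity
      have h2 := le_max_right (1 / 2) (2 / Real.exp ε - 1)
      rw [div_le_comm₀ (by positivity) (by positivity)]
      linarith
  obtain ⟨C, hC1, hC⟩ := h.exists_prod_bounds (q := (r : ℂ))
    (by rw [Complex.norm_real, Real.norm_eq_abs, abs_of_pos] <;> linarith)
  have h1r : 0 < 1 - r := by linarith
  refine ⟨C * (1 - r)⁻¹, one_le_mul_of_one_le_of_one_le hC1 (one_le_inv₀ h1r |>.2 (by linarith)),
    fun w hw n i => ?_⟩
  have hnorm := h.norm_mul_pow hw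
  have hge : ∀ j : ℕ, 1 - r ≤ ‖1 - (r : ℂ) * (w * ω ^ j)‖ := by
    intro j
    have := norm_sub_norm_le (1 : ℂ) ((r : ℂ) * (w * ω ^ j))
    rw [norm_mul, hnorm, Complex.norm_real, Real.norm_eq_abs, abs_of_pos hr0, norm_one] at this
    linarith
  have h1 : ∏ j ∈ (Finset.range n).erase i, ‖1 - w * ω ^ j‖ ≤
      ∏ j ∈ (Finset.range n).erase i, (Real.exp ε * ‖1 - (r : ℂ) * (w * ω ^ j)‖) := by
    refine Finset.prod_le_prod (fun _ _ => norm_nonneg _) fun j _ => ?_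
    have h2 := norm_one_sub_le_mul (hnorm j) hr0.le
    calc ‖1 - w * ω ^ j‖ ≤ 2 / (1 + r) * ‖1 - (r : ℂ) * (w * ω ^ j)‖ := by
          rw [div_mul_eq_mul_div, le_div_iff₀ (by positivity)]; linarith
      _ ≤ _ := by gcongr
  have h2 : ∏ j ∈ (Finset.range n).erase i, ‖1 - (r : ℂ) * (w * ω ^ j)‖ ≤ C * (1 - r)⁻¹ := by
    have hu := (hC w hw n).1
    by_cases hi : i ∈ Finset.range n
    · rw [← Finset.prod_erase_mul _ _ hi] at hu
      rw [← div_eq_mul_inv, le_div_iff₀ h1r]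
      exact (mul_le_mul_of_nonneg_left (hge i)
        (Finset.prod_nonneg fun _ _ => norm_nonneg _)).trans hu
    · rw [Finset.erase_eq_of_notMem hi]
      exact hu.trans (le_mul_of_one_le_right (by linarith) ((one_le_inv₀ h1r).2 (by linarith)))
  refine h1.trans ?_
  rw [Finset.prod_mul_distrib, Finset.prod_const, mul_comm, ← Real.exp_nat_mul]
  have hcard : (((Finset.range n).erase i).card : ℝ) ≤ n := by
    exact_mod_cast (Finset.card_le_card (Finset.erase_subset _ _)).trans (Finset.card_range n).le
  have h1C : 0 ≤ C * (1 - r)⁻¹ := by positivity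
  refine mul_le_mul h2 (Real.exp_le_exp.2 ?_) (Real.exp_pos _).le h1C
  rw [mul_comm ε]
  exact mul_le_mul_of_nonneg_right hcard hε.le

lemma prod_Ico_int_erase_add (f : ℤ → ℝ) (a : ℤ) (n i : ℕ) :
    ∏ j ∈ (Finset.Ico a (a + n)).erase (a + i), f j =
      ∏ j ∈ (Finset.range n).erase i, f (a + j) := by
  symm
  refine Finset.prod_bij (fun j _ => a + (j : ℤ)) ?_ ?_ ?_ ?_
  · intro j hj
    simp only [Finset.mem_erase, Finset.mem_range, Finset.mem_Ico] at hj ⊢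
    omega
  · intro j _ j' _ h
    omega
  · intro j hj
    simp only [Finset.mem_erase, Finset.mem_range, Finset.mem_Ico] at hj ⊢
    exact ⟨(j - a).toNat, by omega, by omega⟩
  · intro j _; rfl

lemma exists_prod_Ico_int_erase (f : ℤ → ℝ) (a : ℤ) (n : ℕ) (i : ℤ) :
    ∃ i' : ℕ, ∏ j ∈ (Finset.Ico a (a + n)).erase i, f j =
      ∏ j ∈ (Finset.range n).erase i', f (a + j) := by
  by_cases hi : i < a
  · refine ⟨n, ?_⟩
    rw [← prod_Ico_int_erase_add, Finset.erase_eq_of_notMem, Finset.erase_eq_of_notMem] <;>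
      simp [hi]
  · refine ⟨(i - a).toNat, ?_⟩
    rw [← prod_Ico_int_erase_add]
    congr 2
    omega

lemma DioUnit.ne_zero {ω : ℂ} {κ τ : ℝ} (h : DioUnit ω κ τ) : ω ≠ 0 := by
  intro h0; have := h.1; simp [h0] at this

lemma DioUnit.norm_zpow {ω : ℂ} {κ τ : ℝ} (h : DioUnit ω κ τ) (a : ℤ) : ‖ω ^ a‖ = 1 := by
  rw [_root_.norm_zpow, h.1, one_zpow]

lemma DioUnit.exists_upper_prod_int {ω : ℂ} {κ τ : ℝ} (h : DioUnit ω κ τ) {ε : ℝ} (hε : 0 < ε) :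
    ∃ C : ℝ, 1 ≤ C ∧ ∀ w : ℂ, ‖w‖ = 1 → ∀ (a : ℤ) (n : ℕ) (i : ℤ),
      ∏ j ∈ (Finset.Ico a (a + n)).erase i, ‖1 - w * ω ^ j‖ ≤ C * Real.exp (ε * n) := by
  obtain ⟨C, hC1, hC⟩ := h.exists_upper_prod hε
  refine ⟨C, hC1, fun w hw a n i => ?_⟩
  obtain ⟨i', hi'⟩ := exists_prod_Ico_int_erase (fun j => ‖1 - w * ω ^ j‖) a n i
  rw [hi']
  have := hC (w * ω ^ a) (by rw [norm_mul, hw, h.norm_zpow, one_mul]) n i'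
  simpa only [zpow_add₀ h.ne_zero, zpow_natCast, mul_assoc] using this

lemma DioUnit.exists_lower_prod_int {ω : ℂ} {κ τ : ℝ} (h : DioUnit ω κ τ) {ε : ℝ} (hε : 0 < ε) :
    ∃ C : ℝ, 1 ≤ C ∧ ∀ w : ℂ, ‖w‖ = 1 → ∀ (a : ℤ) (n : ℕ) (i : ℤ) (δ : ℝ), 0 < δ → δ ≤ 1 →
      (∀ j ∈ (Finset.Ico a (a + n)).erase i, δ ≤ ‖1 - w * ω ^ j‖) →
      C⁻¹ * Real.exp (-(ε * n)) * δ ≤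
        ∏ j ∈ (Finset.Ico a (a + n)).erase i, ‖1 - w * ω ^ j‖ := by
  obtain ⟨C, hC1, hC⟩ := h.exists_lower_prod hε
  have hC0 : 0 < C := by linarith
  refine ⟨2 * C, by linarith, fun w hw a n i δ hδ hδ1 hlow => ?_⟩
  rcases Nat.eq_zero_or_pos n with rfl | hn
  · simp
    calc C⁻¹ * 2⁻¹ * δ ≤ 1 * 2⁻¹ * 1 := by gcongr; exact inv_le_one_of_one_le₀ hC1
      _ ≤ 1 := by norm_num
  obtain ⟨j₀, hj₀⟩ := hC (w * ω ^ a) (by rw [norm_mul, hw, h.norm_zpow, one_mul]) n hn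
  have e : ∏ j ∈ (Finset.range n).erase j₀, ‖1 - w * ω ^ a * ω ^ j‖ =
      ∏ j ∈ (Finset.Ico a (a + n)).erase (a + j₀), ‖1 - w * ω ^ j‖ := by
    rw [prod_Ico_int_erase_add (fun j => ‖1 - w * ω ^ j‖)]
    simp only [zpow_add₀ h.ne_zero, zpow_natCast, mul_assoc]
  rw [e] at hj₀
  set S := Finset.Ico a (a + n)
  set d : ℤ → ℝ := fun j => ‖1 - w * ω ^ j‖ with hd
  have hd0 : ∀ j, 0 ≤ d j := fun j => norm_nonneg _
  have hd2 : ∀ j, d j ≤ 2 := fun j => by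
    refine (norm_sub_le _ _).trans ?_
    rw [norm_mul, hw, h.norm_zpow]; norm_num
  have hX : 0 ≤ C⁻¹ * Real.exp (-(ε * n)) := by positivity
  have h1 : C⁻¹ * Real.exp (-(ε * n)) / 2 ≤ ∏ j ∈ (S.erase (a + j₀)).erase i, d j := by
    by_cases hi : i ∈ S.erase (a + j₀)
    · rw [← Finset.prod_erase_mul _ _ hi] at hj₀
      rw [div_le_iff₀ two_pos]
      exact hj₀.trans (mul_le_mul_of_nonneg_left (hd2 i) (Finset.prod_nonneg fun _ _ => hd0 _))
    · rw [Finset.erase_eq_of_notMem hi]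
      linarith [hj₀]
  have h2 : (∏ j ∈ (S.erase (a + j₀)).erase i, d j) * δ ≤ ∏ j ∈ S.erase i, d j := by
    rw [Finset.erase_right_comm]
    by_cases hj : a + (j₀ : ℤ) ∈ S.erase i
    · rw [← Finset.prod_erase_mul _ _ hj]
      exact mul_le_mul_of_nonneg_left (hlow _ hj) (Finset.prod_nonneg fun _ _ => hd0 _)
    · rw [Finset.erase_eq_of_notMem hj]
      exact mul_le_of_le_one_right (Finset.prod_nonneg fun _ _ => hd0 _) hδ1
  refine le_trans ?_ h2
  calc _ = C⁻¹ * Real.exp (-(ε * n)) / 2 * δ := by rw [mul_inv]; ring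
    _ ≤ _ := by gcongr

/-- Twice the cosine of the angle of `u` when `|u| = 1`. -/
def twoCos (u : ℂ) : ℂ := u + u⁻¹

lemma norm_twoCos_sub {u v : ℂ} (hu : ‖u‖ = 1) (hv : ‖v‖ = 1) :
    ‖twoCos u - twoCos v‖ = ‖1 - u⁻¹ * v‖ * ‖1 - u * v‖ := by
  have hu0 : u ≠ 0 := by intro h; simp [h] at hu
  have hv0 : v ≠ 0 := by intro h; simp [h] at hv
  have e : twoCos u - twoCos v = -v⁻¹ * ((1 - u⁻¹ * v) * (1 - u * v)) := by
    unfold twoCos; field_simp; ring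
  rw [e, norm_mul, norm_mul, norm_neg, norm_inv, hv, inv_one, one_mul]

/-- The interpolation nodes `ξ ω ^ j` have a subexponential Lebesgue constant. -/
lemma DioUnit.exists_ratio_le {ω : ℂ} {κ τ : ℝ} (h : DioUnit ω κ τ) {ε : ℝ} (hε : 0 < ε) :
    ∃ C : ℝ, 1 ≤ C ∧ ∀ (ξ : ℂ), ‖ξ‖ = 1 → ∀ (a₁ a₂ : ℤ) (n₁ n₂ : ℕ) (H : Finset ℤ),
      Disjoint (Finset.Ico a₁ (a₁ + n₁)) (Finset.Ico a₂ (a₂ + n₂)) →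
      H = Finset.Ico a₁ (a₁ + n₁) ∪ Finset.Ico a₂ (a₂ + n₂) →
      ∀ (i : ℤ) (δ : ℝ), 0 < δ → δ ≤ 1 →
      (∀ j ∈ H.erase i, δ ≤ ‖1 - ω ^ (j - i)‖ ∧ δ ≤ ‖1 - ξ ^ 2 * ω ^ (i + j)‖) →
      ∀ u : ℂ, ‖u‖ = 1 →
      (∏ j ∈ H.erase i, ‖twoCos u - twoCos (ξ * ω ^ j)‖) ≤
        C * Real.exp (ε * (n₁ + n₂)) * δ⁻¹ ^ 4 *
        ∏ j ∈ H.erase i, ‖twoCos (ξ * ω ^ i) - twoCos (ξ * ω ^ j)‖ := by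
  obtain ⟨C, hC1, hC⟩ := h.exists_upper_prod_int (ε := ε / 4) (by positivity)
  obtain ⟨D, hD1, hD⟩ := h.exists_lower_prod_int (ε := ε / 4) (by positivity)
  have hω0 := h.ne_zero
  refine ⟨C ^ 4 * D ^ 4, one_le_mul_of_one_le_of_one_le (one_le_pow₀ hC1) (one_le_pow₀ hD1), ?_⟩
  rintro ξ hξ a₁ a₂ n₁ n₂ H hdisj rfl i δ hδ hδ1 hlow u hu
  have hξ0 : ξ ≠ 0 := by intro h; simp [h] at hξ
  have hn : ∀ j : ℤ, ‖ξ * ω ^ j‖ = 1 := fun j => by rw [norm_mul, hξ, h.norm_zpow, one_mul]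
  have hui : ‖u⁻¹‖ = 1 := by rw [norm_inv, hu, inv_one]
  have hsplit : ∀ F : ℤ → ℝ, ∏ j ∈ (Finset.Ico a₁ (a₁ + n₁) ∪ Finset.Ico a₂ (a₂ + n₂)).erase i, F j
      = (∏ j ∈ (Finset.Ico a₁ (a₁ + n₁)).erase i, F j) *
        ∏ j ∈ (Finset.Ico a₂ (a₂ + n₂)).erase i, F j := by
    intro F
    rw [Finset.erase_union_distrib, Finset.prod_union]
    exact hdisj.mono (Finset.erase_subset _ _) (Finset.erase_subset _ _)
  have hup : ∀ (a : ℤ) (n : ℕ),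
      ∏ j ∈ (Finset.Ico a (a + n)).erase i, ‖twoCos u - twoCos (ξ * ω ^ j)‖ ≤
        C ^ 2 * Real.exp (ε / 2 * n) := by
    intro a n
    simp only [norm_twoCos_sub hu (hn _), ← mul_assoc]
    rw [Finset.prod_mul_distrib]
    have h1 := hC (u⁻¹ * ξ) (by rw [norm_mul, hui, hξ, one_mul]) a n i
    have h2 := hC (u * ξ) (by rw [norm_mul, hu, hξ, one_mul]) a n i
    calc _ ≤ (C * Real.exp (ε / 4 * n)) * (C * Real.exp (ε / 4 * n)) := by gcongr
      _ = _ := by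
        rw [show ε / 2 * n = ε / 4 * n + ε / 4 * n by ring, Real.exp_add]; ring
  have hlo : ∀ (a : ℤ) (n : ℕ), (∀ j ∈ (Finset.Ico a (a + n)).erase i,
      δ ≤ ‖1 - ω ^ (j - i)‖ ∧ δ ≤ ‖1 - ξ ^ 2 * ω ^ (i + j)‖) →
      (D ^ 2)⁻¹ * Real.exp (-(ε / 2 * n)) * δ ^ 2 ≤
      ∏ j ∈ (Finset.Ico a (a + n)).erase i, ‖twoCos (ξ * ω ^ i) - twoCos (ξ * ω ^ j)‖ := by
    intro a n hl
    have e1 : ∀ j : ℤ, (ξ * ω ^ i)⁻¹ * (ξ * ω ^ j) = ω ^ (-i) * ω ^ j := fun j => by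
      rw [zpow_neg]; field_simp
    have e2 : ∀ j : ℤ, (ξ * ω ^ i) * (ξ * ω ^ j) = ξ ^ 2 * ω ^ i * ω ^ j := fun j => by ring
    have e3 : ∀ j : ℤ, ω ^ (j - i) = ω ^ (-i) * ω ^ j := fun j => by
      rw [← zpow_add₀ hω0]; ring_nf
    have e4 : ∀ j : ℤ, ξ ^ 2 * ω ^ (i + j) = ξ ^ 2 * ω ^ i * ω ^ j := fun j => by
      rw [zpow_add₀ hω0]; ring
    simp only [norm_twoCos_sub (hn _) (hn _), e1, e2]
    rw [Finset.prod_mul_distrib]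
    simp only [e3, e4] at hl
    have h1 := hD (ω ^ (-i)) (h.norm_zpow _) a n i δ hδ hδ1 fun j hj => (hl j hj).1
    have h2 := hD (ξ ^ 2 * ω ^ i) (by rw [norm_mul, norm_pow, hξ, h.norm_zpow]; norm_num)
      a n i δ hδ hδ1 fun j hj => (hl j hj).2
    calc _ = (D⁻¹ * Real.exp (-(ε / 4 * n)) * δ) * (D⁻¹ * Real.exp (-(ε / 4 * n)) * δ) := by
          rw [show -(ε / 2 * n) = -(ε / 4 * n) + -(ε / 4 * n) by ring, Real.exp_add, ← inv_pow]
          ring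
      _ ≤ _ := mul_le_mul h1 h2 (by positivity) (Finset.prod_nonneg fun _ _ => norm_nonneg _)
  rw [hsplit, hsplit]
  have u1 := hup a₁ n₁
  have u2 := hup a₂ n₂
  have l1 := hlo a₁ n₁ fun j hj => hlow j (Finset.erase_subset_erase _ Finset.subset_union_left hj)
  have l2 := hlo a₂ n₂ fun j hj => hlow j (Finset.erase_subset_erase _ Finset.subset_union_right hj)
  have hl12 := mul_le_mul l1 l2 (by positivity) (Finset.prod_nonneg fun _ _ => norm_nonneg _)
  calc _ ≤ (C ^ 2 * Real.exp (ε / 2 * n₁)) * (C ^ 2 * Real.exp (ε / 2 * n₂)) :=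
        mul_le_mul u1 u2 (Finset.prod_nonneg fun _ _ => norm_nonneg _) (by positivity)
    _ = C ^ 4 * D ^ 4 * Real.exp (ε * (n₁ + n₂)) * δ⁻¹ ^ 4 *
        (((D ^ 2)⁻¹ * Real.exp (-(ε / 2 * n₁)) * δ ^ 2) *
          ((D ^ 2)⁻¹ * Real.exp (-(ε / 2 * n₂)) * δ ^ 2)) := by
      rw [show ε * ((n₁ : ℝ) + n₂) = ε / 2 * n₁ + ε / 2 * n₁ + (ε / 2 * n₂ + ε / 2 * n₂) by ring]
      simp only [Real.exp_add, Real.exp_neg]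
      field_simp
    _ ≤ _ := mul_le_mul_of_nonneg_left hl12 (by positivity)

lemma DioUnit.exists_interpolation_le {ω : ℂ} {κ τ : ℝ} (h : DioUnit ω κ τ) {ε : ℝ} (hε : 0 < ε) :
    ∃ C : ℝ, 1 ≤ C ∧ ∀ (ξ : ℂ), ‖ξ‖ = 1 → ∀ (a₁ a₂ : ℤ) (n₁ n₂ : ℕ),
      Disjoint (Finset.Ico a₁ (a₁ + n₁)) (Finset.Ico a₂ (a₂ + n₂)) →
      ∀ (δ : ℝ), 0 < δ → δ ≤ 1 →
      (∀ i ∈ Finset.Ico a₁ (a₁ + n₁) ∪ Finset.Ico a₂ (a₂ + n₂),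
        ∀ j ∈ Finset.Ico a₁ (a₁ + n₁) ∪ Finset.Ico a₂ (a₂ + n₂), j ≠ i →
          δ ≤ ‖1 - ω ^ (j - i)‖ ∧ δ ≤ ‖1 - ξ ^ 2 * ω ^ (i + j)‖) →
      ∀ p : Polynomial ℂ, p.natDegree < n₁ + n₂ →
      ∃ i ∈ Finset.Ico a₁ (a₁ + n₁) ∪ Finset.Ico a₂ (a₂ + n₂), ∀ u : ℂ, ‖u‖ = 1 →
        ‖p.eval (twoCos u)‖ ≤ (n₁ + n₂) * (C * Real.exp (ε * (n₁ + n₂)) * δ⁻¹ ^ 4) *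
          ‖p.eval (twoCos (ξ * ω ^ i))‖ := by
  obtain ⟨C, hC1, hC⟩ := h.exists_ratio_le hε
  refine ⟨C, hC1, fun ξ hξ a₁ a₂ n₁ n₂ hdisj δ hδ hδ1 hlow p hp => ?_⟩
  set H := Finset.Ico a₁ (a₁ + n₁) ∪ Finset.Ico a₂ (a₂ + n₂) with hH
  have hcard : H.card = n₁ + n₂ := by
    rw [hH, Finset.card_union_of_disjoint hdisj]; simp
  have hne : H.Nonempty := by
    rw [← Finset.card_pos, hcard]; omega
  obtain ⟨i, hi, hmax⟩ := H.exists_max_image (fun i => ‖p.eval (twoCos (ξ * ω ^ i))‖) hne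
  refine ⟨i, hi, fun u hu => ?_⟩
  have hn : ∀ j : ℤ, ‖ξ * ω ^ j‖ = 1 := fun j => by rw [norm_mul, hξ, h.norm_zpow, one_mul]
  have hpos : ∀ i ∈ H, ∀ j ∈ H, j ≠ i → 0 < ‖twoCos (ξ * ω ^ i) - twoCos (ξ * ω ^ j)‖ := by
    intro i hi j hj hji
    have hξ0 : ξ ≠ 0 := by intro h; simp [h] at hξ
    have hω0 := h.ne_zero
    obtain ⟨l1, l2⟩ := hlow i hi j hj hji
    rw [norm_twoCos_sub (hn _) (hn _)]
    have e1 : (ξ * ω ^ i)⁻¹ * (ξ * ω ^ j) = ω ^ (j - i) := by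
      rw [zpow_sub₀ hω0]; field_simp
    have e2 : (ξ * ω ^ i) * (ξ * ω ^ j) = ξ ^ 2 * ω ^ (i + j) := by
      rw [zpow_add₀ hω0]; ring
    rw [e1, e2]
    exact mul_pos (hδ.trans_le l1) (hδ.trans_le l2)
  have hinj : Set.InjOn (fun j : ℤ => twoCos (ξ * ω ^ j)) H := by
    intro x hx y hy hxy
    by_contra hne
    have := hpos x hx y hy (Ne.symm hne)
    simp only at hxy
    rw [hxy, sub_self, norm_zero] at this
    exact lt_irrefl _ this
  have hdeg : p.degree < H.card := by
    rw [hcard]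
    exact lt_of_le_of_lt Polynomial.degree_le_natDegree (by exact_mod_cast hp)
  have h_interp := Lagrange.eq_interpolate hinj hdeg
  have heval : p.eval (twoCos u) = ∑ i ∈ H, p.eval (twoCos (ξ * ω ^ i)) *
      ∏ j ∈ H.erase i, ((twoCos (ξ * ω ^ i) - twoCos (ξ * ω ^ j))⁻¹ *
        (twoCos u - twoCos (ξ * ω ^ j))) := by
    conv_lhs => rw [h_interp]
    rw [Lagrange.interpolate_apply, Polynomial.eval_finsetSum]
    refine Finset.sum_congr rfl fun i _ => ?_
    simp [Lagrange.basis, Lagrange.basisDivisor, Polynomial.eval_prod]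
  rw [heval]
  refine (norm_sum_le _ _).trans ?_
  have hterm : ∀ i' ∈ H, ‖p.eval (twoCos (ξ * ω ^ i')) *
      ∏ j ∈ H.erase i', ((twoCos (ξ * ω ^ i') - twoCos (ξ * ω ^ j))⁻¹ *
        (twoCos u - twoCos (ξ * ω ^ j)))‖ ≤
      ‖p.eval (twoCos (ξ * ω ^ i))‖ * (C * Real.exp (ε * (n₁ + n₂)) * δ⁻¹ ^ 4) := by
    intro i' hi'
    rw [norm_mul]
    refine mul_le_mul (hmax i' hi') ?_ (norm_nonneg _) (norm_nonneg _)
    have hr := hC ξ hξ a₁ a₂ n₁ n₂ H hdisj hH i' δ hδ hδ1 (fun j hj =>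
      hlow i' hi' j (Finset.mem_of_mem_erase hj) (Finset.ne_of_mem_erase hj)) u hu
    have hP : 0 < ∏ j ∈ H.erase i', ‖twoCos (ξ * ω ^ i') - twoCos (ξ * ω ^ j)‖ :=
      Finset.prod_pos fun j hj =>
        hpos i' hi' j (Finset.mem_of_mem_erase hj) (Finset.ne_of_mem_erase hj)
    rw [Finset.prod_mul_distrib, norm_mul, norm_prod, norm_prod, Finset.prod_congr rfl
      (fun j _ => norm_inv _), Finset.prod_inv_distrib, inv_mul_le_iff₀ hP, mul_comm]
    exact hr
  refine (Finset.sum_le_sum hterm).trans (le_of_eq ?_)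
  rw [Finset.sum_const, hcard, nsmul_eq_mul]
  push_cast
  ring

/-- The character `x ↦ e^{2πix}`. -/
def eC (x : ℝ) : ℂ := Complex.exp (2 * Real.pi * x * Complex.I)

lemma norm_eC (x : ℝ) : ‖eC x‖ = 1 := by
  have : eC x = Complex.exp ((2 * Real.pi * x : ℝ) * Complex.I) := by simp [eC]
  rw [this, Complex.norm_exp_ofReal_mul_I]

lemma eC_ne_zero (x : ℝ) : eC x ≠ 0 := Complex.exp_ne_zero _

lemma eC_add (x y : ℝ) : eC (x + y) = eC x * eC y := by
  rw [eC, eC, eC, ← Complex.exp_add]; push_cast; ring_nf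

lemma eC_int_mul (n : ℤ) (x : ℝ) : eC (n * x) = eC x ^ n := by
  rw [eC, eC, ← Complex.exp_int_mul]; push_cast; ring_nf

lemma eC_int (n : ℤ) : eC n = 1 := by
  rw [← Complex.exp_int_mul_two_pi_mul_I n, eC]; push_cast; ring_nf

lemma norm_one_sub_eC (x : ℝ) : ‖1 - eC x‖ = 2 * |Real.sin (Real.pi * x)| := by
  have := Complex.norm_exp_I_mul_ofReal_sub_one (2 * Real.pi * x)
  rw [norm_sub_rev, eC]
  rw [show (2 * Real.pi * x * Complex.I : ℂ) = Complex.I * ((2 * Real.pi * x : ℝ) : ℂ) by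
    push_cast; ring, this, norm_mul, Real.norm_eq_abs, Real.norm_eq_abs, abs_two,
    show 2 * Real.pi * x / 2 = Real.pi * x by ring]

lemma abs_sub_round_le_norm_one_sub_eC (x : ℝ) : |(round x : ℝ) - x| ≤ ‖1 - eC x‖ := by
  have h1 : eC x = eC (x - round x) := by
    conv_lhs => rw [show x = (x - round x) + (round x : ℤ) by ring]
    rw [eC_add, eC_int, mul_one]
  rw [h1, norm_one_sub_eC, abs_sub_comm]
  have h2 := abs_sub_round x
  have h3 : |Real.pi * (x - round x)| ≤ Real.pi / 2 := by
    rw [abs_mul, abs_of_pos Real.pi_pos]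
    nlinarith [Real.pi_pos]
  have h4 := Real.mul_abs_le_abs_sin h3
  rw [abs_mul, abs_of_pos Real.pi_pos] at h4
  have h5 : 2 / Real.pi * (Real.pi * |x - round x|) = 2 * |x - round x| := by
    field_simp
  rw [h5] at h4
  have := abs_nonneg (x - round x)
  linarith

lemma dioUnit_eC {Φ τ κ : ℝ} (hτ : 1 < τ) (hκ : 0 < κ)
    (hdio : ∀ n : ℤ, n ≠ 0 → ∀ j : ℤ, κ / |(n : ℝ)| ^ τ ≤ |(j : ℝ) - (n : ℝ) * Φ|) :
    DioUnit (eC Φ) κ τ := by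
  refine ⟨norm_eC Φ, hκ, hτ, fun m hm => ?_⟩
  have h1 := hdio m (by exact_mod_cast hm.ne') (round (((m : ℤ) : ℝ) * Φ))
  have h2 := abs_sub_round_le_norm_one_sub_eC (((m : ℤ) : ℝ) * Φ)
  rw [eC_int_mul, zpow_natCast] at h2
  refine le_trans ?_ (h1.trans h2)
  simp

lemma DioUnit.le_norm_one_sub_zpow {ω : ℂ} {κ τ : ℝ} (h : DioUnit ω κ τ) (l : ℤ) (hl : l ≠ 0) :
    κ / |(l : ℝ)| ^ τ ≤ ‖1 - ω ^ l‖ := by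
  have h1 := h.2.2.2 l.natAbs (by omega)
  have h2 : ((l.natAbs : ℕ) : ℝ) = |(l : ℝ)| := by
    rw [Nat.cast_natAbs, Int.cast_abs]
  rw [h2] at h1
  refine h1.trans (le_of_eq ?_)
  rcases Int.natAbs_eq l with h3 | h3
  · conv_rhs => rw [h3, zpow_natCast]
  · conv_rhs => rw [h3, zpow_neg, zpow_natCast]
    have h0 : ω ^ l.natAbs ≠ 0 := pow_ne_zero _ h.ne_zero
    have : 1 - (ω ^ l.natAbs)⁻¹ = -((ω ^ l.natAbs)⁻¹ * (1 - ω ^ l.natAbs)) := by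
      field_simp; ring
    rw [this, norm_neg, norm_mul, norm_inv, norm_pow, h.1]; simp

/-- Subexponential lower bounds for the small divisors at scale `p`. -/
lemma exists_small_divisor_bound {Φ θ τ κ : ℝ} (hτ : 1 < τ) (hκ : 0 < κ)
    (hdio : ∀ n : ℤ, n ≠ 0 → ∀ j : ℤ, κ / |(n : ℝ)| ^ τ ≤ |(j : ℝ) - (n : ℝ) * Φ|)
    (hres : {m : ℤ | |Real.sin (2 * Real.pi * (θ + ((m : ℝ) / 2) * Φ))| <
        Real.exp (-(|(m : ℝ)| / 2) ^ (1 / (2 * τ)))}.Finite) {ε : ℝ} (hε : 0 < ε) :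
    ∃ p₀ : ℕ, ∀ p : ℕ, p₀ ≤ p → ∀ l : ℤ, |l| ≤ 76 * p →
      (l ≠ 0 → Real.exp (-(ε * p)) ≤ ‖1 - eC Φ ^ l‖) ∧
      (2 * (p : ℤ) ≤ |l| → Real.exp (-(ε * p)) ≤ ‖1 - eC θ ^ 2 * eC Φ ^ l‖) := by
  have hD := dioUnit_eC hτ hκ hdio
  have hτ0 : 0 < τ := by linarith
  obtain ⟨R, hR⟩ := hres.bddAbove
  obtain ⟨R', hR'⟩ := hres.bddBelow
  have e1 : ∀ᶠ p : ℕ in Filter.atTop, (76 * (p : ℝ)) ^ τ * Real.exp (-(ε * p)) ≤ κ := by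
    have h1 : Filter.Tendsto (fun x : ℝ => 76 ^ τ * (x ^ τ * Real.exp (-ε * x)))
        Filter.atTop (nhds (76 ^ τ * 0)) :=
      (tendsto_rpow_mul_exp_neg_mul_atTop_nhds_zero τ ε hε).const_mul _
    rw [mul_zero] at h1
    have h2 := h1.comp tendsto_natCast_atTop_atTop
    filter_upwards [h2.eventually (ge_mem_nhds hκ)] with p hp
    simp only [Function.comp] at hp
    rw [Real.mul_rpow (by norm_num) (Nat.cast_nonneg p), mul_assoc, ← neg_mul]
    exact hp
  have e2 : ∀ᶠ p : ℕ in Filter.atTop, (38 * (p : ℝ)) ^ (1 / (2 * τ)) ≤ ε * p := by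
    have ha : 1 / (2 * τ) < 1 := by
      rw [div_lt_one (by linarith)]; linarith
    have h1 : Filter.Tendsto (fun x : ℝ => 38 ^ (1 / (2 * τ)) * x ^ (-(1 - 1 / (2 * τ))))
        Filter.atTop (nhds (38 ^ (1 / (2 * τ)) * 0)) :=
      (tendsto_rpow_neg_atTop (by linarith)).const_mul _
    rw [mul_zero] at h1
    have h2 := h1.comp tendsto_natCast_atTop_atTop
    filter_upwards [h2.eventually (ge_mem_nhds hε), Filter.eventually_gt_atTop 0] with p hp hp0
    simp only [Function.comp] at hp
    have hp' : (0 : ℝ) < p := by exact_mod_cast hp0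
    rw [Real.mul_rpow (by norm_num) hp'.le]
    have : (p : ℝ) ^ (1 / (2 * τ)) = (p : ℝ) ^ (-(1 - 1 / (2 * τ))) * p := by
      rw [← Real.rpow_add_one hp'.ne']; ring_nf
    rw [this, ← mul_assoc]
    exact mul_le_mul_of_nonneg_right hp hp'.le
  have e3 : ∀ᶠ p : ℕ in Filter.atTop, |R| + |R'| < p :=
    (tendsto_natCast_atTop_atTop (R := ℤ)).eventually_gt_atTop _
  obtain ⟨p₀, hp₀⟩ := Filter.eventually_atTop.1 (e1.and (e2.and e3))
  refine ⟨p₀, fun p hp l hl => ⟨fun hl0 => ?_, fun hl2 => ?_⟩⟩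
  · obtain ⟨h1, -, -⟩ := hp₀ p hp
    refine le_trans ?_ (hD.le_norm_one_sub_zpow l hl0)
    have hl1 : 0 < |(l : ℝ)| := abs_pos.2 (by exact_mod_cast hl0)
    rw [le_div_iff₀ (Real.rpow_pos_of_pos hl1 τ)]
    refine le_trans ?_ h1
    rw [mul_comm]
    have : |(l : ℝ)| ≤ 76 * p := by exact_mod_cast hl
    gcongr
  · obtain ⟨-, h2, h3⟩ := hp₀ p hp
    have hl' : |(l : ℝ)| / 2 ≤ 38 * p := by
      have : |(l : ℝ)| ≤ 76 * p := by exact_mod_cast hl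
      linarith
    have hn : l ∉ {m : ℤ | |Real.sin (2 * Real.pi * (θ + ((m : ℝ) / 2) * Φ))| <
        Real.exp (-(|(m : ℝ)| / 2) ^ (1 / (2 * τ)))} := by
      intro hm
      have a1 := hR hm
      have a2 := hR' hm
      have a3 := le_abs_self R
      have a4 := neg_abs_le R'
      have a5 := abs_nonneg R
      have a6 := abs_nonneg R'
      have : |l| ≤ |R| + |R'| := abs_le.2 ⟨by linarith, by linarith⟩
      omega
    simp only [Set.mem_ofPred_eq, not_lt] at hn
    have h4 : eC θ ^ 2 * eC Φ ^ l = eC (2 * (θ + ((l : ℝ) / 2) * Φ)) := by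
      rw [show 2 * (θ + ((l : ℝ) / 2) * Φ) = ((2 : ℤ) : ℝ) * θ + l * Φ by push_cast; ring, eC_add,
        eC_int_mul, eC_int_mul]; rfl
    rw [h4, norm_one_sub_eC, show Real.pi * (2 * (θ + ((l : ℝ) / 2) * Φ)) =
      2 * Real.pi * (θ + ((l : ℝ) / 2) * Φ) by ring]
    have h5 : Real.exp (-(ε * p)) ≤ Real.exp (-(|(l : ℝ)| / 2) ^ (1 / (2 * τ))) := by
      apply Real.exp_le_exp.2
      have : (|(l : ℝ)| / 2) ^ (1 / (2 * τ)) ≤ (38 * (p : ℝ)) ^ (1 / (2 * τ)) :=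
        Real.rpow_le_rpow (by positivity) hl' (by positivity)
      linarith
    have := abs_nonneg (Real.sin (2 * Real.pi * (θ + ((l : ℝ) / 2) * Φ)))
    linarith

/-- The entrywise `ℓ¹` norm of a `2 × 2` matrix. -/
def mN (M : Matrix (Fin 2) (Fin 2) ℂ) : ℝ := ∑ i, ∑ j, ‖M i j‖

lemma mN_nonneg (M : Matrix (Fin 2) (Fin 2) ℂ) : 0 ≤ mN M :=
  Finset.sum_nonneg fun _ _ => Finset.sum_nonneg fun _ _ => norm_nonneg _

lemma mN_eq (M : Matrix (Fin 2) (Fin 2) ℂ) :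
    mN M = ‖M 0 0‖ + ‖M 0 1‖ + (‖M 1 0‖ + ‖M 1 1‖) := by
  simp [mN, Fin.sum_univ_two]

lemma norm_le_mN (M : Matrix (Fin 2) (Fin 2) ℂ) (i j : Fin 2) : ‖M i j‖ ≤ mN M := by
  have h := mN_eq M
  have h1 := norm_nonneg (M 0 0)
  have h2 := norm_nonneg (M 0 1)
  have h3 := norm_nonneg (M 1 0)
  have h4 := norm_nonneg (M 1 1)
  fin_cases i <;> fin_cases j <;> simp only [Fin.zero_eta, Fin.mk_one] <;> linarith

lemma mN_mul_le (M N : Matrix (Fin 2) (Fin 2) ℂ) : mN (M * N) ≤ mN M * mN N := by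
  have key : ∀ i j, ‖(M * N) i j‖ ≤ ‖M i 0‖ * ‖N 0 j‖ + ‖M i 1‖ * ‖N 1 j‖ := fun i j => by
    rw [Matrix.mul_apply, Fin.sum_univ_two]
    refine (norm_add_le _ _).trans (le_of_eq ?_)
    rw [norm_mul, norm_mul]
  rw [mN_eq, mN_eq, mN_eq]
  have h1 := key 0 0
  have h2 := key 0 1
  have h3 := key 1 0
  have h4 := key 1 1
  have := fun i j k l => mul_nonneg (norm_nonneg (M i j)) (norm_nonneg (N k l))
  have a1 := this 0 0 1 0
  have a2 := this 0 0 1 1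
  have a3 := this 0 1 0 0
  have a4 := this 0 1 0 1
  have a5 := this 1 0 1 0
  have a6 := this 1 0 1 1
  have a7 := this 1 1 0 0
  have a8 := this 1 1 0 1
  linarith

/-- The bilinear form of a `2 × 2` matrix. -/
def bil (v : Fin 2 → ℂ) (M : Matrix (Fin 2) (Fin 2) ℂ) : ℂ :=
  v 0 * M 0 0 * v 0 + v 0 * M 0 1 * v 1 + (v 1 * M 1 0 * v 0 + v 1 * M 1 1 * v 1)

lemma bil_transpose (v : Fin 2 → ℂ) (M : Matrix (Fin 2) (Fin 2) ℂ) :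
    bil v M.transpose = bil v M := by
  simp only [bil, Matrix.transpose_apply]; ring

/-- Three test vectors whose quadratic forms control a matrix up to its determinant. -/
def testV : Fin 3 → Fin 2 → ℂ := ![![1, 0], ![0, 1], ![1, 1]]

lemma norm_testV_le (k : Fin 3) (i : Fin 2) : ‖testV k i‖ ≤ 1 := by
  fin_cases k <;> fin_cases i <;> simp [testV]

lemma mN_le_of_bil_le (M : Matrix (Fin 2) (Fin 2) ℂ) (q D : ℝ) (hD : 0 ≤ D)
    (hq : ∀ k, ‖bil (testV k) M‖ ≤ q) (hdet : ‖M.det‖ ≤ D ^ 2) : mN M ≤ 9 * q + 2 * D := by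
  have h0 : ‖M 0 0‖ ≤ q := by simpa [bil, testV] using hq 0
  have h1 : ‖M 1 1‖ ≤ q := by simpa [bil, testV] using hq 1
  have h2 : ‖M 0 0 + M 0 1 + (M 1 0 + M 1 1)‖ ≤ q := by simpa [bil, testV] using hq 2
  have hq0 : 0 ≤ q := (norm_nonneg _).trans h0
  rw [Matrix.det_fin_two] at hdet
  rw [mN_eq]
  set a := M 0 0
  set b := M 0 1
  set c := M 1 0
  set d := M 1 1
  have hs : ‖b + c‖ ≤ 3 * q := by
    have : b + c = (a + b + (c + d)) - a - d := by ring
    rw [this]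
    have e1 := norm_sub_le ((a + b + (c + d)) - a) d
    have e2 := norm_sub_le (a + b + (c + d)) a
    linarith
  have hbc : ‖b * c‖ ≤ q ^ 2 + D ^ 2 := by
    have : b * c = a * d - (a * d - b * c) := by ring
    rw [this]
    refine (norm_sub_le _ _).trans (add_le_add ?_ hdet)
    rw [norm_mul, sq]
    exact mul_le_mul h0 h1 (norm_nonneg _) hq0
  have hd2 : ‖b - c‖ ^ 2 ≤ (4 * q + 2 * D) ^ 2 := by
    rw [← norm_pow]
    have : (b - c) ^ 2 = (b + c) ^ 2 - 4 * (b * c) := by ring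
    rw [this]
    refine (norm_sub_le _ _).trans ?_
    rw [norm_pow, norm_mul]
    have : ‖(4 : ℂ)‖ = 4 := by simp
    rw [this]
    have e1 : ‖b + c‖ ^ 2 ≤ (3 * q) ^ 2 := by gcongr
    nlinarith [mul_nonneg hq0 hD]
  have hd : ‖b - c‖ ≤ 4 * q + 2 * D := abs_le_of_sq_le_sq' hd2 (by positivity) |>.2
  have hb : 2 * ‖b‖ ≤ ‖b + c‖ + ‖b - c‖ := by
    have := norm_add_le (b + c) (b - c)
    rwa [show b + c + (b - c) = 2 * b by ring, norm_mul, Complex.norm_ofNat] at this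
  have hc : 2 * ‖c‖ ≤ ‖b + c‖ + ‖b - c‖ := by
    have := norm_sub_le (b + c) (b - c)
    rwa [show b + c - (b - c) = 2 * c by ring, norm_mul, Complex.norm_ofNat] at this
  linarith

/-- The cocycle `B(ζω^{n-1}) ⋯ B(ζω) B(ζ)`. -/
def cocyc (B : ℂ → Matrix (Fin 2) (Fin 2) ℂ) (ω : ℂ) : ℕ → ℂ → Matrix (Fin 2) (Fin 2) ℂ
  | 0, _ => 1
  | n + 1, ζ => B (ζ * ω ^ n) * cocyc B ω n ζ

section Cocycle
variable (B : ℂ → Matrix (Fin 2) (Fin 2) ℂ) (ω : ℂ)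

lemma cocyc_zero (ζ : ℂ) : cocyc B ω 0 ζ = 1 := rfl

lemma cocyc_succ (n : ℕ) (ζ : ℂ) : cocyc B ω (n + 1) ζ = B (ζ * ω ^ n) * cocyc B ω n ζ := rfl

lemma cocyc_add (m n : ℕ) (ζ : ℂ) :
    cocyc B ω (m + n) ζ = cocyc B ω m (ζ * ω ^ n) * cocyc B ω n ζ := by
  induction m with
  | zero => simp [cocyc_zero]
  | succ m ih =>
    rw [show m + 1 + n = (m + n) + 1 by ring, cocyc_succ, ih, cocyc_succ, ← mul_assoc]
    congr 3
    rw [pow_add]; ring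

lemma cocyc_one (ζ : ℂ) : cocyc B ω 1 ζ = B ζ := by
  rw [cocyc_succ, cocyc_zero, pow_zero, mul_one, mul_one]

lemma det_cocyc (n : ℕ) (ζ : ℂ) :
    (cocyc B ω n ζ).det = ∏ j ∈ Finset.range n, (B (ζ * ω ^ j)).det := by
  induction n with
  | zero => rw [cocyc_zero, Matrix.det_one, Finset.range_zero, Finset.prod_empty]
  | succ n ih => rw [cocyc_succ, Matrix.det_mul, ih, Finset.prod_range_succ, mul_comm]

lemma transpose_cocyc_succ {B : ℂ → Matrix (Fin 2) (Fin 2) ℂ} {ω : ℂ} (hω : ω ≠ 0)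
    (hB : ∀ ζ, ζ ≠ 0 → B ζ⁻¹ = (B ζ).transpose) (n : ℕ) {ζ : ℂ} (hζ : ζ ≠ 0) :
    (cocyc B ω (n + 1) ζ).transpose = cocyc B ω (n + 1) (ζ * ω ^ n)⁻¹ := by
  induction n with
  | zero => rw [pow_zero, mul_one, zero_add, cocyc_one, cocyc_one, hB ζ hζ]
  | succ n ih =>
    rw [cocyc_succ, Matrix.transpose_mul, ih, cocyc_add B ω (n + 1) 1, cocyc_one,
      hB _ (mul_ne_zero hζ (pow_ne_zero _ hω))]
    congr 2
    rw [pow_one, pow_succ, ← mul_assoc, mul_inv (ζ * ω ^ n) ω, inv_mul_cancel_right₀ hω]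

end Cocycle

/-- `F` agrees off `0` with a Laurent polynomial with exponents in `[-k, k]`. -/
def LaurentDeg (k : ℕ) (F : ℂ → ℂ) : Prop :=
  ∃ q : Polynomial ℂ, q.natDegree ≤ 2 * k ∧ ∀ ξ, ξ ≠ 0 → ξ ^ k * F ξ = q.eval ξ

namespace LaurentDeg
variable {k m : ℕ} {F G : ℂ → ℂ}

lemma const (c : ℂ) : LaurentDeg k fun _ => c :=
  ⟨Polynomial.C c * Polynomial.X ^ k, (Polynomial.natDegree_C_mul_X_pow_le _ _).trans (by omega),
    fun ξ _ => by rw [Polynomial.eval_C_mul, Polynomial.eval_pow, Polynomial.eval_X, mul_comm]⟩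

lemma add (hF : LaurentDeg k F) (hG : LaurentDeg k G) : LaurentDeg k fun ξ => F ξ + G ξ := by
  obtain ⟨p, hp, hp'⟩ := hF
  obtain ⟨q, hq, hq'⟩ := hG
  exact ⟨p + q, (Polynomial.natDegree_add_le _ _).trans (max_le hp hq), fun ξ h => by
    rw [mul_add, hp' ξ h, hq' ξ h, Polynomial.eval_add]⟩

lemma mul (hF : LaurentDeg k F) (hG : LaurentDeg m G) :
    LaurentDeg (k + m) fun ξ => F ξ * G ξ := by
  obtain ⟨p, hp, hp'⟩ := hF
  obtain ⟨q, hq, hq'⟩ := hG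
  exact ⟨p * q, Polynomial.natDegree_mul_le.trans (by omega), fun ξ h => by
    rw [Polynomial.eval_mul, ← hp' ξ h, ← hq' ξ h, pow_add]; ring⟩

lemma const_mul (c : ℂ) (hF : LaurentDeg k F) : LaurentDeg k fun ξ => c * F ξ := by
  simpa using (const (k := 0) c).mul hF

lemma id : LaurentDeg 1 fun ξ => ξ :=
  ⟨Polynomial.X ^ 2, by simp, fun ξ _ => by simp [sq]⟩

lemma inv : LaurentDeg 1 fun ξ => ξ⁻¹ :=
  ⟨1, by simp, fun ξ h => by simp [h]⟩

lemma comp_mul (hF : LaurentDeg k F) {c : ℂ} (hc : c ≠ 0) : LaurentDeg k fun ξ => F (c * ξ) := by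
  obtain ⟨p, hp, hp'⟩ := hF
  refine ⟨Polynomial.C (c ^ k)⁻¹ * p.comp (Polynomial.C c * Polynomial.X), ?_, fun ξ h => ?_⟩
  · refine (Polynomial.natDegree_C_mul_le _ _).trans ?_
    refine Polynomial.natDegree_comp_le.trans ?_
    have : (Polynomial.C c * Polynomial.X : Polynomial ℂ).natDegree ≤ 1 := by
      simpa using Polynomial.natDegree_C_mul_X_pow_le c 1
    nlinarith
  · have := hp' (c * ξ) (mul_ne_zero hc h)
    simp only [Polynomial.eval_mul, Polynomial.eval_C, Polynomial.eval_comp, Polynomial.eval_X,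
      ← this, mul_pow]
    field_simp

end LaurentDeg

lemma eval_chebyshevC_twoCos {ξ : ℂ} (hξ : ξ ≠ 0) (n : ℕ) :
    (Polynomial.Chebyshev.C ℂ n).eval (twoCos ξ) = ξ ^ n + (ξ ^ n)⁻¹ := by
  induction n using Nat.twoStepInduction with
  | zero => norm_num
  | one => simp [twoCos]
  | more n h1 h2 =>
    push_cast at h1 h2 ⊢
    rw [Polynomial.Chebyshev.C_add_two, Polynomial.eval_sub, Polynomial.eval_mul,
      Polynomial.eval_X, h1, h2, twoCos]
    field_simp; ring

lemma natDegree_chebyshevC_le (n : ℕ) : (Polynomial.Chebyshev.C ℂ n).natDegree ≤ n := by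
  induction n using Nat.twoStepInduction with
  | zero => simp [show (2 : Polynomial ℂ) = Polynomial.C 2 from rfl]
  | one => simp
  | more n h1 h2 =>
    push_cast at h1 h2 ⊢
    rw [Polynomial.Chebyshev.C_add_two]
    refine (Polynomial.natDegree_sub_le _ _).trans (max_le ?_ (by omega))
    refine Polynomial.natDegree_mul_le.trans ?_
    rw [Polynomial.natDegree_X]; omega

/-- A Laurent polynomial invariant under inversion is a polynomial in `ξ + ξ⁻¹`. -/
lemma LaurentDeg.exists_eval_twoCos {k : ℕ} {F : ℂ → ℂ} (hF : LaurentDeg k F)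
    (hsymm : ∀ ξ, ξ ≠ 0 → F ξ⁻¹ = F ξ) :
    ∃ p : Polynomial ℂ, p.natDegree ≤ k ∧ ∀ ξ, ξ ≠ 0 → F ξ = p.eval (twoCos ξ) := by
  obtain ⟨q, hq, hq'⟩ := hF
  refine ⟨∑ i ∈ Finset.range (2 * k + 1), Polynomial.C (q.coeff i / 2) *
    Polynomial.Chebyshev.C ℂ ((((i : ℤ) - k).natAbs : ℕ) : ℤ), ?_, fun ξ h => ?_⟩
  · refine Polynomial.natDegree_sum_le_of_forall_le _ _ fun i hi => ?_
    refine (Polynomial.natDegree_C_mul_le _ _).trans ((natDegree_chebyshevC_le _).trans ?_)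
    have := Finset.mem_range.1 hi
    omega
  · have key : ∀ ξ : ℂ, ξ ≠ 0 →
        F ξ = ∑ i ∈ Finset.range (2 * k + 1), q.coeff i * ξ ^ ((i : ℤ) - k) := fun ξ h => by
      have h1 : F ξ = (ξ ^ k)⁻¹ * q.eval ξ := by rw [← hq' ξ h]; field_simp
      rw [h1, Polynomial.eval_eq_sum_range' (n := 2 * k + 1) (by omega), Finset.mul_sum]
      refine Finset.sum_congr rfl fun i _ => ?_
      rw [zpow_sub₀ h, zpow_natCast, zpow_natCast]; field_simp
    have h2 : F ξ = (F ξ + F ξ⁻¹) / 2 := by rw [hsymm ξ h]; ring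
    rw [h2, key ξ h, key ξ⁻¹ (inv_ne_zero h), ← Finset.sum_add_distrib, Finset.sum_div,
      Polynomial.eval_finsetSum]
    refine Finset.sum_congr rfl fun i _ => ?_
    rw [Polynomial.eval_mul, Polynomial.eval_C, eval_chebyshevC_twoCos h]
    have h3 : ξ ^ (((i : ℤ) - k).natAbs) + (ξ ^ (((i : ℤ) - k).natAbs))⁻¹ =
        ξ ^ ((i : ℤ) - k) + ξ⁻¹ ^ ((i : ℤ) - k) := by
      rw [inv_zpow]
      rcases Int.natAbs_eq ((i : ℤ) - k) with h4 | h4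
      · conv_rhs => rw [h4]
        rw [zpow_natCast]
      · conv_rhs => rw [h4]
        rw [zpow_neg, zpow_natCast, inv_inv, add_comm]
    rw [h3]; ring

lemma mN_one : mN 1 = 2 := by rw [mN_eq]; norm_num

/-- Existence of the Lyapunov exponent of a bounded cocycle that grows at rate at least `ρ`. -/
lemma exists_lyapunov {B : ℂ → Matrix (Fin 2) (Fin 2) ℂ} {ω : ℂ} (hω : ‖ω‖ = 1) {K c ρ : ℝ}
    (hK : ∀ ζ, ‖ζ‖ = 1 → mN (B ζ) ≤ K) (hc : 0 < c) (hρ : 0 < ρ)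
    (hlow : ∀ n : ℕ, ∃ ζ, ‖ζ‖ = 1 ∧ c * ρ ^ n ≤ mN (cocyc B ω n ζ)) :
    ∃ M : ℝ, Real.log ρ ≤ M ∧
      (∀ n : ℕ, ∃ ζ, ‖ζ‖ = 1 ∧ Real.exp (n * M) / 2 ≤ mN (cocyc B ω n ζ)) ∧
      ∀ ε, 0 < ε → ∃ C : ℝ, 1 ≤ C ∧ ∀ (n : ℕ) ζ, ‖ζ‖ = 1 →
        mN (cocyc B ω n ζ) ≤ C * Real.exp (n * (M + ε)) := by
  have hωn : ∀ n : ℕ, ‖ω ^ n‖ = 1 := fun n => by rw [norm_pow, hω, one_pow]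
  have hbd : ∀ (n : ℕ) ζ, ‖ζ‖ = 1 → mN (cocyc B ω n ζ) ≤ 2 * K ^ n := by
    intro n
    induction n with
    | zero => intro ζ _; rw [cocyc_zero, mN_one]; simp
    | succ n ih =>
      intro ζ hζ
      rw [cocyc_succ]
      refine (mN_mul_le _ _).trans ?_
      have h1 := hK (ζ * ω ^ n) (by rw [norm_mul, hζ, hωn, one_mul])
      have h2 := mul_le_mul h1 (ih ζ hζ) (mN_nonneg _) ((mN_nonneg _).trans h1)
      refine h2.trans (le_of_eq (by ring))
  set N : ℕ → ℝ := fun n => ⨆ ζ : Circle, mN (cocyc B ω n ζ) with hN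
  have hbdd : ∀ n, BddAbove (Set.range fun ζ : Circle => mN (cocyc B ω n ζ)) := fun n =>
    ⟨2 * K ^ n, by rintro _ ⟨ζ, rfl⟩; exact hbd n ζ ζ.norm_coe⟩
  have hle : ∀ (n : ℕ) ζ, ‖ζ‖ = 1 → mN (cocyc B ω n ζ) ≤ N n := fun n ζ hζ =>
    le_ciSup (hbdd n) (⟨ζ, by simpa [Submonoid.unitSphere] using hζ⟩ : Circle)
  have hlowN : ∀ n, c * ρ ^ n ≤ N n := fun n => by
    obtain ⟨ζ, h1, h2⟩ := hlow n
    exact h2.trans (hle n ζ h1)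
  have hpos : ∀ n, 0 < N n := fun n => lt_of_lt_of_le (by positivity) (hlowN n)
  have hsub : Subadditive fun n => Real.log (N n) := fun m n => by
    rw [← Real.log_mul (hpos m).ne' (hpos n).ne']
    refine Real.log_le_log (hpos _) (ciSup_le fun ζ => ?_)
    rw [cocyc_add]
    refine (mN_mul_le _ _).trans ?_
    exact mul_le_mul (hle m _ (by rw [norm_mul, hωn, ζ.norm_coe, one_mul]))
      (hle n _ ζ.norm_coe) (mN_nonneg _) (hpos m).le
  have hlog : ∀ n : ℕ, Real.log c + n * Real.log ρ ≤ Real.log (N n) := fun n => by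
    rw [← Real.log_pow, ← Real.log_mul hc.ne' (pow_pos hρ n).ne']
    exact Real.log_le_log (by positivity) (hlowN n)
  have hbb : BddBelow (Set.range fun n : ℕ => Real.log (N n) / n) := by
    refine ⟨-|Real.log c| - |Real.log ρ|, ?_⟩
    rintro _ ⟨n, rfl⟩
    rcases Nat.eq_zero_or_pos n with rfl | hn
    · simp only [Nat.cast_zero, div_zero]
      have := abs_nonneg (Real.log c)
      have := abs_nonneg (Real.log ρ)
      linarith
    · have hn' : (1 : ℝ) ≤ n := by exact_mod_cast hn
      simp only
      rw [le_div_iff₀ (by linarith)]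
      have h1 := hlog n
      have h2 := neg_abs_le (Real.log c)
      have h3 := neg_abs_le (Real.log ρ)
      have h4 := abs_nonneg (Real.log c)
      nlinarith
  have htend := hsub.tendsto_lim hbb
  refine ⟨hsub.lim, ?_, fun n => ?_, fun ε hε => ?_⟩
  · have h1 : Filter.Tendsto (fun n : ℕ => Real.log c / n + Real.log ρ) Filter.atTop
        (nhds (0 + Real.log ρ)) := (tendsto_const_div_atTop_nhds_zero_nat _).add_const _
    rw [zero_add] at h1
    refine le_of_tendsto_of_tendsto h1 htend ?_
    filter_upwards [Filter.eventually_gt_atTop 0] with n hn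
    have hn' : (0 : ℝ) < n := by exact_mod_cast hn
    rw [le_div_iff₀ hn', add_mul, div_mul_cancel₀ _ hn'.ne']
    have := hlog n
    linarith
  · have h1 : Real.exp (n * hsub.lim) / 2 < N n := by
      rcases Nat.eq_zero_or_pos n with rfl | hn
      · have : N 0 = 2 := by simp [hN, cocyc_zero, mN_one]
        rw [this]; norm_num
      · have hn' : (0 : ℝ) < n := by exact_mod_cast hn
        have h2 := hsub.lim_le_div hbb hn.ne'
        rw [le_div_iff₀ hn', mul_comm, ← Real.exp_le_exp, Real.exp_log (hpos n)] at h2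
        have := hpos n
        linarith
    obtain ⟨ζ, hζ⟩ := exists_lt_of_lt_ciSup h1
    exact ⟨ζ, ζ.norm_coe, hζ.le⟩
  · have h1 := htend.eventually (ge_mem_nhds (show hsub.lim < hsub.lim + ε by linarith))
    obtain ⟨n₀, hn₀⟩ := Filter.eventually_atTop.1 (h1.and (Filter.eventually_gt_atTop 0))
    set S : ℝ := ∑ n ∈ Finset.range n₀, N n * Real.exp (-(n * (hsub.lim + ε)))
    have hS : 0 ≤ S := Finset.sum_nonneg fun n _ => mul_nonneg (hpos n).le (Real.exp_pos _).le
    refine ⟨1 + S, by linarith, fun n ζ hζ => (hle n ζ hζ).trans ?_⟩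
    rcases lt_or_ge n n₀ with h2 | h2
    · have h3 : N n * Real.exp (-(n * (hsub.lim + ε))) ≤ S :=
        Finset.single_le_sum (f := fun n : ℕ => N n * Real.exp (-(n * (hsub.lim + ε))))
          (fun n _ => mul_nonneg (hpos n).le (Real.exp_pos _).le) (Finset.mem_range.2 h2)
      have h4 : N n = N n * Real.exp (-(n * (hsub.lim + ε))) * Real.exp (n * (hsub.lim + ε)) := by
        rw [mul_assoc, ← Real.exp_add, neg_add_cancel, Real.exp_zero, mul_one]
      rw [h4]
      gcongr
      linarith
    · obtain ⟨h3, h4⟩ := hn₀ n h2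
      have hn' : (0 : ℝ) < n := by exact_mod_cast h4
      rw [div_le_iff₀ hn', mul_comm, ← Real.exp_le_exp, Real.exp_log (hpos n)] at h3
      refine h3.trans ?_
      have := Real.exp_pos (n * (hsub.lim + ε))
      nlinarith

/-- The prefactor `1/k` in the definitions of the sampling functions. -/
def kF (t : ℝ) : ℝ := 1 / (-(1 + t ^ 2))

/-- The sampling function `g` in the variable `ζ = e^{2πix}`. -/
def gZ (t l : ℝ) (ζ : ℂ) : ℂ :=
  (kF t : ℂ) * (-(((t ^ 2 * l : ℝ)) : ℂ) * ζ + (l : ℂ) * ζ⁻¹ + ((2 * t * sq1 l : ℝ) : ℂ))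

/-- The sampling function `f` in the variable `ζ = e^{2πix}`. -/
def fZ (t l : ℝ) (ζ : ℂ) : ℂ :=
  (kF t : ℂ) * (((t * l : ℝ) : ℂ) * twoCos ζ + (((t ^ 2 - 1) * sq1 l : ℝ) : ℂ))

lemma gS_eq (t l x : ℝ) : gS t l x = gZ t l (eC x) := by
  have : Complex.exp (-(2 * Real.pi * x) * Complex.I) = (eC x)⁻¹ := by
    rw [eC, ← Complex.exp_neg]; ring_nf
  rw [gS, gZ, this]; rfl

lemma conj_eC (x : ℝ) : (starRingEnd ℂ) (eC x) = (eC x)⁻¹ :=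
  (Complex.inv_eq_conj (norm_eC x)).symm

lemma conj_gS_eq (t l x : ℝ) : (starRingEnd ℂ) (gS t l x) = gZ t l (eC x)⁻¹ := by
  simp only [gS_eq, gZ, map_mul, map_add, map_neg, Complex.conj_ofReal, map_inv₀, conj_eC]

lemma fS_eq (t l x : ℝ) : (fS t l x : ℂ) = fZ t l (eC x) := by
  have h : ((Real.cos (2 * Real.pi * x) : ℝ) : ℂ) = (eC x + (eC x)⁻¹) / 2 := by
    rw [Complex.ofReal_cos, Complex.cos, eC, ← Complex.exp_neg]; push_cast; ring_nf
  rw [fS, fZ, twoCos, kF]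
  rw [Complex.ofReal_mul, Complex.ofReal_add, Complex.ofReal_mul, h]
  push_cast; ring

lemma sq1_sq {l : ℝ} (hl : l ∈ Set.Ioo (0 : ℝ) 1) : sq1 l ^ 2 = 1 - l ^ 2 :=
  Real.sq_sqrt (by nlinarith [hl.1, hl.2])

lemma sq1_pos {l : ℝ} (hl : l ∈ Set.Ioo (0 : ℝ) 1) : 0 < sq1 l :=
  Real.sqrt_pos.2 (by nlinarith [hl.1, hl.2])

lemma fZ_sq_add {t l : ℝ} (hl : l ∈ Set.Ioo (0 : ℝ) 1) {ζ : ℂ} (hζ : ζ ≠ 0) :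
    fZ t l ζ ^ 2 + gZ t l ζ * gZ t l ζ⁻¹ = 1 := by
  have h1 : ((sq1 l : ℝ) : ℂ) ^ 2 = 1 - (l : ℂ) ^ 2 := by
    exact_mod_cast congrArg (fun x : ℝ => (x : ℂ)) (sq1_sq hl)
  have h2 : (kF t : ℂ) ^ 2 * (1 + (t : ℂ) ^ 2) ^ 2 = 1 := by
    have : kF t ^ 2 * (1 + t ^ 2) ^ 2 = 1 := by
      rw [kF]; field_simp
    exact_mod_cast congrArg (fun x : ℝ => (x : ℂ)) this
  have h3 : ζ * ζ⁻¹ = 1 := mul_inv_cancel₀ hζ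
  rw [fZ, gZ, gZ, twoCos, inv_inv]
  push_cast
  generalize ζ⁻¹ = y at *
  linear_combination h2 + (kF t : ℂ) ^ 2 * (1 + (t : ℂ) ^ 2) ^ 2 * h1 +
    (kF t : ℂ) ^ 2 * (l : ℂ) ^ 2 * (1 + (t : ℂ) ^ 2) ^ 2 * h3

/-- The cocycle matrix governing `u_n = (φ_{n-1}⁺, φ_n⁻)` where `φ = Q ψ`. -/
def tB (t l1 l2 : ℝ) (z ζ : ℂ) : Matrix (Fin 2) (Fin 2) ℂ :=
  !![(l1 : ℂ) ^ 2, -(l1 : ℂ) * (sq1 l1 + z * gZ t l2 ζ);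
    -(l1 : ℂ) * (sq1 l1 + z * gZ t l2 ζ⁻¹),
    z ^ 2 + (sq1 l1 : ℂ) ^ 2 + z * sq1 l1 * (gZ t l2 ζ + gZ t l2 ζ⁻¹)]

lemma tB_inv (t l1 l2 : ℝ) (z ζ : ℂ) : tB t l1 l2 z ζ⁻¹ = (tB t l1 l2 z ζ).transpose := by
  ext i j
  fin_cases i <;> fin_cases j <;> simp [tB]
  exact Or.inl (add_comm _ _)

lemma det_tB {t l1 l2 : ℝ} (hl : l2 ∈ Set.Ioo (0 : ℝ) 1) (z : ℂ) {ζ : ℂ} (hζ : ζ ≠ 0) :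
    (tB t l1 l2 z ζ).det = (l1 * z * fZ t l2 ζ) ^ 2 := by
  rw [tB, Matrix.det_fin_two_of]
  linear_combination -(l1 : ℂ) ^ 2 * z ^ 2 * fZ_sq_add (t := t) hl hζ

lemma exists_mN_tB_le (t l1 l2 : ℝ) {z : ℂ} (hz : ‖z‖ = 1) :
    ∃ K, ∀ ζ, ‖ζ‖ = 1 → mN (tB t l1 l2 z ζ) ≤ K := by
  obtain ⟨G, hG⟩ : ∃ G, ∀ ζ, ‖ζ‖ = 1 → ‖gZ t l2 ζ‖ ≤ G := by
    refine ⟨‖(kF t : ℂ)‖ * (‖-(((t ^ 2 * l2 : ℝ)) : ℂ)‖ * 1 + ‖(l2 : ℂ)‖ * 1⁻¹ +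
      ‖((2 * t * sq1 l2 : ℝ) : ℂ)‖), fun ζ hζ => ?_⟩
    rw [gZ, norm_mul]
    gcongr
    refine (norm_add₃_le).trans ?_
    rw [norm_mul, norm_mul, norm_inv, hζ]
  have hz2 : ‖z ^ 2‖ = 1 := by rw [norm_pow, hz, one_pow]
  refine ⟨‖(l1 : ℂ) ^ 2‖ + ‖-(l1 : ℂ)‖ * (‖(sq1 l1 : ℂ)‖ + G) +
    (‖-(l1 : ℂ)‖ * (‖(sq1 l1 : ℂ)‖ + G) +
      (1 + ‖(sq1 l1 : ℂ) ^ 2‖ + ‖(sq1 l1 : ℂ)‖ * (G + G))), fun ζ hζ => ?_⟩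
  have h1 := hG ζ hζ
  have h2 := hG ζ⁻¹ (by rw [norm_inv, hζ, inv_one])
  rw [mN_eq]
  simp only [tB, Matrix.of_apply, Matrix.cons_val_zero, Matrix.cons_val_one, Matrix.cons_val',
    Matrix.cons_val_fin_one]
  have e1 : ‖(sq1 l1 : ℂ) + z * gZ t l2 ζ‖ ≤ ‖(sq1 l1 : ℂ)‖ + G := by
    refine (norm_add_le _ _).trans ?_
    rw [norm_mul, hz, one_mul]; gcongr
  have e2 : ‖(sq1 l1 : ℂ) + z * gZ t l2 ζ⁻¹‖ ≤ ‖(sq1 l1 : ℂ)‖ + G := by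
    refine (norm_add_le _ _).trans ?_
    rw [norm_mul, hz, one_mul]; gcongr
  have e3 : ‖z ^ 2 + (sq1 l1 : ℂ) ^ 2 + z * sq1 l1 * (gZ t l2 ζ + gZ t l2 ζ⁻¹)‖ ≤
      1 + ‖(sq1 l1 : ℂ) ^ 2‖ + ‖(sq1 l1 : ℂ)‖ * (G + G) := by
    refine (norm_add₃_le).trans ?_
    rw [hz2, norm_mul, norm_mul z, hz, one_mul]
    gcongr
    exact (norm_add_le _ _).trans (add_le_add h1 h2)
  rw [norm_mul, norm_mul]
  gcongr

/-- Subharmonicity lower bound for the growth of a cocycle extending analytically to the disk. -/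
lemma exists_cocyc_growth {B C : ℂ → Matrix (Fin 2) (Fin 2) ℂ} {ω : ℂ} (hω : ‖ω‖ = 1)
    (hBC : ∀ ζ, ‖ζ‖ = 1 → C ζ = ζ • B ζ) (hC : ∀ i j, Differentiable ℂ fun ζ => C ζ i j)
    {w : Fin 2 → ℂ} {μ : ℂ} (hμ : μ ≠ 0) (hw0 : w 0 ≠ 0) (hw : (C 0).mulVec w = μ • w) :
    ∃ c : ℝ, 0 < c ∧ ∀ n : ℕ, ∃ ζ, ‖ζ‖ = 1 ∧ c * ‖μ‖ ^ n ≤ mN (cocyc B ω n ζ) := by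
  have hωn : ∀ n : ℕ, ‖ω ^ n‖ = 1 := fun n => by rw [norm_pow, hω, one_pow]
  have hw0' : 0 < ‖w 0‖ := norm_pos_iff.2 hw0
  have hμ' : 0 < ‖μ‖ := norm_pos_iff.2 hμ
  have hws : 0 < ‖w 0‖ + ‖w 1‖ := by positivity
  have hscal : ∀ (n : ℕ) ζ, ‖ζ‖ = 1 → ∃ s : ℂ, ‖s‖ = 1 ∧ cocyc C ω n ζ = s • cocyc B ω n ζ := by
    intro n ζ hζ
    induction n with
    | zero => exact ⟨1, by simp, by rw [cocyc_zero, cocyc_zero, one_smul]⟩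
    | succ n ih =>
      obtain ⟨s, hs, h⟩ := ih
      have h1 : ‖ζ * ω ^ n‖ = 1 := by rw [norm_mul, hζ, hωn, one_mul]
      refine ⟨ζ * ω ^ n * s, by rw [norm_mul, h1, hs, one_mul], ?_⟩
      rw [cocyc_succ, cocyc_succ, h, hBC _ h1, smul_mul_smul_comm]
  have hdiff : ∀ (n : ℕ) i j, Differentiable ℂ fun ζ => cocyc C ω n ζ i j := by
    intro n
    induction n with
    | zero => intro i j; simp only [cocyc_zero]; exact differentiable_const _
    | succ n ih =>
      intro i j
      simp only [cocyc_succ, Matrix.mul_apply, Fin.sum_univ_two]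
      have hc : ∀ i j, Differentiable ℂ fun ζ => C (ζ * ω ^ n) i j := fun i j =>
        (hC i j).comp (differentiable_id.mul_const _)
      exact ((hc i 0).mul (ih 0 j)).add ((hc i 1).mul (ih 1 j))
  have hzero : ∀ n : ℕ, (cocyc C ω n 0).mulVec w = μ ^ n • w := by
    intro n
    induction n with
    | zero => rw [cocyc_zero, Matrix.one_mulVec, pow_zero, one_smul]
    | succ n ih =>
      rw [cocyc_succ, zero_mul, ← Matrix.mulVec_mulVec, ih, Matrix.mulVec_smul, hw, smul_smul,
        pow_succ]
  refine ⟨‖w 0‖ / (2 * (‖w 0‖ + ‖w 1‖)), by positivity, fun n => ?_⟩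
  by_contra! hcon
  set G : ℂ → ℂ := fun ζ => cocyc C ω n ζ 0 0 * w 0 + cocyc C ω n ζ 0 1 * w 1 with hG
  have hGd : Differentiable ℂ G :=
    ((hdiff n 0 0).mul_const _).add ((hdiff n 0 1).mul_const _)
  have hG0 : G 0 = μ ^ n * w 0 := by
    have := congrFun (hzero n) 0
    simpa [Matrix.mulVec, dotProduct, Fin.sum_univ_two] using this
  have hb : ∀ ζ ∈ frontier (Metric.ball (0 : ℂ) 1), ‖G ζ‖ ≤ ‖w 0‖ * ‖μ‖ ^ n / 2 := by
    intro ζ hζ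
    rw [frontier_ball _ one_ne_zero, mem_sphere_zero_iff_norm] at hζ
    obtain ⟨s, hs, h⟩ := hscal n ζ hζ
    have h1 := (hcon ζ hζ).le
    have e : ∀ j, ‖cocyc C ω n ζ 0 j‖ ≤ mN (cocyc B ω n ζ) := fun j => by
      rw [h, Matrix.smul_apply, smul_eq_mul, norm_mul, hs, one_mul]
      exact norm_le_mN _ _ _
    calc ‖G ζ‖ ≤ mN (cocyc B ω n ζ) * ‖w 0‖ + mN (cocyc B ω n ζ) * ‖w 1‖ := by
          refine (norm_add_le _ _).trans ?_
          rw [norm_mul, norm_mul]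
          gcongr <;> exact e _
      _ = mN (cocyc B ω n ζ) * (‖w 0‖ + ‖w 1‖) := by ring
      _ ≤ ‖w 0‖ / (2 * (‖w 0‖ + ‖w 1‖)) * ‖μ‖ ^ n * (‖w 0‖ + ‖w 1‖) := by gcongr
      _ = ‖w 0‖ * ‖μ‖ ^ n / 2 := by field_simp
  have hmax := Complex.norm_le_of_forall_mem_frontier_norm_le Metric.isBounded_ball
    hGd.diffContOnCl hb (subset_closure (Metric.mem_ball_self one_pos))
  rw [hG0, norm_mul, norm_pow] at hmax
  have : 0 < ‖w 0‖ * ‖μ‖ ^ n := by positivity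
  linarith

/-- The dominant eigenvalue of the (rescaled) limit of the cocycle matrix at `ζ → 0`. -/
lemma exists_dominant_root {t l1 : ℝ} (hl1 : l1 ∈ Set.Ioo (0 : ℝ) 1)
    (hsub : l1 < (1 - t ^ 2) / (1 + t ^ 2)) :
    ∃ r : ℝ, l1 * |t| < r ∧ r ^ 2 - sq1 l1 * (1 - t ^ 2) * r + l1 ^ 2 * t ^ 2 = 0 := by
  have h1 := sq1_sq hl1
  have h2 := sq1_pos hl1
  rw [lt_div_iff₀ (by positivity)] at hsub
  have h3 : 0 < 1 - t ^ 2 := lt_trans (mul_pos hl1.1 (by positivity)) hsub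
  set Y := sq1 l1 * (1 - t ^ 2) with hY
  have hY0 : 0 < Y := mul_pos h2 h3
  have hd : 0 < Y ^ 2 - 4 * (l1 ^ 2 * t ^ 2) := by
    have h4 : (l1 * (1 + t ^ 2)) ^ 2 < (1 - t ^ 2) ^ 2 :=
      pow_lt_pow_left₀ hsub (mul_nonneg hl1.1.le (by positivity)) two_ne_zero
    rw [hY, mul_pow, h1]
    nlinarith
  have hs := Real.sq_sqrt hd.le
  have hs0 := Real.sqrt_pos.2 hd
  refine ⟨(Y + Real.sqrt (Y ^ 2 - 4 * (l1 ^ 2 * t ^ 2))) / 2, ?_, by nlinarith⟩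
  have h5 : (2 * (l1 * |t|)) ^ 2 < Y ^ 2 := by
    rw [mul_pow, mul_pow, sq_abs]; linarith
  have h6 := abs_lt_of_sq_lt_sq h5 hY0.le
  rw [abs_of_nonneg (mul_nonneg zero_le_two (mul_nonneg hl1.1.le (abs_nonneg t)))] at h6
  linarith

lemma exists_tB_growth {t l1 l2 r : ℝ} (hl1 : l1 ∈ Set.Ioo (0 : ℝ) 1)
    (hl2 : l2 ∈ Set.Ioo (0 : ℝ) 1) (hr0 : 0 < r)
    (hr : r ^ 2 - sq1 l1 * (1 - t ^ 2) * r + l1 ^ 2 * t ^ 2 = 0) {z ω : ℂ} (hz : ‖z‖ = 1)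
    (hω : ‖ω‖ = 1) :
    ∃ c : ℝ, 0 < c ∧ ∀ n : ℕ, ∃ ζ, ‖ζ‖ = 1 ∧
      c * (l2 / (1 + t ^ 2) * r) ^ n ≤ mN (cocyc (tB t l1 l2 z) ω n ζ) := by
  set C : ℂ → Matrix (Fin 2) (Fin 2) ℂ := fun ζ =>
    !![ζ * (l1 : ℂ) ^ 2, -(l1 : ℂ) * (sq1 l1 * ζ + z * ((kF t : ℂ) *
        (-(t ^ 2 * l2) * ζ ^ 2 + l2 + 2 * t * sq1 l2 * ζ)));
      -(l1 : ℂ) * (sq1 l1 * ζ + z * ((kF t : ℂ) *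
        (-(t ^ 2 * l2) + l2 * ζ ^ 2 + 2 * t * sq1 l2 * ζ))),
      ζ * (z ^ 2 + (sq1 l1 : ℂ) ^ 2) + z * sq1 l1 * ((kF t : ℂ) *
        (-(t ^ 2 * l2) * ζ ^ 2 + l2 + 2 * t * sq1 l2 * ζ) + (kF t : ℂ) *
        (-(t ^ 2 * l2) + l2 * ζ ^ 2 + 2 * t * sq1 l2 * ζ))] with hC
  have hz0 : z ≠ 0 := by intro h; simp [h] at hz
  have hk : kF t ≠ 0 := by rw [kF]; exact one_div_ne_zero (by nlinarith [sq_nonneg t])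
  have h := exists_cocyc_growth (B := tB t l1 l2 z) (C := C) hω (w := ![-(l1 : ℂ), (r : ℂ)])
    (μ := z * ((kF t * l2 * r : ℝ) : ℂ)) ?_ ?_ ?_ ?_ ?_
  · have hn : ‖z * ((kF t * l2 * r : ℝ) : ℂ)‖ = l2 / (1 + t ^ 2) * r := by
      rw [norm_mul, hz, one_mul, Complex.norm_real, Real.norm_eq_abs, abs_mul, abs_mul,
        abs_of_pos hr0, abs_of_pos hl2.1, kF, abs_div, abs_neg, abs_one,
        abs_of_pos (by positivity)]
      ring
    rwa [hn] at h
  · intro ζ hζ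
    have hζ0 : ζ ≠ 0 := by intro h; simp [h] at hζ
    have hi : ζ * ζ⁻¹ = 1 := mul_inv_cancel₀ hζ0
    ext i j
    fin_cases i <;> fin_cases j <;>
      simp only [hC, tB, gZ, Matrix.smul_apply, smul_eq_mul, Matrix.of_apply, Fin.zero_eta,
        Fin.mk_one, Matrix.cons_val_zero, Matrix.cons_val_one, Matrix.cons_val',
        Matrix.cons_val_fin_one, inv_inv] <;> push_cast <;> generalize ζ⁻¹ = y at * 
    · linear_combination l1 * z * kF t * l2 * hi
    · linear_combination -(l1 * z * kF t * l2 * t ^ 2) * hi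
    · linear_combination -z * sq1 l1 * kF t * l2 * (1 - t ^ 2) * hi
  · intro i j
    fin_cases i <;> fin_cases j <;>
      simp only [hC, Matrix.of_apply, Fin.zero_eta,
        Fin.mk_one, Matrix.cons_val_zero, Matrix.cons_val_one, Matrix.cons_val',
        Matrix.cons_val_fin_one] <;> fun_prop
  · have h1 : kF t * l2 * r ≠ 0 := mul_ne_zero (mul_ne_zero hk hl2.1.ne') hr0.ne'
    exact mul_ne_zero hz0 (by exact_mod_cast h1)
  · simpa using hl1.1.ne'
  · have hrC : (r : ℂ) ^ 2 - sq1 l1 * (1 - (t : ℂ) ^ 2) * r + (l1 : ℂ) ^ 2 * (t : ℂ) ^ 2 = 0 := by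
      exact_mod_cast congrArg (fun x : ℝ => (x : ℂ)) hr
    ext i
    fin_cases i <;> simp [hC, Matrix.mulVec, dotProduct, Fin.sum_univ_two]
    · ring
    · linear_combination -z * kF t * l2 * hrC

/-- The products `∏ |λ₁ f|` grow strictly slower than the cocycle. -/
lemma exists_prod_fZ_le {t l1 l2 r : ℝ} (hl1 : l1 ∈ Set.Ioo (0 : ℝ) 1)
    (hl2 : l2 ∈ Set.Ioo (0 : ℝ) 1) (hlt : l1 < l2) (ht : t ^ 2 < 1) (hrt : l1 * |t| < r)
    (hr : r ^ 2 - sq1 l1 * (1 - t ^ 2) * r + l1 ^ 2 * t ^ 2 = 0) {ω : ℂ} {κ τ : ℝ}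
    (h : DioUnit ω κ τ) :
    ∃ F C : ℝ, F < Real.log (l2 / (1 + t ^ 2) * r) ∧ 1 ≤ C ∧ ∀ (n : ℕ) ζ, ‖ζ‖ = 1 →
      ∏ j ∈ Finset.range n, ‖(l1 : ℂ) * fZ t l2 (ζ * ω ^ j)‖ ≤ C * Real.exp (n * F) := by
  have hs1 := sq1_sq hl1
  have hs2 := sq1_sq hl2
  have hp1 := sq1_pos hl1
  have hp2 := sq1_pos hl2
  have hωn : ∀ n : ℕ, ‖ω ^ n‖ = 1 := fun n => by rw [norm_pow, h.1, one_pow]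
  have ht1 : 0 < 1 - t ^ 2 := by linarith
  have htl : 0 ≤ l1 * |t| := mul_nonneg hl1.1.le (abs_nonneg t)
  have hr0 : 0 < r := htl.trans_lt hrt
  set γ := l2 / (1 + t ^ 2) with hγ
  have hγ0 : 0 < γ := div_pos hl2.1 (by positivity)
  set X := (1 - t ^ 2) * l1 * sq1 l2 / l2 with hX
  set Y := sq1 l1 * (1 - t ^ 2) with hY
  have hX0 : 0 < X := div_pos (mul_pos (mul_pos ht1 hl1.1) hp2) hl2.1
  have hXY : X < Y := by
    rw [hX, div_lt_iff₀ hl2.1, hY]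
    have : l1 * sq1 l2 < sq1 l1 * l2 := by
      refine lt_of_pow_lt_pow_left₀ 2 (by have := hl2.1; positivity) ?_
      rw [mul_pow, mul_pow, hs1, hs2]
      nlinarith [hl1.1, hl2.1]
    nlinarith
  have hfac : ∀ ζ, ‖(l1 : ℂ) * fZ t l2 ζ‖ = γ * ‖((l1 * t : ℝ) : ℂ) * twoCos ζ - (X : ℂ)‖ := by
    intro ζ
    have e1 : (l1 : ℂ) * fZ t l2 ζ =
        ((-γ : ℝ) : ℂ) * (((l1 * t : ℝ) : ℂ) * twoCos ζ - (X : ℂ)) := by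
      have hl2' : (l2 : ℂ) ≠ 0 := by exact_mod_cast hl2.1.ne'
      have ht' : (1 + (t : ℂ) ^ 2) ≠ 0 := by
        have : (1 + t ^ 2 : ℝ) ≠ 0 := by positivity
        exact_mod_cast this
      rw [fZ, hγ, hX, kF]
      push_cast
      rw [one_div, inv_neg]
      field_simp
      ring
    rw [e1, norm_mul, Complex.norm_real, norm_neg, Real.norm_of_nonneg hγ0.le]
  simp only [hfac]
  rcases le_or_gt (2 * (l1 * |t|)) X with hc | hc
  · have hq : ‖((l1 * t / r : ℝ) : ℂ)‖ < 1 := by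
      rw [Complex.norm_real, Real.norm_eq_abs, abs_div, abs_mul, abs_of_pos hl1.1,
        abs_of_pos hr0, div_lt_one hr0]
      exact hrt
    obtain ⟨C, hC1, hC⟩ := h.exists_prod_bounds hq
    set σ := (X + 2 * (l1 * |t|)) / (Y + 2 * (l1 * |t|)) with hσ
    have hY' : 0 < Y + 2 * (l1 * |t|) := by linarith
    have hσ0 : 0 < σ := div_pos (by linarith) hY'
    have hσ1 : σ < 1 := (div_lt_one hY').2 (by linarith)
    have hpt : ∀ ζ, ‖ζ‖ = 1 → ‖((l1 * t : ℝ) : ℂ) * twoCos ζ - (X : ℂ)‖ ≤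
        σ * r * ‖1 - ((l1 * t / r : ℝ) : ℂ) * ζ‖ ^ 2 := by
      intro ζ hζ
      have e1 : twoCos ζ = ((2 * ζ.re : ℝ) : ℂ) := by
        rw [twoCos, Complex.inv_eq_conj hζ, Complex.add_conj]
      have e2 : ζ.re ^ 2 + ζ.im ^ 2 = 1 := by
        have := Complex.sq_norm ζ
        rw [hζ, Complex.normSq_apply] at this
        linarith
      have e3 : |ζ.re| ≤ 1 := hζ ▸ Complex.abs_re_le_norm ζ
      have e4 : ‖1 - ((l1 * t / r : ℝ) : ℂ) * ζ‖ ^ 2 =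
          1 + (l1 * t / r) ^ 2 - (l1 * t / r) * (2 * ζ.re) := by
        rw [Complex.sq_norm, Complex.normSq_apply]
        simp only [Complex.sub_re, Complex.sub_im, Complex.one_re, Complex.one_im,
          Complex.re_ofReal_mul, Complex.im_ofReal_mul]
        linear_combination (l1 * t / r) ^ 2 * e2
      have e5 : r * ‖1 - ((l1 * t / r : ℝ) : ℂ) * ζ‖ ^ 2 = Y - l1 * t * (2 * ζ.re) := by
        rw [e4]; field_simp; linear_combination hr
      have e6 : |l1 * t * (2 * ζ.re)| ≤ 2 * (l1 * |t|) := by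
        rw [abs_mul, abs_mul, abs_mul, abs_of_pos hl1.1, abs_two]
        nlinarith
      have e7 := abs_le.1 e6
      rw [mul_assoc, e5, e1, ← Complex.ofReal_mul, ← Complex.ofReal_sub, Complex.norm_real,
        Real.norm_eq_abs, abs_sub_comm, abs_of_nonneg (by linarith), hσ, div_mul_eq_mul_div,
        le_div_iff₀ hY']
      nlinarith
    refine ⟨Real.log (γ * (σ * r)), C ^ 2, ?_, one_le_pow₀ hC1, fun n ζ hζ => ?_⟩
    · refine Real.log_lt_log (by positivity) ?_
      have : σ * r < 1 * r := by gcongr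
      rw [one_mul] at this
      gcongr
    · rw [← Real.log_pow, Real.exp_log (by positivity)]
      calc ∏ j ∈ Finset.range n, γ * ‖((l1 * t : ℝ) : ℂ) * twoCos (ζ * ω ^ j) - (X : ℂ)‖
          ≤ ∏ j ∈ Finset.range n,
            γ * (σ * r) * ‖1 - ((l1 * t / r : ℝ) : ℂ) * (ζ * ω ^ j)‖ ^ 2 := by
            refine Finset.prod_le_prod (fun j _ => by positivity) fun j _ => ?_
            rw [mul_assoc γ]
            exact mul_le_mul_of_nonneg_left (hpt _ (by rw [norm_mul, hζ, hωn, one_mul])) hγ0.le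
        _ = (γ * (σ * r)) ^ n *
            (∏ j ∈ Finset.range n, ‖1 - ((l1 * t / r : ℝ) : ℂ) * (ζ * ω ^ j)‖) ^ 2 := by
            rw [Finset.prod_mul_distrib, Finset.prod_const, Finset.card_range, Finset.prod_pow]
        _ ≤ (γ * (σ * r)) ^ n * C ^ 2 := by
            have := (hC ζ hζ n).1
            gcongr
        _ = _ := by ring
  · have htne : t ≠ 0 := by
      rintro rfl
      simp at hc; linarith
    have ha : 0 < l1 * |t| := mul_pos hl1.1 (abs_pos.2 htne)
    have hx1 : |X / (2 * (l1 * t))| ≤ 1 := by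
      rw [abs_div, abs_of_pos hX0, abs_mul, abs_two, abs_mul, abs_of_pos hl1.1,
        div_le_one (by positivity)]
      exact hc.le
    set α := Real.arccos (X / (2 * (l1 * t))) with hα
    have hcos : Real.cos α = X / (2 * (l1 * t)) :=
      Real.cos_arccos (abs_le.1 hx1).1 (abs_le.1 hx1).2
    set η : ℂ := Complex.exp (α * Complex.I) with hη
    have hη1 : ‖η‖ = 1 := Complex.norm_exp_ofReal_mul_I α
    have hηc : ((l1 * t : ℝ) : ℂ) * twoCos η = (X : ℂ) := by
      have e : twoCos η = ((2 * Real.cos α : ℝ) : ℂ) := by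
        rw [twoCos, Complex.inv_eq_conj hη1, Complex.add_conj, hη, Complex.exp_ofReal_mul_I_re]
      rw [e, hcos, ← Complex.ofReal_mul]
      congr 1
      have := hl1.1.ne'
      field_simp
    set ε := (Real.log (γ * r) - Real.log (γ * (l1 * |t|))) / 4 with hε
    have hlog : Real.log (γ * (l1 * |t|)) < Real.log (γ * r) :=
      Real.log_lt_log (by positivity) (by gcongr)
    have hε0 : 0 < ε := by rw [hε]; linarith
    obtain ⟨C, hC1, hC⟩ := h.exists_upper_prod hε0
    refine ⟨Real.log (γ * (l1 * |t|)) + 2 * ε, C ^ 2, by rw [hε]; linarith, one_le_pow₀ hC1,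
      fun n ζ hζ => ?_⟩
    have hηi : ‖η⁻¹‖ = 1 := by rw [norm_inv, hη1, inv_one]
    have hpt : ∀ j, γ * ‖((l1 * t : ℝ) : ℂ) * twoCos (ζ * ω ^ j) - (X : ℂ)‖ =
        γ * (l1 * |t|) * (‖1 - (η⁻¹ * ζ) * ω ^ j‖ * ‖1 - (η * ζ) * ω ^ j‖) := by
      intro j
      rw [← hηc, ← mul_sub, norm_mul, Complex.norm_real, Real.norm_eq_abs, abs_mul,
        abs_of_pos hl1.1, norm_sub_rev, norm_twoCos_sub hη1 (by rw [norm_mul, hζ, hωn, one_mul])]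
      simp only [mul_assoc]
    simp only [hpt]
    rw [Finset.prod_mul_distrib, Finset.prod_const, Finset.card_range, Finset.prod_mul_distrib]
    have c1 := hC (η⁻¹ * ζ) (by rw [norm_mul, hηi, hζ, one_mul]) n n
    have c2 := hC (η * ζ) (by rw [norm_mul, hη1, hζ, one_mul]) n n
    rw [Finset.erase_eq_of_notMem Finset.notMem_range_self] at c1 c2
    have e1 : Real.exp (n * (Real.log (γ * (l1 * |t|)) + 2 * ε)) =
        (γ * (l1 * |t|)) ^ n * (Real.exp (ε * n) * Real.exp (ε * n)) := by
      rw [mul_add, Real.exp_add, ← Real.log_pow, Real.exp_log (by positivity), ← Real.exp_add]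
      ring_nf
    rw [e1]
    calc _ ≤ (γ * (l1 * |t|)) ^ n * ((C * Real.exp (ε * n)) * (C * Real.exp (ε * n))) := by
          gcongr
      _ = _ := by ring

/-- A symmetric analytic cocycle with Lyapunov exponent `M`, whose determinant is the square of
a factor `s` growing at rate at most `F < M`. -/
structure IsSupercritical (B : ℂ → Matrix (Fin 2) (Fin 2) ℂ) (s : ℂ → ℂ) (ω : ℂ) (M F : ℝ) :
    Prop where
  lt : F < M
  transpose : ∀ ζ, ζ ≠ 0 → B ζ⁻¹ = (B ζ).transpose
  det : ∀ ζ, ζ ≠ 0 → (B ζ).det = s ζ ^ 2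
  laurent : ∀ i j, LaurentDeg 1 fun ζ => B ζ i j
  lower : ∀ n : ℕ, ∃ ζ, ‖ζ‖ = 1 ∧ Real.exp (n * M) / 2 ≤ mN (cocyc B ω n ζ)
  upper : ∀ ε, 0 < ε → ∃ C : ℝ, 1 ≤ C ∧ ∀ (n : ℕ) ζ, ‖ζ‖ = 1 →
    mN (cocyc B ω n ζ) ≤ C * Real.exp (n * (M + ε))
  prod_le : ∃ C : ℝ, 1 ≤ C ∧ ∀ (n : ℕ) ζ, ‖ζ‖ = 1 →
    ∏ j ∈ Finset.range n, ‖s (ζ * ω ^ j)‖ ≤ C * Real.exp (n * F)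

/-- `u` solves the (possibly singular) recursion `s u_{n+1} = B u_n`, `s u_n = adj(B) u_{n+1}`
along the orbit `ζ_n = ξ ω^n`. -/
def IsSol (B : ℂ → Matrix (Fin 2) (Fin 2) ℂ) (s : ℂ → ℂ) (ω ξ : ℂ) (u : ℤ → Fin 2 → ℂ) : Prop :=
  ∀ n : ℤ, (B (ξ * ω ^ n)).mulVec (u n) = s (ξ * ω ^ n) • u (n + 1) ∧
    (B (ξ * ω ^ n)).adjugate.mulVec (u (n + 1)) = s (ξ * ω ^ n) • u n

section
variable {B : ℂ → Matrix (Fin 2) (Fin 2) ℂ} {s : ℂ → ℂ} {ω ξ : ℂ} {M F : ℝ} {u : ℤ → Fin 2 → ℂ}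

lemma IsSol.cocyc (hu : IsSol B s ω ξ u) (hω : ω ≠ 0) (a : ℤ) (k : ℕ) :
    (cocyc B ω k (ξ * ω ^ a)).mulVec (u a) =
      (∏ j ∈ Finset.range k, s (ξ * ω ^ a * ω ^ j)) • u (a + k) ∧
    (cocyc B ω k (ξ * ω ^ a)).adjugate.mulVec (u (a + k)) =
      (∏ j ∈ Finset.range k, s (ξ * ω ^ a * ω ^ j)) • u a := by
  induction k with
  | zero => simp [cocyc_zero]
  | succ k ih =>
    have e : ξ * ω ^ a * ω ^ k = ξ * ω ^ (a + k) := by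
      rw [zpow_add₀ hω, zpow_natCast, mul_assoc]
    obtain ⟨h1, h2⟩ := hu (a + k)
    rw [show a + ((k + 1 : ℕ) : ℤ) = a + k + 1 by push_cast; ring]
    constructor
    · rw [cocyc_succ, ← Matrix.mulVec_mulVec, ih.1, Matrix.mulVec_smul, e, h1, smul_smul,
        Finset.prod_range_succ, e]
    · rw [cocyc_succ, Matrix.adjugate_mul_distrib, ← Matrix.mulVec_mulVec, e, h2,
        Matrix.mulVec_smul, ih.2, smul_smul, Finset.prod_range_succ, e, mul_comm]

/-- Poisson formula: interior values of a solution in terms of its boundary values. -/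
lemma norm_bil_mul_le (R T : Matrix (Fin 2) (Fin 2) ℂ) (v x a b : Fin 2 → ℂ) (r s : ℂ)
    (hv : ∀ i, ‖v i‖ ≤ 1) (hR : R.mulVec x = r • b) (hT : T.adjugate.mulVec x = s • a)
    (i : Fin 2) : ‖bil v (R * T)‖ * ‖x i‖ ≤
      mN T * ‖r‖ * (‖b 0‖ + ‖b 1‖) + mN R * ‖s‖ * (‖a 0‖ + ‖a 1‖) := by
  have hR0 := congrFun hR 0
  have hR1 := congrFun hR 1
  have hT0 := congrFun hT 0
  have hT1 := congrFun hT 1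
  rw [Matrix.adjugate_fin_two] at hT0 hT1
  simp only [Matrix.mulVec, dotProduct, Fin.sum_univ_two, Pi.smul_apply, smul_eq_mul,
    Matrix.of_apply, Matrix.cons_val_zero, Matrix.cons_val_one, Matrix.cons_val',
    Matrix.cons_val_fin_one] at hR0 hR1 hT0 hT1
  have hcomb : ∀ p q : ℂ, ‖v 0 * p + v 1 * q‖ ≤ ‖p‖ + ‖q‖ := fun p q => by
    refine (norm_add_le _ _).trans ?_
    rw [norm_mul, norm_mul]
    have h0 := mul_le_mul_of_nonneg_right (hv 0) (norm_nonneg p)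
    have h1 := mul_le_mul_of_nonneg_right (hv 1) (norm_nonneg q)
    linarith
  have hβ : ∀ i, ‖v 0 * T i 0 + v 1 * T i 1‖ ≤ mN T := fun i => by
    refine (hcomb _ _).trans ?_
    have h2 := mN_eq T
    have := fun i j => norm_nonneg (T i j)
    have h3 := this 0 0
    have h4 := this 0 1
    have h5 := this 1 0
    have h6 := this 1 1
    fin_cases i <;> simp only [Fin.zero_eta, Fin.mk_one] <;> linarith
  have hα : ∀ i, ‖v 0 * R 0 i + v 1 * R 1 i‖ ≤ mN R := fun i => by
    refine (hcomb _ _).trans ?_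
    have h2 := mN_eq R
    have := fun i j => norm_nonneg (R i j)
    have h3 := this 0 0
    have h4 := this 0 1
    have h5 := this 1 0
    have h6 := this 1 1
    fin_cases i <;> simp only [Fin.zero_eta, Fin.mk_one] <;> linarith
  have hb := hcomb (b 0) (b 1)
  have ha : ‖v 0 * a 1 - v 1 * a 0‖ ≤ ‖a 0‖ + ‖a 1‖ := by
    have := hcomb (a 1) (-(a 0))
    rw [norm_neg, mul_neg, ← sub_eq_add_neg] at this
    linarith
  have key : ∀ i j : Fin 2, ∀ c : ℂ, ‖c‖ = 1 → bil v (R * T) * x i =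
      (v 0 * T i 0 + v 1 * T i 1) * r * (v 0 * b 0 + v 1 * b 1) +
      c * ((v 0 * R 0 j + v 1 * R 1 j) * s * (v 0 * a 1 - v 1 * a 0)) →
      ‖bil v (R * T)‖ * ‖x i‖ ≤
        mN T * ‖r‖ * (‖b 0‖ + ‖b 1‖) + mN R * ‖s‖ * (‖a 0‖ + ‖a 1‖) := by
    intro i j c hc h
    rw [← norm_mul, h]
    refine (norm_add_le _ _).trans ?_
    rw [norm_mul c, hc, one_mul, norm_mul, norm_mul, norm_mul, norm_mul]
    have hnT := mN_nonneg T
    have hnR := mN_nonneg R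
    gcongr
    · exact hβ i
    · exact hα j
  fin_cases i
  · refine key 0 1 (-1) (by simp) ?_
    simp only [bil, Matrix.mul_apply, Fin.sum_univ_two]
    linear_combination (v 0 * T 0 0 + v 1 * T 0 1) * v 0 * hR0 +
      (v 0 * T 0 0 + v 1 * T 0 1) * v 1 * hR1 -
      (v 0 * R 0 1 + v 1 * R 1 1) * v 0 * hT1 + (v 0 * R 0 1 + v 1 * R 1 1) * v 1 * hT0
  · refine key 1 0 1 (by simp) ?_
    simp only [bil, Matrix.mul_apply, Fin.sum_univ_two]
    linear_combination (v 0 * T 1 0 + v 1 * T 1 1) * v 0 * hR0 +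
      (v 0 * T 1 0 + v 1 * T 1 1) * v 1 * hR1 +
      (v 0 * R 0 0 + v 1 * R 1 0) * v 0 * hT1 - (v 0 * R 0 0 + v 1 * R 1 0) * v 1 * hT0

lemma IsSupercritical.exists_bil_ge (h : IsSupercritical B s ω M F) (hω : ‖ω‖ = 1) :
    ∃ k₀ : ℕ, ∀ k, k₀ ≤ k → ∃ ζ, ‖ζ‖ = 1 ∧ ∃ i,
      Real.exp (k * M) / 36 ≤ ‖bil (testV i) (cocyc B ω k ζ)‖ := by
  obtain ⟨C, hC1, hC⟩ := h.prod_le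
  have hω0 : ω ≠ 0 := by intro h; simp [h] at hω
  obtain ⟨k₀, hk₀⟩ := exists_nat_gt (Real.log (8 * C) / (M - F))
  refine ⟨k₀, fun k hk => ?_⟩
  obtain ⟨ζ, hζ, hl⟩ := h.lower k
  have hζ0 : ζ ≠ 0 := by intro h; simp [h] at hζ
  refine ⟨ζ, hζ, ?_⟩
  by_contra! hcon
  have hdet : ‖(cocyc B ω k ζ).det‖ ≤ (C * Real.exp (k * F)) ^ 2 := by
    rw [det_cocyc, norm_prod]
    have : ∀ j ∈ Finset.range k, ‖(B (ζ * ω ^ j)).det‖ = ‖s (ζ * ω ^ j)‖ ^ 2 := fun j _ => by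
      rw [h.det _ (mul_ne_zero hζ0 (pow_ne_zero _ hω0)), norm_pow]
    rw [Finset.prod_congr rfl this, Finset.prod_pow]
    have := hC k ζ hζ
    gcongr
  have h1 := mN_le_of_bil_le (cocyc B ω k ζ) _ (C * Real.exp (k * F)) (by positivity)
    (fun i => (hcon i).le) hdet
  have hMF : 0 < M - F := by linarith [h.lt]
  have h2 : 8 * C * Real.exp (k * F) < Real.exp (k * M) := by
    have h3 : Real.log (8 * C) < k * (M - F) := by
      rw [div_lt_iff₀ hMF] at hk₀
      refine hk₀.trans_le ?_
      gcongr
    rw [← Real.exp_lt_exp, Real.exp_log (by positivity)] at h3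
    have h4 : Real.exp (k * M) = Real.exp (k * (M - F)) * Real.exp (k * F) := by
      rw [← Real.exp_add]; ring_nf
    rw [h4]
    gcongr
  linarith

lemma LaurentDeg.cocyc {B : ℂ → Matrix (Fin 2) (Fin 2) ℂ}
    (hB : ∀ i j, LaurentDeg 1 fun ζ => B ζ i j) {ω : ℂ} (hω : ω ≠ 0) (k : ℕ) (i j : Fin 2) :
    LaurentDeg k fun ζ => cocyc B ω k ζ i j := by
  induction k generalizing i j with
  | zero => simp only [cocyc_zero]; exact LaurentDeg.const _
  | succ k ih =>
    simp only [cocyc_succ, Matrix.mul_apply, Fin.sum_univ_two]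
    have hc : ∀ i j, LaurentDeg 1 fun ζ => B (ζ * ω ^ k) i j := fun i j => by
      simpa only [mul_comm] using (hB i j).comp_mul (pow_ne_zero k hω)
    rw [add_comm k 1]
    exact ((hc i 0).mul (ih 0 j)).add ((hc i 1).mul (ih 1 j))

lemma LaurentDeg.bil {A : ℂ → Matrix (Fin 2) (Fin 2) ℂ} {k : ℕ}
    (hA : ∀ i j, LaurentDeg k fun ζ => A ζ i j) (v : Fin 2 → ℂ) :
    LaurentDeg k fun ζ => bil v (A ζ) := by
  have h : ∀ i j, LaurentDeg k fun ζ => v i * A ζ i j * v j := fun i j => by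
    have := (hA i j).const_mul (v i * v j)
    refine (congrArg (LaurentDeg k) (funext fun ζ => ?_)).mp this
    ring
  exact ((h 0 0).add (h 0 1)).add ((h 1 0).add (h 1 1))

/-- The quadratic forms of the centred cocycle are polynomials in `ξ + ξ⁻¹`. -/
lemma IsSupercritical.exists_polynomial (h : IsSupercritical B s ω M F) (hω : ω ≠ 0) (m : ℕ)
    (v : Fin 2 → ℂ) : ∃ p : Polynomial ℂ, p.natDegree ≤ 2 * m + 1 ∧ ∀ ξ, ξ ≠ 0 →
      bil v (_root_.cocyc B ω (2 * m + 1) (ω ^ (-(m : ℤ)) * ξ)) = p.eval (twoCos ξ) := by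
  have h1 := (LaurentDeg.bil (LaurentDeg.cocyc h.laurent hω (2 * m + 1)) v).comp_mul
    (zpow_ne_zero (-(m : ℤ)) hω)
  refine h1.exists_eval_twoCos fun ξ hξ => ?_
  rw [← bil_transpose, transpose_cocyc_succ hω h.transpose (2 * m)
    (mul_ne_zero (zpow_ne_zero _ hω) (inv_ne_zero hξ))]
  congr 2
  have : ω ^ (-(m : ℤ)) * ω ^ (2 * m) = ω ^ (m : ℤ) := by
    rw [← zpow_natCast, ← zpow_add₀ hω]; congr 1; push_cast; ring
  rw [mul_right_comm, this, mul_inv, inv_inv, ← zpow_neg]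

end

section
variable {B : ℂ → Matrix (Fin 2) (Fin 2) ℂ} {s : ℂ → ℂ} {ω ξ : ℂ} {M F : ℝ} {u : ℤ → Fin 2 → ℂ}

lemma IsSupercritical.exists_good_node (h : IsSupercritical B s ω M F) {κ τ : ℝ}
    (hD : DioUnit ω κ τ) {ε : ℝ} (hε : 0 < ε) :
    ∃ C : ℝ, 1 ≤ C ∧ ∃ p₀ : ℕ, ∀ p, p₀ ≤ p → ∀ ξ : ℂ, ‖ξ‖ = 1 → ∀ (a₁ a₂ : ℤ) (n₁ n₂ : ℕ),
      n₁ + n₂ = 16 * p + 2 →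
      Disjoint (Finset.Ico a₁ (a₁ + n₁)) (Finset.Ico a₂ (a₂ + n₂)) →
      (∀ i ∈ Finset.Ico a₁ (a₁ + n₁) ∪ Finset.Ico a₂ (a₂ + n₂),
        ∀ j ∈ Finset.Ico a₁ (a₁ + n₁) ∪ Finset.Ico a₂ (a₂ + n₂), j ≠ i →
        Real.exp (-(ε * p)) ≤ ‖1 - ω ^ (j - i)‖ ∧
        Real.exp (-(ε * p)) ≤ ‖1 - ξ ^ 2 * ω ^ (i + j)‖) →
      ∃ i ∈ Finset.Ico a₁ (a₁ + n₁) ∪ Finset.Ico a₂ (a₂ + n₂), ∃ v : Fin 2 → ℂ,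
        (∀ l, ‖v l‖ ≤ 1) ∧ Real.exp ((16 * p + 1 : ℕ) * M) ≤ C * Real.exp (21 * (ε * p)) *
          ‖bil v (cocyc B ω (16 * p + 1) (ξ * ω ^ (i - 8 * p)))‖ := by
  obtain ⟨C₀, hC₀, hI⟩ := hD.exists_interpolation_le hε
  obtain ⟨k₀, hk₀⟩ := h.exists_bil_ge hD.1
  have hω0 := hD.ne_zero
  refine ⟨max 1 (36 * (18 * ε⁻¹ * (C₀ * Real.exp (2 * ε)))), le_max_left _ _, max 1 k₀, ?_⟩
  intro p hp ξ hξ a₁ a₂ n₁ n₂ hn hdisj hsep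
  have hp1 : 1 ≤ p := (le_max_left _ _).trans hp
  have hp1' : (1 : ℝ) ≤ p := by exact_mod_cast hp1
  obtain ⟨ζ, hζ, l, hl⟩ := hk₀ (16 * p + 1) (by have := (le_max_right 1 k₀).trans hp; omega)
  have hζ0 : ζ ≠ 0 := by intro h; simp [h] at hζ
  have hξ0 : ξ ≠ 0 := by intro h; simp [h] at hξ
  obtain ⟨P, hPdeg, hP⟩ := h.exists_polynomial hω0 (8 * p) (testV l)
  rw [show 2 * (8 * p) + 1 = 16 * p + 1 by ring] at hPdeg hP
  obtain ⟨i, hi, hPi⟩ := hI ξ hξ a₁ a₂ n₁ n₂ hdisj (Real.exp (-(ε * p))) (Real.exp_pos _)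
    (Real.exp_le_one_iff.2 (by have := mul_pos hε (lt_of_lt_of_le one_pos hp1'); linarith))
    hsep P (by omega)
  refine ⟨i, hi, testV l, norm_testV_le l, ?_⟩
  have h1 := hPi (ω ^ ((8 * p : ℕ) : ℤ) * ζ) (by rw [norm_mul, hD.norm_zpow, hζ, one_mul])
  rw [← hP _ (mul_ne_zero (zpow_ne_zero _ hω0) hζ0),
    ← hP _ (mul_ne_zero hξ0 (zpow_ne_zero _ hω0)), ← mul_assoc, ← zpow_add₀ hω0,
    neg_add_cancel, zpow_zero, one_mul] at h1
  have e1 : ω ^ (-((8 * p : ℕ) : ℤ)) * (ξ * ω ^ i) = ξ * ω ^ (i - 8 * p) := by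
    rw [mul_left_comm, ← zpow_add₀ hω0]; congr 2; push_cast; ring
  rw [e1] at h1
  set b := ‖bil (testV l) (cocyc B ω (16 * p + 1) (ξ * ω ^ (i - 8 * p)))‖ with hb
  have hn' : ((n₁ : ℝ) + n₂) = 16 * p + 2 := by exact_mod_cast hn
  rw [hn'] at h1
  have h2 : (16 * (p : ℝ) + 2) ≤ 18 * ε⁻¹ * Real.exp (ε * p) := by
    have h3 := Real.add_one_le_exp (ε * p)
    have h4 : (p : ℝ) ≤ ε⁻¹ * Real.exp (ε * p) := by
      rw [inv_mul_eq_div, le_div_iff₀ hε]; linarith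
    nlinarith
  have h5 : (Real.exp (-(ε * p)))⁻¹ ^ 4 = Real.exp (4 * (ε * p)) := by
    rw [← Real.exp_neg, neg_neg, ← Real.exp_nat_mul]; norm_num
  have h6 : Real.exp (ε * (16 * p + 2)) = Real.exp (2 * ε) * Real.exp (16 * (ε * p)) := by
    rw [← Real.exp_add]; ring_nf
  rw [h5, h6] at h1
  have h7 : Real.exp (21 * (ε * p)) =
      Real.exp (ε * p) * (Real.exp (16 * (ε * p)) * Real.exp (4 * (ε * p))) := by
    rw [← Real.exp_add, ← Real.exp_add]; ring_nf
  have h8 : Real.exp ((16 * p + 1 : ℕ) * M) / 36 ≤ 18 * ε⁻¹ * Real.exp (ε * p) *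
      (C₀ * (Real.exp (2 * ε) * Real.exp (16 * (ε * p))) * Real.exp (4 * (ε * p))) * b := by
    refine (hl.trans h1).trans ?_
    have : 0 ≤ b := norm_nonneg _
    gcongr
  calc Real.exp ((16 * p + 1 : ℕ) * M) ≤ 36 * (18 * ε⁻¹ * Real.exp (ε * p) *
      (C₀ * (Real.exp (2 * ε) * Real.exp (16 * (ε * p))) * Real.exp (4 * (ε * p))) * b) := by
        linarith
    _ = 36 * (18 * ε⁻¹ * (C₀ * Real.exp (2 * ε))) * Real.exp (21 * (ε * p)) * b := by
        rw [h7]; ring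
    _ ≤ _ := by
        have : 0 ≤ b := norm_nonneg _
        gcongr
        exact le_max_right _ _

/-- Polynomial growth is beaten by any exponential. -/
lemma exists_poly_le_exp (A : ℝ) (hA : 0 ≤ A) (K : ℕ) {ε : ℝ} (hε : 0 < ε) :
    ∃ C : ℝ, 1 ≤ C ∧ ∀ p : ℕ, A * (1 + 60 * p) ^ K ≤ C * Real.exp (ε * p) := by
  have h1 : ∀ x : ℝ, 0 ≤ x → x ^ K ≤ K.factorial * Real.exp x := fun x hx => by
    have := Real.pow_div_factorial_le_exp x hx K
    rwa [div_le_iff₀ (by positivity), mul_comm] at this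
  refine ⟨max 1 (A * ((60 / ε) ^ K * (K.factorial * Real.exp (ε / 60)))), le_max_left _ _,
    fun p => ?_⟩
  have h2 := h1 (ε / 60 + ε * p) (by positivity)
  have h3 : (1 + 60 * (p : ℝ)) = 60 / ε * (ε / 60 + ε * p) := by field_simp
  rw [h3, mul_pow]
  calc A * ((60 / ε) ^ K * (ε / 60 + ε * p) ^ K) ≤
        A * ((60 / ε) ^ K * (K.factorial * Real.exp (ε / 60 + ε * p))) := by gcongr
    _ = A * ((60 / ε) ^ K * (K.factorial * Real.exp (ε / 60))) * Real.exp (ε * p) := by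
        rw [Real.exp_add]; ring
    _ ≤ _ := by gcongr; exact le_max_right _ _

/-- A good node forces exponential smallness of polynomially bounded solutions well inside the
corresponding interval. -/
lemma IsSupercritical.decay_of_good_node (h : IsSupercritical B s ω M F) (hω : ‖ω‖ = 1)
    (hξ : ‖ξ‖ = 1) (hu : IsSol B s ω ξ u) {A : ℝ} {K : ℕ} (hA : 0 ≤ A)
    (hpoly : ∀ n : ℤ, ‖u n 0‖ + ‖u n 1‖ ≤ A * (1 + |(n : ℝ)|) ^ K) {C₀ ε : ℝ} (hC₀ : 1 ≤ C₀)
    (hε : 0 < ε) (hεM : 400 * ε = M - F) :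
    ∃ C : ℝ, 1 ≤ C ∧ ∀ (p : ℕ) (i m : ℤ) (v : Fin 2 → ℂ), 1 ≤ p → |i| ≤ 38 * p →
      (∀ l, ‖v l‖ ≤ 1) → Real.exp ((16 * p + 1 : ℕ) * M) ≤ C₀ * Real.exp (21 * (ε * p)) *
        ‖bil v (cocyc B ω (16 * p + 1) (ξ * ω ^ (i - 8 * p)))‖ →
      (p : ℤ) ≤ 2 * (m - (i - 8 * p)) → (p : ℤ) ≤ 2 * (i + 8 * p + 1 - m) →
      ∀ l, ‖u m l‖ ≤ C * Real.exp (-(ε * p)) := by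
  obtain ⟨C₁, hC₁, h1⟩ := exists_poly_le_exp A hA K hε
  obtain ⟨C₂, hC₂, h2⟩ := h.upper ε hε
  obtain ⟨C₃, hC₃, h3⟩ := h.prod_le
  have hω0 : ω ≠ 0 := by intro h; simp [h] at hω
  refine ⟨max 1 (2 * (C₀ * (C₁ * (C₂ * C₃)))), le_max_left _ _, ?_⟩
  intro p i m v hp hi hv hgood hm1 hm2 l
  obtain ⟨k₁, hk₁⟩ := Int.eq_ofNat_of_zero_le (show 0 ≤ m - (i - 8 * p) by omega)
  obtain ⟨k₂, hk₂⟩ := Int.eq_ofNat_of_zero_le (show 0 ≤ i + 8 * p + 1 - m by omega)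
  have hk : 16 * p + 1 = k₂ + k₁ := by omega
  set a := i - 8 * p with ha
  have hma : m = a + k₁ := by omega
  have hzn : ∀ n : ℤ, ‖ξ * ω ^ n‖ = 1 := fun n => by
    rw [norm_mul, hξ, one_mul, norm_zpow, hω, one_zpow]
  have e1 : ξ * ω ^ a * ω ^ k₁ = ξ * ω ^ m := by
    rw [hma, zpow_add₀ hω0, zpow_natCast, mul_assoc]
  rw [hk, cocyc_add, e1] at hgood
  have hT := (hu.cocyc hω0 a k₁).2
  have hR := (hu.cocyc hω0 m k₂).1
  rw [← hma] at hT
  have hP := norm_bil_mul_le _ _ v _ _ _ _ _ hv hR hT l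
  set b := ‖bil v (cocyc B ω k₂ (ξ * ω ^ m) * cocyc B ω k₁ (ξ * ω ^ a))‖ with hb
  rw [norm_prod, norm_prod] at hP
  have hp' : (1 : ℝ) ≤ p := by exact_mod_cast hp
  have hbdry : ∀ n : ℤ, |n| ≤ 60 * p → ‖u n 0‖ + ‖u n 1‖ ≤ C₁ * Real.exp (ε * p) := by
    intro n hn
    refine (hpoly n).trans (le_trans ?_ (h1 p))
    have : |(n : ℝ)| ≤ 60 * p := by exact_mod_cast hn
    gcongr
  have hi' := abs_le.1 hi
  have b1 := hbdry a (abs_le.2 ⟨by omega, by omega⟩)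
  have b2 := hbdry (m + k₂) (abs_le.2 ⟨by omega, by omega⟩)
  have r1 := h2 k₁ _ (hzn a)
  have r2 := h2 k₂ _ (hzn m)
  have s1 := h3 k₁ _ (hzn a)
  have s2 := h3 k₂ _ (hzn m)
  have t1 := mN_nonneg (cocyc B ω k₁ (ξ * ω ^ a))
  have t2 := mN_nonneg (cocyc B ω k₂ (ξ * ω ^ m))
  have hP2 : b * ‖u m l‖ ≤
      C₂ * Real.exp (k₁ * (M + ε)) * (C₃ * Real.exp (k₂ * F)) * (C₁ * Real.exp (ε * p)) +
      C₂ * Real.exp (k₂ * (M + ε)) * (C₃ * Real.exp (k₁ * F)) * (C₁ * Real.exp (ε * p)) := by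
    refine hP.trans ?_
    have : ∀ n : ℤ, 0 ≤ ‖u n 0‖ + ‖u n 1‖ := fun n => by positivity
    have q1 := this a
    have q2 := this (m + k₂)
    have w1 : 0 ≤ ∏ j ∈ Finset.range k₁, ‖s (ξ * ω ^ a * ω ^ j)‖ :=
      Finset.prod_nonneg fun _ _ => norm_nonneg _
    have w2 : 0 ≤ ∏ j ∈ Finset.range k₂, ‖s (ξ * ω ^ m * ω ^ j)‖ :=
      Finset.prod_nonneg fun _ _ => norm_nonneg _
    gcongr
  have hkR : (k₁ : ℝ) + k₂ = 16 * p + 1 := by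
    have : ((16 * p + 1 : ℕ) : ℝ) = ((k₂ + k₁ : ℕ) : ℝ) := by rw [hk]
    push_cast at this; linarith
  have hk1R : (p : ℝ) ≤ 2 * k₁ := by
    have : (p : ℤ) ≤ 2 * k₁ := by omega
    exact_mod_cast this
  have hk2R : (p : ℝ) ≤ 2 * k₂ := by
    have : (p : ℤ) ≤ 2 * k₂ := by omega
    exact_mod_cast this
  have hexp : ∀ x y : ℕ, (x : ℝ) + y = 16 * p + 1 → (p : ℝ) ≤ 2 * y →
      Real.exp (x * (M + ε)) * Real.exp (y * F) * Real.exp (ε * p) * Real.exp (21 * (ε * p)) ≤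
      Real.exp (-(ε * p)) * Real.exp ((k₂ + k₁ : ℕ) * M) := by
    intro x y hxy hy
    rw [← Real.exp_add, ← Real.exp_add, ← Real.exp_add, ← Real.exp_add]
    apply Real.exp_le_exp.2
    have hF : F = M - 400 * ε := by linarith
    rw [hF]
    push_cast
    rw [show (k₂ : ℝ) + k₁ = x + y by linarith]
    have hx : (x : ℝ) ≤ 17 * p := by
      have : (0 : ℝ) ≤ y := Nat.cast_nonneg y
      linarith
    nlinarith
  have hfin : Real.exp ((k₂ + k₁ : ℕ) * M) * ‖u m l‖ ≤
      Real.exp ((k₂ + k₁ : ℕ) * M) * (2 * (C₀ * (C₁ * (C₂ * C₃))) * Real.exp (-(ε * p))) := by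
    calc Real.exp ((k₂ + k₁ : ℕ) * M) * ‖u m l‖ ≤
          C₀ * Real.exp (21 * (ε * p)) * b * ‖u m l‖ := by gcongr
      _ = C₀ * Real.exp (21 * (ε * p)) * (b * ‖u m l‖) := by ring
      _ ≤ C₀ * Real.exp (21 * (ε * p)) * (C₂ * Real.exp (k₁ * (M + ε)) *
            (C₃ * Real.exp (k₂ * F)) * (C₁ * Real.exp (ε * p)) + C₂ * Real.exp (k₂ * (M + ε)) *
            (C₃ * Real.exp (k₁ * F)) * (C₁ * Real.exp (ε * p))) := by gcongr
      _ = C₀ * (C₁ * (C₂ * C₃)) * (Real.exp (k₁ * (M + ε)) * Real.exp (k₂ * F) *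
            Real.exp (ε * p) * Real.exp (21 * (ε * p)) + Real.exp (k₂ * (M + ε)) *
            Real.exp (k₁ * F) * Real.exp (ε * p) * Real.exp (21 * (ε * p))) := by ring
      _ ≤ C₀ * (C₁ * (C₂ * C₃)) * (Real.exp (-(ε * p)) * Real.exp ((k₂ + k₁ : ℕ) * M) +
            Real.exp (-(ε * p)) * Real.exp ((k₂ + k₁ : ℕ) * M)) := by
          have z1 := hexp k₁ k₂ hkR hk2R
          have z2 := hexp k₂ k₁ (by linarith) hk1R
          gcongr
      _ = _ := by ring
  refine (le_of_mul_le_mul_left hfin (Real.exp_pos _)).trans ?_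
  gcongr
  exact le_max_right _ _
end

section
variable {B : ℂ → Matrix (Fin 2) (Fin 2) ℂ} {s : ℂ → ℂ} {ω ξ : ℂ} {M F : ℝ} {u : ℤ → Fin 2 → ℂ}

/-- Polynomially bounded solutions decay exponentially. -/
lemma IsSupercritical.exists_decay (h : IsSupercritical B s ω M F) {κ τ : ℝ}
    (hD : DioUnit ω κ τ) (hξ : ‖ξ‖ = 1)
    (hsep : ∀ ε : ℝ, 0 < ε → ∃ p₀ : ℕ, ∀ p : ℕ, p₀ ≤ p → ∀ l : ℤ, |l| ≤ 76 * p →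
      (l ≠ 0 → Real.exp (-(ε * p)) ≤ ‖1 - ω ^ l‖) ∧
      (2 * (p : ℤ) ≤ |l| → Real.exp (-(ε * p)) ≤ ‖1 - ξ ^ 2 * ω ^ l‖))
    (hu : IsSol B s ω ξ u) {A : ℝ} {K : ℕ} (hA : 0 ≤ A)
    (hpoly : ∀ n : ℤ, ‖u n 0‖ + ‖u n 1‖ ≤ A * (1 + |(n : ℝ)|) ^ K) {n₀ : ℤ} (hn₀ : u n₀ ≠ 0) :
    ∃ C c : ℝ, 0 < C ∧ 0 < c ∧ ∀ (m : ℤ) l, ‖u m l‖ ≤ C * Real.exp (-c * |(m : ℝ)|) := by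
  have hMF := h.lt
  set ε := (M - F) / 400 with hεdef
  have hε : 0 < ε := div_pos (sub_pos.2 hMF) (by norm_num)
  have hεM : 400 * ε = M - F := by rw [hεdef]; ring
  obtain ⟨C₀, hC₀, p₁, hgood⟩ := h.exists_good_node hD hε
  obtain ⟨p₂, hp₂⟩ := hsep ε hε
  obtain ⟨C₁, hC₁, hdec⟩ := h.decay_of_good_node hD.1 hξ hu hA hpoly hC₀ hε hεM
  obtain ⟨l₀, hl₀⟩ : ∃ l, u n₀ l ≠ 0 := by
    by_contra! hc; exact hn₀ (funext hc)
  obtain ⟨p₃, hp₃⟩ : ∃ p₃ : ℕ, ∀ p : ℕ, p₃ ≤ p → C₁ * Real.exp (-(ε * p)) < ‖u n₀ l₀‖ := by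
    have h1 : Filter.Tendsto (fun p : ℕ => C₁ * Real.exp (-(ε * p))) Filter.atTop
        (nhds (C₁ * 0)) := by
      refine Filter.Tendsto.const_mul _ (Real.tendsto_exp_neg_atTop_nhds_zero.comp ?_)
      exact tendsto_natCast_atTop_atTop.const_mul_atTop hε
    rw [mul_zero] at h1
    exact Filter.eventually_atTop.1 (h1.eventually_lt_const (norm_pos_iff.2 hl₀))
  set P := max (max p₁ p₂) (max p₃ (2 * n₀.natAbs + 1)) with hP
  have key : ∀ (p : ℕ) (m : ℤ), P ≤ p → 16 * p ≤ m.natAbs → m.natAbs < 16 * p + 16 →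
      ∀ l, ‖u m l‖ ≤ C₁ * Real.exp (-(ε * p)) := by
    intro p m hp hm1 hm2
    have hpp : p₁ ≤ p ∧ p₂ ≤ p ∧ p₃ ≤ p ∧ 2 * n₀.natAbs + 1 ≤ p := by omega
    obtain ⟨q1, q2, q3, q4⟩ := hpp
    obtain ⟨a₁, ha₁⟩ : ∃ a₁ : ℤ, (0 < m ∧ a₁ = p) ∨ (m < 0 ∧ a₁ = -7 * p + 1) := by
      rcases lt_trichotomy m 0 with h | h | h
      · exact ⟨_, Or.inr ⟨h, rfl⟩⟩
      · omega
      · exact ⟨_, Or.inl ⟨h, rfl⟩⟩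
    have hmem : ∀ i ∈ Finset.Ico a₁ (a₁ + (6 * p : ℕ)) ∪
        Finset.Ico (m - 5 * p) (m - 5 * p + (10 * p + 2 : ℕ)),
        p ≤ i.natAbs ∧ i.natAbs ≤ 38 * p ∧ (0 < m → 0 < i) ∧ (m < 0 → i < 0) := by
      intro i hi
      rw [Finset.mem_union, Finset.mem_Ico, Finset.mem_Ico] at hi
      push_cast at hi
      omega
    obtain ⟨i, hi, v, hv, hv'⟩ := hgood p q1 ξ hξ a₁ (m - 5 * p) (6 * p) (10 * p + 2) (by ring)
      (by
        rw [Finset.disjoint_left]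
        intro i h1 h2
        rw [Finset.mem_Ico] at h1 h2
        push_cast at h1 h2
        omega)
      (by
        intro i hi j hj hij
        obtain ⟨b1, b2, b3, b4⟩ := hmem i hi
        obtain ⟨c1, c2, c3, c4⟩ := hmem j hj
        exact ⟨(hp₂ p q2 (j - i) (by rw [Int.abs_eq_natAbs]; omega)).1 (sub_ne_zero.2 hij),
          (hp₂ p q2 (i + j) (by rw [Int.abs_eq_natAbs]; omega)).2
            (by rw [Int.abs_eq_natAbs]; omega)⟩)
    obtain ⟨b1, b2, b3, b4⟩ := hmem i hi
    rw [Finset.mem_union, Finset.mem_Ico, Finset.mem_Ico] at hi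
    push_cast at hi
    have b2' : |i| ≤ 38 * p := by rw [Int.abs_eq_natAbs]; omega
    rcases hi with hi | hi
    · have := hdec p i n₀ v (by omega) b2' hv hv' (by omega) (by omega) l₀
      exact absurd this (not_le.2 (hp₃ p q3))
    · exact hdec p i m v (by omega) b2' hv hv' (by omega) (by omega)
  have hAK : ∀ m : ℤ, ∀ l, ‖u m l‖ ≤ A * (1 + |(m : ℝ)|) ^ K := fun m l => by
    refine le_trans ?_ (hpoly m)
    have := norm_nonneg (u m 0)
    have := norm_nonneg (u m 1)
    fin_cases l <;> simp only [Fin.zero_eta, Fin.mk_one] <;> linarith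
  set D := A * (1 + 16 * (P : ℝ)) ^ K with hDdef
  have hD0 : 0 ≤ D := by positivity
  refine ⟨C₁ * Real.exp ε + D * Real.exp (ε * P), ε / 16, by positivity, by positivity, ?_⟩
  intro m l
  have habs : |(m : ℝ)| = (m.natAbs : ℝ) := by rw [Nat.cast_natAbs]; push_cast; rfl
  by_cases hm : 16 * P ≤ m.natAbs
  · have h1 := key (m.natAbs / 16) m (by omega) (by omega) (by omega) l
    have h2 : (m.natAbs : ℝ) ≤ 16 * ((m.natAbs / 16 : ℕ) : ℝ) + 16 := by
      exact_mod_cast (by omega : m.natAbs ≤ 16 * (m.natAbs / 16) + 16)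
    have h3 : Real.exp (-(ε * (m.natAbs / 16 : ℕ))) ≤
        Real.exp ε * Real.exp (-(ε / 16) * |(m : ℝ)|) := by
      rw [← Real.exp_add, Real.exp_le_exp, habs]
      nlinarith
    have h4 : 0 ≤ D * Real.exp (ε * P) * Real.exp (-(ε / 16) * |(m : ℝ)|) := by positivity
    calc ‖u m l‖ ≤ C₁ * (Real.exp ε * Real.exp (-(ε / 16) * |(m : ℝ)|)) :=
          h1.trans (by gcongr)
      _ ≤ _ := by rw [add_mul]; linarith
  · have h1 : (m.natAbs : ℝ) ≤ 16 * P := by exact_mod_cast (by omega : m.natAbs ≤ 16 * P)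
    have h2 := hAK m l
    have h3 : (1 : ℝ) ≤ Real.exp (ε * P) * Real.exp (-(ε / 16) * |(m : ℝ)|) := by
      rw [← Real.exp_add]
      apply Real.one_le_exp
      rw [habs]
      nlinarith
    have h4 : A * (1 + |(m : ℝ)|) ^ K ≤ D := by rw [habs, hDdef]; gcongr
    have h5 : 0 ≤ C₁ * Real.exp ε * Real.exp (-(ε / 16) * |(m : ℝ)|) := by positivity
    calc ‖u m l‖ ≤ D * 1 := by rw [mul_one]; exact h2.trans h4
      _ ≤ D * (Real.exp (ε * P) * Real.exp (-(ε / 16) * |(m : ℝ)|)) := by gcongr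
      _ ≤ _ := by rw [add_mul]; linarith
end

lemma laurentDeg_gZ (t l : ℝ) : LaurentDeg 1 fun ζ => gZ t l ζ := by
  have h1 := ((LaurentDeg.id.const_mul (-(((t ^ 2 * l : ℝ)) : ℂ))).add
    (LaurentDeg.inv.const_mul (l : ℂ))).add (LaurentDeg.const (((2 * t * sq1 l : ℝ) : ℂ)))
  exact h1.const_mul (kF t : ℂ)

lemma laurentDeg_gZ_inv (t l : ℝ) : LaurentDeg 1 fun ζ => gZ t l ζ⁻¹ := by
  have h1 := ((LaurentDeg.inv.const_mul (-(((t ^ 2 * l : ℝ)) : ℂ))).add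
    (LaurentDeg.id.const_mul (l : ℂ))).add (LaurentDeg.const (((2 * t * sq1 l : ℝ) : ℂ)))
  have h2 := h1.const_mul (kF t : ℂ)
  simpa only [gZ, inv_inv] using h2

lemma laurentDeg_tB (t l1 l2 : ℝ) (z : ℂ) (i j : Fin 2) :
    LaurentDeg 1 fun ζ => tB t l1 l2 z ζ i j := by
  have hg := laurentDeg_gZ t l2
  have hg' := laurentDeg_gZ_inv t l2
  have h00 : LaurentDeg 1 fun _ => (l1 : ℂ) ^ 2 := LaurentDeg.const _
  have h01 := ((LaurentDeg.const (k := 1) (sq1 l1 : ℂ)).add (hg.const_mul z)).const_mul (-(l1 : ℂ))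
  have h10 := ((LaurentDeg.const (k := 1) (sq1 l1 : ℂ)).add (hg'.const_mul z)).const_mul
    (-(l1 : ℂ))
  have h11 := (LaurentDeg.const (k := 1) (z ^ 2 + (sq1 l1 : ℂ) ^ 2)).add
    ((hg.add hg').const_mul (z * sq1 l1))
  fin_cases i <;> fin_cases j
  · exact h00
  · exact h01
  · exact h10
  · exact h11

lemma exists_isSupercritical {t l1 l2 : ℝ} (ht : t ∈ Set.Ioo (-1 : ℝ) 1)
    (hl1 : l1 ∈ Set.Ioo (0 : ℝ) 1) (hl2 : l2 ∈ Set.Ioo (0 : ℝ) 1)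
    (hsub : l1 < (1 - t ^ 2) / (1 + t ^ 2)) (hlt : l1 < l2) {ω : ℂ} {κ τ : ℝ}
    (h : DioUnit ω κ τ) {z : ℂ} (hz : ‖z‖ = 1) :
    ∃ M F, IsSupercritical (tB t l1 l2 z) (fun ζ => (l1 : ℂ) * z * fZ t l2 ζ) ω M F := by
  obtain ⟨r, hrt, hr⟩ := exists_dominant_root hl1 hsub
  have hr0 : 0 < r := (mul_nonneg hl1.1.le (abs_nonneg t)).trans_lt hrt
  have ht2 : t ^ 2 < 1 := by nlinarith [ht.1, ht.2]
  obtain ⟨F, C, hF, hC, hprod⟩ := exists_prod_fZ_le hl1 hl2 hlt ht2 hrt hr h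
  obtain ⟨c, hc, hgrow⟩ := exists_tB_growth hl1 hl2 hr0 hr hz h.1
  obtain ⟨K, hK⟩ := exists_mN_tB_le t l1 l2 hz
  have hρ : 0 < l2 / (1 + t ^ 2) * r := mul_pos (div_pos hl2.1 (by positivity)) hr0
  obtain ⟨M, hM, hlow, hup⟩ := exists_lyapunov h.1 hK hc hρ hgrow
  refine ⟨M, F, hF.trans_le hM, fun ζ _ => tB_inv _ _ _ _ _, fun ζ hζ => det_tB hl2 z hζ,
    laurentDeg_tB t l1 l2 z, hlow, hup, C, hC, fun n ζ hζ => ?_⟩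
  refine le_trans (le_of_eq (Finset.prod_congr rfl fun j _ => ?_)) (hprod n ζ hζ)
  rw [norm_mul, norm_mul, norm_mul, hz, mul_one]

/-- The field `φ = Q ψ` regrouped as `u_n = (φ_{n-1}⁺, φ_n⁻)`. -/
def coinField (t l2 Φ θ : ℝ) (ψ : ℤ → EuclideanSpace ℂ (Fin 2)) (n : ℤ) : Fin 2 → ℂ :=
  ![(fS t l2 (θ + ((n : ℝ) - 1) * Φ) : ℂ) * ψ (n - 1) 0
      - gS t l2 (θ + ((n : ℝ) - 1) * Φ) * ψ (n - 1) 1,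
    (starRingEnd ℂ) (gS t l2 (θ + (n : ℝ) * Φ)) * ψ n 0
      + (fS t l2 (θ + (n : ℝ) * Φ) : ℂ) * ψ n 1]

lemma eC_orbit (θ Φ : ℝ) (n : ℤ) : eC (θ + (n : ℝ) * Φ) = eC θ * eC Φ ^ n := by
  rw [eC_add, eC_int_mul]

lemma fS_sq_add {t l : ℝ} (hl : l ∈ Set.Ioo (0 : ℝ) 1) (x : ℝ) :
    (fS t l x : ℂ) ^ 2 + gS t l x * (starRingEnd ℂ) (gS t l x) = 1 := by
  rw [conj_gS_eq, gS_eq, fS_eq]; exact fZ_sq_add hl (eC_ne_zero _)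

lemma IsEigen.isSol {t l1 l2 Φ θ : ℝ} (hl1 : l1 ∈ Set.Ioo (0 : ℝ) 1)
    (hl2 : l2 ∈ Set.Ioo (0 : ℝ) 1) {z : ℂ}
    {ψ : ℤ → EuclideanSpace ℂ (Fin 2)} (h : IsEigen t l1 l2 Φ θ z ψ) :
    IsSol (tB t l1 l2 z) (fun ζ => (l1 : ℂ) * z * fZ t l2 ζ) (eC Φ) (eC θ)
      (coinField t l2 Φ θ ψ) := by
  intro n
  have h1 : (sq1 l1 : ℂ) ^ 2 = 1 - (l1 : ℂ) ^ 2 := by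
    exact_mod_cast congrArg (fun x : ℝ => (x : ℂ)) (sq1_sq hl1)
  obtain ⟨e1, e2⟩ := h n
  have hq := fS_sq_add (t := t) hl2 (θ + (n : ℝ) * Φ)
  rw [← eC_orbit]
  rw [tB, Matrix.adjugate_fin_two_of]
  beta_reduce
  rw [← gS_eq, ← conj_gS_eq, ← fS_eq]
  rw [wPlus] at e1
  rw [wMinus] at e2
  have hc : ((n + 1 : ℤ) : ℝ) = (n : ℝ) + 1 := by push_cast; rfl
  have hs : n + 1 - 1 = n := by ring
  have hs' : (n : ℝ) + 1 - 1 = n := by ring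
  simp only [coinField, hc, hs, hs']
  generalize (fS t l2 (θ + ((n : ℝ) - 1) * Φ) : ℂ) * ψ (n - 1) 0
      - gS t l2 (θ + ((n : ℝ) - 1) * Φ) * ψ (n - 1) 1 = x at *
  generalize (starRingEnd ℂ) (gS t l2 (θ + ((n : ℝ) + 1) * Φ)) * ψ (n + 1) 0
      + (fS t l2 (θ + ((n : ℝ) + 1) * Φ) : ℂ) * ψ (n + 1) 1 = y' at *
  generalize (starRingEnd ℂ) (gS t l2 (θ + (n : ℝ) * Φ)) = g' at *
  generalize gS t l2 (θ + (n : ℝ) * Φ) = g at *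
  generalize (fS t l2 (θ + (n : ℝ) * Φ) : ℂ) = f at *
  generalize ψ n 0 = a at *
  generalize ψ n 1 = b at *
  generalize (l1 : ℂ) = l at *
  generalize (sq1 l1 : ℂ) = k at *
  refine ⟨funext fun i => ?_, funext fun i => ?_⟩ <;> fin_cases i <;>
    simp only [Matrix.mulVec, dotProduct, Fin.sum_univ_two, Matrix.of_apply, Matrix.cons_val',
      Matrix.cons_val_zero, Matrix.cons_val_one, Matrix.cons_val_fin_one, Pi.smul_apply,
      smul_eq_mul, Fin.zero_eta, Fin.mk_one]
  · linear_combination l * e1 - l * z * a * hq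
  · linear_combination (-(k + z * g')) * e1 - z * f * e2 + z * k * a * hq
  · linear_combination (k + z * g) * e2 - z * f * e1 - z * k * b * hq
  · linear_combination l * e2 - l * z * b * hq

lemma norm_fS_le {t l : ℝ} (hl : l ∈ Set.Ioo (0 : ℝ) 1) (x : ℝ) :
    ‖(fS t l x : ℂ)‖ ≤ 1 ∧ ‖gS t l x‖ ≤ 1 ∧ ‖(starRingEnd ℂ) (gS t l x)‖ ≤ 1 := by
  have h := fS_sq_add (t := t) hl x
  rw [Complex.mul_conj, Complex.normSq_eq_norm_sq] at h
  have h' : fS t l x ^ 2 + ‖gS t l x‖ ^ 2 = 1 := by exact_mod_cast h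
  have hg : ‖gS t l x‖ ≤ 1 := by nlinarith [sq_nonneg (fS t l x), norm_nonneg (gS t l x)]
  refine ⟨?_, hg, by rwa [RCLike.norm_conj]⟩
  rw [Complex.norm_real, Real.norm_eq_abs]
  exact (sq_le_one_iff_abs_le_one _).1 (by nlinarith [sq_nonneg ‖gS t l x‖])

lemma norm_fiber_le (v : EuclideanSpace ℂ (Fin 2)) : ‖v‖ ≤ ‖v 0‖ + ‖v 1‖ := by
  rw [EuclideanSpace.norm_eq, Fin.sum_univ_two]
  refine Real.sqrt_le_iff.2 ⟨by positivity, ?_⟩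
  nlinarith [mul_nonneg (norm_nonneg (v 0)) (norm_nonneg (v 1))]

lemma norm_mul_add_le {a b x y : ℂ} (ha : ‖a‖ ≤ 1) (hb : ‖b‖ ≤ 1) :
    ‖a * x + b * y‖ ≤ ‖x‖ + ‖y‖ := by
  refine (norm_add_le _ _).trans ?_
  rw [norm_mul, norm_mul]
  have h0 := mul_le_mul_of_nonneg_right ha (norm_nonneg x)
  have h1 := mul_le_mul_of_nonneg_right hb (norm_nonneg y)
  linarith

lemma norm_mul_sub_le {a b x y : ℂ} (ha : ‖a‖ ≤ 1) (hb : ‖b‖ ≤ 1) :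
    ‖a * x - b * y‖ ≤ ‖x‖ + ‖y‖ := by
  have := norm_mul_add_le (x := x) (y := -y) ha hb
  rwa [mul_neg, ← sub_eq_add_neg, norm_neg] at this

lemma coinField_inv {t l2 : ℝ} (hl2 : l2 ∈ Set.Ioo (0 : ℝ) 1) (Φ θ : ℝ)
    (ψ : ℤ → EuclideanSpace ℂ (Fin 2)) (n : ℤ) :
    ψ n 0 = (fS t l2 (θ + (n : ℝ) * Φ) : ℂ) * coinField t l2 Φ θ ψ (n + 1) 0 +
      gS t l2 (θ + (n : ℝ) * Φ) * coinField t l2 Φ θ ψ n 1 ∧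
    ψ n 1 = (fS t l2 (θ + (n : ℝ) * Φ) : ℂ) * coinField t l2 Φ θ ψ n 1 -
      (starRingEnd ℂ) (gS t l2 (θ + (n : ℝ) * Φ)) * coinField t l2 Φ θ ψ (n + 1) 0 := by
  have hq := fS_sq_add (t := t) hl2 (θ + (n : ℝ) * Φ)
  have hc : ((n + 1 : ℤ) : ℝ) - 1 = (n : ℝ) := by push_cast; ring
  have hs : n + 1 - 1 = n := by ring
  simp only [coinField, hc, hs, Matrix.cons_val_zero, Matrix.cons_val_one,
    Matrix.cons_val_fin_one]
  constructor
  · linear_combination -ψ n 0 * hq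
  · linear_combination -ψ n 1 * hq

/-- Nonzero polynomially bounded generalized eigenfunctions decay exponentially. -/
lemma IsEigen.exists_decay {t l1 l2 Φ θ τ κ : ℝ} (ht : t ∈ Set.Ioo (-1 : ℝ) 1)
    (hl1 : l1 ∈ Set.Ioo (0 : ℝ) 1) (hl2 : l2 ∈ Set.Ioo (0 : ℝ) 1)
    (hsub : l1 < (1 - t ^ 2) / (1 + t ^ 2)) (hlt : l1 < l2)
    (hτ : 1 < τ) (hκ : 0 < κ)
    (hdio : ∀ n : ℤ, n ≠ 0 → ∀ j : ℤ, κ / |(n : ℝ)| ^ τ ≤ |(j : ℝ) - (n : ℝ) * Φ|)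
    (hres : {m : ℤ | |Real.sin (2 * Real.pi * (θ + ((m : ℝ) / 2) * Φ))| <
        Real.exp (-(|(m : ℝ)| / 2) ^ (1 / (2 * τ)))}.Finite)
    {z : ℂ} (hz : ‖z‖ = 1) {ψ : ℤ → EuclideanSpace ℂ (Fin 2)} (h : IsEigen t l1 l2 Φ θ z ψ)
    {A : ℝ} {K : ℕ} (hA : 0 ≤ A) (hψ : ∀ n : ℤ, ‖ψ n‖ ≤ A * (1 + |(n : ℝ)|) ^ K)
    {n₀ : ℤ} (hn₀ : ψ n₀ ≠ 0) :
    ∃ C c : ℝ, 0 < C ∧ 0 < c ∧ ∀ n : ℤ, ‖ψ n‖ ≤ C * Real.exp (-c * |(n : ℝ)|) := by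
  have hD := dioUnit_eC hτ hκ hdio
  obtain ⟨M, F, hS⟩ := exists_isSupercritical ht hl1 hl2 hsub hlt hD hz
  set u := coinField t l2 Φ θ ψ with hu
  have hinv := coinField_inv (t := t) hl2 Φ θ ψ
  rw [← hu] at hinv
  have hu0 : ∀ n i, ‖u n i‖ ≤ 2 * (A * 2 ^ K * (1 + |(n : ℝ)|) ^ K) := by
    intro n i
    have hfg := norm_fS_le (t := t) hl2
    have hi : ∀ m, ‖ψ m 0‖ + ‖ψ m 1‖ ≤ 2 * ‖ψ m‖ := fun m => by
      have := PiLp.norm_apply_le (ψ m) 0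
      have := PiLp.norm_apply_le (ψ m) 1
      linarith
    fin_cases i
    · refine (norm_mul_sub_le (hfg _).1 (hfg _).2.1).trans ((hi _).trans ?_)
      refine mul_le_mul_of_nonneg_left ((hψ _).trans ?_) two_pos.le
      rw [mul_assoc, ← mul_pow]
      have : |((n - 1 : ℤ) : ℝ)| ≤ |(n : ℝ)| + 1 := by
        push_cast; exact (abs_sub _ _).trans (by simp)
      have h0 := abs_nonneg (n : ℝ)
      gcongr
      linarith
    · refine (norm_mul_add_le (hfg _).2.2 (hfg _).1).trans ((hi _).trans ?_)
      refine mul_le_mul_of_nonneg_left ((hψ _).trans ?_) two_pos.le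
      rw [mul_assoc, ← mul_pow]
      have h0 := abs_nonneg (n : ℝ)
      gcongr
      linarith
  have hne : ∃ n, u n ≠ 0 := by
    by_contra! hc
    apply hn₀
    have h1 := hinv n₀
    rw [hc, hc] at h1
    ext i
    fin_cases i
    · simpa using h1.1
    · simpa using h1.2
  obtain ⟨n₁, hn₁⟩ := hne
  obtain ⟨C, c, hC, hc, hdec⟩ := hS.exists_decay (ξ := eC θ) hD (norm_eC θ)
    (fun ε hε => exists_small_divisor_bound hτ hκ hdio hres hε) (h.isSol hl1 hl2)
    (A := 2 * (2 * (A * 2 ^ K))) (K := K) (by positivity)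
    (fun n => (add_le_add (hu0 n 0) (hu0 n 1)).trans (le_of_eq (by ring))) hn₁
  refine ⟨2 * (C * Real.exp c + C), c, by positivity, hc, fun n => ?_⟩
  have h1 := hdec (n + 1) 0
  have h2 := hdec n 1
  have h3 : Real.exp (-c * |((n + 1 : ℤ) : ℝ)|) ≤ Real.exp c * Real.exp (-c * |(n : ℝ)|) := by
    rw [← Real.exp_add, Real.exp_le_exp]
    have : |(n : ℝ)| ≤ |((n + 1 : ℤ) : ℝ)| + 1 := by
      have := abs_sub ((n + 1 : ℤ) : ℝ) 1
      push_cast at this ⊢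
      simpa using this
    nlinarith
  have hfg := norm_fS_le (t := t) hl2 (θ + (n : ℝ) * Φ)
  have h4 : C * Real.exp (-c * |((n + 1 : ℤ) : ℝ)|) ≤
      C * (Real.exp c * Real.exp (-c * |(n : ℝ)|)) := by gcongr
  have e0 : ‖ψ n 0‖ ≤ ‖u (n + 1) 0‖ + ‖u n 1‖ := by
    rw [(hinv n).1]; exact norm_mul_add_le hfg.1 hfg.2.1
  have e1 : ‖ψ n 1‖ ≤ ‖u n 1‖ + ‖u (n + 1) 0‖ := by
    rw [(hinv n).2]; exact norm_mul_sub_le hfg.1 hfg.2.2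
  have h5 := norm_fiber_le (ψ n)
  calc ‖ψ n‖ ≤ 2 * (C * (Real.exp c * Real.exp (-c * |(n : ℝ)|)) +
      C * Real.exp (-c * |(n : ℝ)|)) := by linarith
    _ = _ := by ring

section
variable {H : Type*} [NormedAddCommGroup H] [InnerProductSpace ℂ H] [CompleteSpace H]

lemma norm_sq_cfcHom_apply {W : H →L[ℂ] H} (hW : IsStarNormal W) (ξ : H)
    (f : C(spectrum ℂ W, ℂ)) :
    ‖cfcHom hW f ξ‖ ^ 2 = (inner ℂ ξ (cfcHom hW (star f * f) ξ)).re := by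
  rw [map_mul, map_star, mul_apply_eq_comp, ContinuousLinearMap.star_eq_adjoint,
    ContinuousLinearMap.adjoint_inner_right, ← @inner_self_eq_norm_sq ℂ]
  rfl

/-- Complexification of real continuous functions. -/
def ofRealC {X : Type*} [TopologicalSpace X] (f : C(X, ℝ)) : C(X, ℂ) :=
  ⟨fun x => (f x : ℂ), by fun_prop⟩

open scoped CompactlySupported in
/-- The positive functional `f ↦ Re ⟨ξ, f(W) ξ⟩`. -/
def specFunctional {W : H →L[ℂ] H} (hW : IsStarNormal W) (ξ : H) :
    C_c(spectrum ℂ W, ℝ) →ₚ[ℝ] ℝ :=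
  PositiveLinearMap.mk₀
    { toFun := fun f => (inner ℂ ξ (cfcHom hW (ofRealC f.toContinuousMap) ξ)).re
      map_add' := fun f g => by
        have : ofRealC (f + g).toContinuousMap =
            ofRealC f.toContinuousMap + ofRealC g.toContinuousMap := by
          ext x; simp [ofRealC]
        rw [this, map_add, add_apply, inner_add_right, Complex.add_re]
      map_smul' := fun c f => by
        have : ofRealC (c • f).toContinuousMap = (c : ℂ) • ofRealC f.toContinuousMap := by
          ext x; simp [ofRealC]
        rw [this, map_smul, smul_apply, inner_smul_right]
        simp }
    (fun f hf => by
      have hs : ofRealC f.toContinuousMap =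
          star (ofRealC ⟨fun x => Real.sqrt (f x), by fun_prop⟩) *
            ofRealC ⟨fun x => Real.sqrt (f x), by fun_prop⟩ := by
        ext x
        have : 0 ≤ f x := hf x
        have h2 := Real.mul_self_sqrt this
        simp [ofRealC, ← Complex.ofReal_mul, h2]
      change 0 ≤ (inner ℂ ξ (cfcHom hW (ofRealC f.toContinuousMap) ξ)).re
      rw [hs, ← norm_sq_cfcHom_apply]
      positivity)

/-- Spectral representation of the cyclic subspace generated by `ξ`. -/
lemma exists_spectral_representation {W : H →L[ℂ] H} (hW : IsStarNormal W) (ξ : H) :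
    ∃ (μ : Measure (spectrum ℂ W)) (_ : IsFiniteMeasure μ) (U : Lp ℂ 2 μ →ₗᵢ[ℂ] H),
      U (ContinuousMap.toLp 2 μ ℂ 1) = ξ ∧
      ∀ h h' : Lp ℂ 2 μ, (h' =ᵐ[μ] fun x => (x : ℂ) * h x) → W (U h) = U h' := by
  set μ := RealRMK.rieszMeasure (specFunctional hW ξ) with hμ
  have hreg : μ.Regular := by rw [hμ]; infer_instance
  have hfin : IsFiniteMeasure μ := inferInstance
  have h_integral : ∀ f : C(spectrum ℂ W, ℝ), ∫ x, f x ∂μ =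
      (inner ℂ ξ (cfcHom hW (ofRealC f) ξ)).re := fun f =>
    RealRMK.integral_rieszMeasure (specFunctional hW ξ)
      (CompactlySupportedContinuousMap.continuousMapEquiv f)
  set E : C(spectrum ℂ W, ℂ) →L[ℂ] Lp ℂ 2 μ := ContinuousMap.toLp 2 μ ℂ with hE
  have hdense : DenseRange E := ContinuousMap.toLp_denseRange ℂ μ ℂ (by norm_num)
  let f₀ : C(spectrum ℂ W, ℂ) →ₗ[ℂ] H :=
    { toFun := fun f => cfcHom hW f ξ
      map_add' := fun f g => by simp
      map_smul' := fun c f => by simp }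
  have hnorm : ∀ f, ‖f₀ f‖ = ‖E f‖ := by
    intro f
    refine (pow_left_inj₀ (norm_nonneg _) (norm_nonneg _) two_ne_zero).1 ?_
    change ‖cfcHom hW f ξ‖ ^ 2 = _
    have h1 : (star f * f) = ofRealC ⟨fun x => ‖f x‖ ^ 2, by fun_prop⟩ := by
      ext x
      simp [ofRealC, Complex.conj_mul']
    rw [norm_sq_cfcHom_apply, h1, ← h_integral, ← @inner_self_eq_norm_sq ℂ, L2.inner_def]
    have h2 : ∀ᵐ x ∂μ, inner ℂ (E f x) (E f x) = (((‖f x‖ ^ 2 : ℝ)) : ℂ) := by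
      filter_upwards [ContinuousMap.coeFn_toLp (p := 2) (𝕜 := ℂ) μ f] with x hx
      rw [hE, hx, inner_self_eq_norm_sq_to_K]
      simp
    rw [integral_congr_ae h2, integral_complex_ofReal]
    rfl
  have hext := LinearMap.extendOfNorm_eq (f := f₀) (e := E.toLinearMap) hdense
    ⟨1, fun f => by rw [one_mul]; exact (hnorm f).le⟩
  set V := f₀.extendOfNorm E.toLinearMap with hV
  have hVn : ∀ h, ‖V h‖ = ‖h‖ := fun h =>
    hdense.induction_on (p := fun h => ‖V h‖ = ‖h‖) h (isClosed_eq (by fun_prop) (by fun_prop))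
      (fun f => (congrArg norm (hext f)).trans (hnorm f))
  refine ⟨μ, hfin, ⟨V.toLinearMap, hVn⟩, ?_, ?_⟩
  · change V (E 1) = ξ
    refine (hext 1).trans ?_
    change cfcHom hW 1 ξ = ξ
    rw [map_one]; rfl
  · intro h h' hh
    change W (V h) = V h'
    set zc : C(spectrum ℂ W, ℂ) := ContinuousMap.restrict (spectrum ℂ W) (ContinuousMap.id ℂ)
      with hzc
    set zL : Lp ℂ ⊤ μ := ContinuousMap.toLp ⊤ μ ℂ zc with hzL
    set mulz := ContinuousLinearMap.holderL μ ⊤ 2 2 (ContinuousLinearMap.mul ℂ ℂ) zL with hmz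
    have hm : ∀ g : Lp ℂ 2 μ, mulz g =ᵐ[μ] fun x => (x : ℂ) * g x := by
      intro g
      have h1 := ContinuousLinearMap.coeFn_holder (r := 2) (ContinuousLinearMap.mul ℂ ℂ) zL g
      filter_upwards [h1, ContinuousMap.coeFn_toLp (p := ⊤) (𝕜 := ℂ) μ zc] with x hx hx'
      refine hx.trans ?_
      rw [hzL, hx']; rfl
    have hh' : h' = mulz h := Lp.ext (hh.trans (hm h).symm)
    rw [hh']
    refine hdense.induction_on (p := fun h => W (V h) = V (mulz h)) h
      (isClosed_eq (by fun_prop) (by fun_prop)) (fun f => ?_)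
    have h2 : mulz (E f) = E (zc * f) := by
      refine Lp.ext ((hm _).trans ?_)
      filter_upwards [ContinuousMap.coeFn_toLp (p := 2) (𝕜 := ℂ) μ f,
        ContinuousMap.coeFn_toLp (p := 2) (𝕜 := ℂ) μ (zc * f)] with x hx hx'
      rw [hE, hx, hx']; rfl
    rw [h2]
    have e1 : V (E f) = cfcHom hW f ξ := hext f
    have e2 : V (E (zc * f)) = cfcHom hW (zc * f) ξ := hext _
    rw [e1, e2, map_mul, mul_apply_eq_comp]
    congr 1
    exact (cfcHom_id hW).symm
end

lemma summable_inv_one_add_abs_sq : Summable fun n : ℤ => 1 / (1 + |(n : ℝ)|) ^ 2 := by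
  have h : Summable fun n : ℕ => 1 / (1 + (n : ℝ)) ^ 2 := by
    have := (summable_nat_add_iff 1).2 (Real.summable_one_div_nat_pow.2 one_lt_two)
    simpa [add_comm] using this
  refine Summable.of_nat_of_neg ?_ ?_ <;> simpa using h

/-- A bounded sequence in `L²` is almost everywhere linearly bounded. -/
lemma ae_exists_linear_bound {X : Type*} [MeasurableSpace X] {μ : Measure X}
    (F : ℤ → Lp ℂ 2 μ) (hF : ∀ n, ‖F n‖ ≤ 1) :
    ∀ᵐ x ∂μ, ∃ A : ℝ, 0 ≤ A ∧ ∀ n, ‖F n x‖ ≤ A * (1 + |(n : ℝ)|) := by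
  set w : ℤ → ENNReal := fun n => ENNReal.ofReal (1 / (1 + |(n : ℝ)|) ^ 2) with hw
  have hmeas : ∀ n, AEMeasurable (fun x => ‖F n x‖ₑ ^ 2) μ := fun n =>
    ((Lp.stronglyMeasurable (F n)).measurable.enorm.pow_const 2).aemeasurable
  have h1 : ∀ n, ∫⁻ x, ‖F n x‖ₑ ^ 2 ∂μ ≤ 1 := by
    intro n
    have h2 := eLpNorm_nnreal_pow_eq_lintegral (f := F n) (μ := μ) (p := 2) two_ne_zero
    have h3 : eLpNorm (F n) 2 μ ≤ 1 := by
      have h4 := hF n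
      rw [Lp.norm_def] at h4
      exact (ENNReal.toReal_le_toReal (Lp.eLpNorm_ne_top _) ENNReal.one_ne_top).1
        (by simpa using h4)
    have h5 : ∫⁻ x, ‖F n x‖ₑ ^ 2 ∂μ = eLpNorm (F n) 2 μ ^ 2 := by
      have := h2.symm
      simp only [NNReal.coe_ofNat, ENNReal.rpow_ofNat, ENNReal.coe_ofNat] at this
      exact this
    rw [h5]
    exact pow_le_one₀ zero_le h3
  have hS : ∫⁻ x, ∑' n, w n * ‖F n x‖ₑ ^ 2 ∂μ ≠ ⊤ := by
    rw [lintegral_tsum fun n => (hmeas n).const_mul _]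
    have h2 : ∑' n, ∫⁻ x, w n * ‖F n x‖ₑ ^ 2 ∂μ ≤ ∑' n, w n := by
      refine ENNReal.tsum_le_tsum fun n => ?_
      rw [lintegral_const_mul'' _ (hmeas n)]
      exact mul_le_of_le_one_right zero_le (h1 n)
    exact ne_top_of_le_ne_top summable_inv_one_add_abs_sq.tsum_ofReal_ne_top h2
  filter_upwards [ae_lt_top' (AEMeasurable.tsum fun n => (hmeas n).const_mul _) hS] with x hx
  set S := ∑' n, w n * ‖F n x‖ₑ ^ 2 with hSdef
  refine ⟨S.toReal + 1, by positivity, fun n => ?_⟩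
  have h2 : w n * ‖F n x‖ₑ ^ 2 ≤ S := ENNReal.le_tsum n
  have h3 := ENNReal.toReal_mono hx.ne h2
  rw [ENNReal.toReal_mul, ENNReal.toReal_pow, toReal_enorm, hw,
    ENNReal.toReal_ofReal (by positivity), div_mul_eq_mul_div, one_mul,
    div_le_iff₀ (by positivity)] at h3
  have hS0 : 0 ≤ S.toReal := ENNReal.toReal_nonneg
  refine (sq_le_sq₀ (norm_nonneg _) (by positivity)).1 (h3.trans ?_)
  rw [mul_pow]
  gcongr
  nlinarith

section
variable {H : Type*} [NormedAddCommGroup H] [InnerProductSpace ℂ H] [CompleteSpace H]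
  {W : H →L[ℂ] H} {μ : Measure (spectrum ℂ W)} [IsFiniteMeasure μ] {U : Lp ℂ 2 μ →ₗᵢ[ℂ] H}

lemma exists_continuous_mul (q : C(spectrum ℂ W, ℂ)) (h : Lp ℂ 2 μ) :
    ∃ g : Lp ℂ 2 μ, g =ᵐ[μ] fun x => q x * h x := by
  refine ⟨ContinuousLinearMap.holder 2 (ContinuousLinearMap.mul ℂ ℂ)
    (ContinuousMap.toLp ⊤ μ ℂ q) h, ?_⟩
  filter_upwards [ContinuousLinearMap.coeFn_holder (r := 2) (ContinuousLinearMap.mul ℂ ℂ)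
    (ContinuousMap.toLp ⊤ μ ℂ q) h, ContinuousMap.coeFn_toLp (p := ⊤) (𝕜 := ℂ) μ q] with x hx hx'
  rw [hx, hx']; rfl

/-- Transpose of a finite-range recursion to the spectral side. -/
lemma ae_adjoint_relation (hU : ∀ h h' : Lp ℂ 2 μ,
      (h' =ᵐ[μ] fun x => (x : ℂ) * h x) → W (U h) = U h')
    {δ δ₁ δ₂ δ₃ δ₄ : H} {c₁ c₂ c₃ c₄ : ℂ}
    (hδ : ∀ v, inner ℂ δ (W v) = c₁ * inner ℂ δ₁ v + c₂ * inner ℂ δ₂ v + c₃ * inner ℂ δ₃ v +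
      c₄ * inner ℂ δ₄ v) {F : H →L[ℂ] Lp ℂ 2 μ}
    (hF : F = ContinuousLinearMap.adjoint U.toContinuousLinearMap) :
    ∀ᵐ x ∂μ, c₁ * star (F δ₁ x) + c₂ * star (F δ₂ x) + c₃ * star (F δ₃ x) + c₄ * star (F δ₄ x) =
      x * star (F δ x) := by
  have hFi : ∀ v h, inner ℂ (F v) h = inner ℂ v (U h) := fun v h => by
    rw [hF, ContinuousLinearMap.adjoint_inner_left]; rfl
  set zc : C(spectrum ℂ W, ℂ) := ContinuousMap.restrict (spectrum ℂ W) (ContinuousMap.id ℂ)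
  obtain ⟨g, hg⟩ := exists_continuous_mul (star zc) (F δ)
  have key : star c₁ • F δ₁ + star c₂ • F δ₂ + star c₃ • F δ₃ + star c₄ • F δ₄ = g := by
    refine ext_inner_right ℂ fun h => ?_
    obtain ⟨h', hh'⟩ := exists_continuous_mul zc h
    have e1 : inner ℂ g h = inner ℂ (F δ) h' := by
      rw [L2.inner_def, L2.inner_def]
      refine integral_congr_ae ?_
      filter_upwards [hg, hh'] with x hx hx'
      rw [hx, hx']
      simp only [RCLike.inner_apply, map_mul, ContinuousMap.star_apply, RCLike.star_def,
        RCLike.conj_conj]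
      ring
    rw [e1, hFi, ← hU h h' hh', hδ]
    simp only [inner_add_left, inner_smul_left, hFi, RCLike.star_def, RCLike.conj_conj]
  rw [← key] at hg
  filter_upwards [hg, Lp.coeFn_add (star c₁ • F δ₁ + star c₂ • F δ₂ + star c₃ • F δ₃)
    (star c₄ • F δ₄), Lp.coeFn_add (star c₁ • F δ₁ + star c₂ • F δ₂) (star c₃ • F δ₃),
    Lp.coeFn_add (star c₁ • F δ₁) (star c₂ • F δ₂), Lp.coeFn_smul (star c₁) (F δ₁),
    Lp.coeFn_smul (star c₂) (F δ₂), Lp.coeFn_smul (star c₃) (F δ₃),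
    Lp.coeFn_smul (star c₄) (F δ₄)] with x h0 h1 h2 h3 h4 h5 h6 h7
  rw [h1, Pi.add_apply, h2, Pi.add_apply, h3, Pi.add_apply, h4, h5, h6, h7] at h0
  have := congrArg star h0
  simp only [Pi.smul_apply, smul_eq_mul, star_add, star_mul', star_star,
    ContinuousMap.star_apply] at this
  exact this

/-- An atom of the spectral measure carried by the eigenvalues yields an eigenvector. -/
lemma exists_eigenvector_of_atom (hU : ∀ h h' : Lp ℂ 2 μ,
      (h' =ᵐ[μ] fun x => (x : ℂ) * h x) → W (U h) = U h') {x₀ : spectrum ℂ W} (hx₀ : μ {x₀} ≠ 0) :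
    ∃ η : H, W η = (x₀ : ℂ) • η ∧ inner ℂ η (U (ContinuousMap.toLp 2 μ ℂ 1)) ≠ 0 := by
  set e := indicatorConstLp 2 (measurableSet_singleton x₀) (measure_ne_top μ _) (1 : ℂ) with he
  refine ⟨U e, ?_, ?_⟩
  · rw [← map_smul]
    refine hU _ _ ?_
    filter_upwards [Lp.coeFn_smul (x₀ : ℂ) e, indicatorConstLp_coeFn (p := 2)
      (hs := measurableSet_singleton x₀) (hμs := measure_ne_top μ _) (c := (1 : ℂ))] with x h1 h2
    rw [h1, Pi.smul_apply, he, h2, smul_eq_mul]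
    by_cases hx : x = x₀
    · rw [hx]
    · simp [hx]
  · rw [U.inner_map_map, he, L2.inner_indicatorConstLp_one]
    have h1 : ∀ᵐ x ∂(μ.restrict {x₀}), (ContinuousMap.toLp 2 μ ℂ 1 : Lp ℂ 2 μ) x = 1 :=
      ae_restrict_of_ae (by
        filter_upwards [ContinuousMap.coeFn_toLp (p := 2) (𝕜 := ℂ) μ
          (1 : C(spectrum ℂ W, ℂ))] with x hx
        rw [hx]; rfl)
    rw [integral_congr_ae h1]
    simp [Measure.real, ENNReal.toReal_eq_zero_iff, hx₀]
end

lemma enorm_sq_fiber (v : EuclideanSpace ℂ (Fin 2)) : ‖v‖ₑ ^ 2 = ‖v 0‖ₑ ^ 2 + ‖v 1‖ₑ ^ 2 := by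
  have h := EuclideanSpace.norm_sq_eq v
  rw [Fin.sum_univ_two] at h
  rw [← ofReal_norm, ← ofReal_norm, ← ofReal_norm,
    ← ENNReal.ofReal_pow (norm_nonneg _), ← ENNReal.ofReal_pow (norm_nonneg _),
    ← ENNReal.ofReal_pow (norm_nonneg _), ← ENNReal.ofReal_add (by positivity) (by positivity), h]

lemma enorm_sq_rotation {f : ℝ} {g : ℂ} (h : (f : ℂ) ^ 2 + g * (starRingEnd ℂ) g = 1) (a b : ℂ) :
    ‖f * a - g * b‖ₑ ^ 2 + ‖(starRingEnd ℂ) g * a + f * b‖ₑ ^ 2 = ‖a‖ₑ ^ 2 + ‖b‖ₑ ^ 2 := by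
  have key : ‖f * a - g * b‖ ^ 2 + ‖(starRingEnd ℂ) g * a + f * b‖ ^ 2 = ‖a‖ ^ 2 + ‖b‖ ^ 2 := by
    have : ∀ w : ℂ, ((‖w‖ ^ 2 : ℝ) : ℂ) = w * (starRingEnd ℂ) w := fun w => by
      rw [Complex.mul_conj, Complex.normSq_eq_norm_sq]
    apply Complex.ofReal_injective
    rw [Complex.ofReal_add, Complex.ofReal_add, this, this, this, this]
    simp only [map_sub, map_add, map_mul, Complex.conj_ofReal, RCLike.conj_conj]
    linear_combination (a * (starRingEnd ℂ) a + b * (starRingEnd ℂ) b) * h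
  simp only [← ofReal_norm, ← ENNReal.ofReal_pow (norm_nonneg _)]
  rw [← ENNReal.ofReal_add (by positivity) (by positivity),
    ← ENNReal.ofReal_add (by positivity) (by positivity), key]

lemma tsum_enorm_sq_ne_top_iff {f : ℤ → EuclideanSpace ℂ (Fin 2)} :
    ∑' n, ‖f n‖ₑ ^ 2 ≠ ⊤ ↔ Memℓp f 2 := by
  rw [memℓp_gen_iff (by norm_num)]
  have : ∀ n, ‖f n‖ₑ ^ 2 = ENNReal.ofReal (‖f n‖ ^ (2 : ENNReal).toReal) := fun n => by
    rw [← ofReal_norm, ← ENNReal.ofReal_pow (norm_nonneg _)]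
    norm_num
  simp only [this]
  constructor
  · intro h
    refine (ENNReal.summable_toReal h).congr fun n => ?_
    exact ENNReal.toReal_ofReal (by positivity)
  · intro h
    exact h.tsum_ofReal_ne_top

lemma H2.norm_sq_eq (v : H2) : ‖v‖ ^ 2 = (∑' n, ‖v n‖ₑ ^ 2).toReal := by
  have h := lp.norm_rpow_eq_tsum (p := 2) (by norm_num) v
  rw [ENNReal.tsum_toReal_eq (fun n => by simp)]
  simp only [ENNReal.toReal_ofNat, Real.rpow_ofNat] at h
  rw [h]
  simp

/-- A bijective linear map preserving square sums is a unitary of `ℓ²(ℤ; ℂ²)`. -/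
def H2.isometryEquiv
    (T : (ℤ → EuclideanSpace ℂ (Fin 2)) →ₗ[ℂ] (ℤ → EuclideanSpace ℂ (Fin 2)))
    (hT : ∀ f, ∑' n, ‖T f n‖ₑ ^ 2 = ∑' n, ‖f n‖ₑ ^ 2) (hs : Function.Surjective T) :
    H2 ≃ₗᵢ[ℂ] H2 :=
  LinearIsometryEquiv.ofSurjective
    { toFun := fun v => ⟨T v, tsum_enorm_sq_ne_top_iff.1
        ((hT v).trans_ne (tsum_enorm_sq_ne_top_iff.2 (lp.memℓp v)))⟩
      map_add' := fun v w => lp.ext (T.map_add v w)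
      map_smul' := fun c v => lp.ext (T.map_smul c v)
      norm_map' := fun v => by
        refine (pow_left_inj₀ (norm_nonneg _) (norm_nonneg _) two_ne_zero).1 ?_
        rw [H2.norm_sq_eq, H2.norm_sq_eq]
        exact congrArg ENNReal.toReal (hT v) }
    (fun w => by
      obtain ⟨f, hf⟩ := hs w
      refine ⟨⟨f, tsum_enorm_sq_ne_top_iff.1
        ((hT f).symm.trans_ne ?_)⟩, lp.ext hf⟩
      rw [hf]; exact tsum_enorm_sq_ne_top_iff.2 (lp.memℓp w))

/-- The quantum walk on arbitrary sequences. -/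
def walkFun (t l1 l2 Φ θ : ℝ) :
    (ℤ → EuclideanSpace ℂ (Fin 2)) →ₗ[ℂ] (ℤ → EuclideanSpace ℂ (Fin 2)) where
  toFun ψ n := !₂[wPlus t l1 l2 Φ θ ψ n, wMinus t l1 l2 Φ θ ψ n]
  map_add' ψ χ := by
    funext n; ext i
    fin_cases i <;> simp [wPlus, wMinus] <;> ring
  map_smul' c ψ := by
    funext n; ext i
    fin_cases i <;> simp [wPlus, wMinus] <;> ring

section
variable {t l1 l2 : ℝ} (Φ θ : ℝ)

lemma wPlus_eq (ψ : ℤ → EuclideanSpace ℂ (Fin 2)) (n : ℤ) : wPlus t l1 l2 Φ θ ψ n =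
    l1 * coinField t l2 Φ θ ψ n 0 - sq1 l1 * coinField t l2 Φ θ ψ n 1 := rfl

lemma wMinus_eq (ψ : ℤ → EuclideanSpace ℂ (Fin 2)) (n : ℤ) : wMinus t l1 l2 Φ θ ψ n =
    (starRingEnd ℂ) (sq1 l1 : ℂ) * coinField t l2 Φ θ ψ (n + 1) 0 +
      l1 * coinField t l2 Φ θ ψ (n + 1) 1 := by
  have hc : ((n + 1 : ℤ) : ℝ) = (n : ℝ) + 1 := by push_cast; rfl
  have hs : n + 1 - 1 = n := by ring
  have hs' : (n : ℝ) + 1 - 1 = n := by ring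
  simp only [wMinus, coinField, hc, hs, hs', Matrix.cons_val_zero, Matrix.cons_val_one,
    Matrix.cons_val_fin_one, Complex.conj_ofReal]
  ring

lemma shift_coin_sq (hl1 : l1 ∈ Set.Ioo (0 : ℝ) 1) :
    (l1 : ℂ) ^ 2 + (sq1 l1 : ℂ) * (starRingEnd ℂ) (sq1 l1 : ℂ) = 1 := by
  have h := sq1_sq hl1
  rw [Complex.conj_ofReal, ← sq]
  exact_mod_cast (by rw [h]; ring : l1 ^ 2 + sq1 l1 ^ 2 = 1)

lemma tsum_enorm_sq_walkFun (hl1 : l1 ∈ Set.Ioo (0 : ℝ) 1) (hl2 : l2 ∈ Set.Ioo (0 : ℝ) 1)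
    (ψ : ℤ → EuclideanSpace ℂ (Fin 2)) :
    ∑' n, ‖walkFun t l1 l2 Φ θ ψ n‖ₑ ^ 2 = ∑' n, ‖ψ n‖ₑ ^ 2 := by
  have hshift : ∀ G : ℤ → ENNReal, ∑' n, G (n + 1) = ∑' n, G n := fun G =>
    (Equiv.addRight (1 : ℤ)).tsum_eq G
  set u := coinField t l2 Φ θ ψ with hu
  have h1 : ∀ n, ‖wPlus t l1 l2 Φ θ ψ (n + 1)‖ₑ ^ 2 + ‖wMinus t l1 l2 Φ θ ψ n‖ₑ ^ 2 =
      ‖u (n + 1) 0‖ₑ ^ 2 + ‖u (n + 1) 1‖ₑ ^ 2 := fun n => by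
    rw [wPlus_eq, wMinus_eq, enorm_sq_rotation (shift_coin_sq hl1)]
  have h2 : ∀ n, ‖u (n + 1) 0‖ₑ ^ 2 + ‖u n 1‖ₑ ^ 2 = ‖ψ n‖ₑ ^ 2 := fun n => by
    rw [enorm_sq_fiber,
      ← enorm_sq_rotation (fS_sq_add (t := t) hl2 (θ + (n : ℝ) * Φ)) (ψ n 0) (ψ n 1)]
    have hc : ((n + 1 : ℤ) : ℝ) - 1 = (n : ℝ) := by push_cast; ring
    have hs : n + 1 - 1 = n := by ring
    simp only [hu, coinField, hc, hs, Matrix.cons_val_zero, Matrix.cons_val_one,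
      Matrix.cons_val_fin_one]
  calc ∑' n, ‖walkFun t l1 l2 Φ θ ψ n‖ₑ ^ 2
      = ∑' n, (‖wPlus t l1 l2 Φ θ ψ n‖ₑ ^ 2 + ‖wMinus t l1 l2 Φ θ ψ n‖ₑ ^ 2) :=
        tsum_congr fun n => enorm_sq_fiber _
    _ = ∑' n, (‖u (n + 1) 0‖ₑ ^ 2 + ‖u (n + 1) 1‖ₑ ^ 2) := by
        rw [ENNReal.tsum_add, ← hshift fun n => ‖wPlus t l1 l2 Φ θ ψ n‖ₑ ^ 2, ← ENNReal.tsum_add]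
        exact tsum_congr h1
    _ = ∑' n, (‖u (n + 1) 0‖ₑ ^ 2 + ‖u n 1‖ₑ ^ 2) := by
        rw [ENNReal.tsum_add, hshift fun n => ‖u n 1‖ₑ ^ 2, ← ENNReal.tsum_add]
    _ = _ := tsum_congr h2

lemma walkFun_surjective (hl1 : l1 ∈ Set.Ioo (0 : ℝ) 1) (hl2 : l2 ∈ Set.Ioo (0 : ℝ) 1) :
    Function.Surjective (walkFun t l1 l2 Φ θ) := by
  intro χ
  set x : ℤ → ℂ := fun n => l1 * χ n 0 + sq1 l1 * χ (n - 1) 1 with hx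
  set y : ℤ → ℂ := fun n => l1 * χ (n - 1) 1 - sq1 l1 * χ n 0 with hy
  set ψ : ℤ → EuclideanSpace ℂ (Fin 2) := fun n =>
    !₂[(fS t l2 (θ + (n : ℝ) * Φ) : ℂ) * x (n + 1) + gS t l2 (θ + (n : ℝ) * Φ) * y n,
      (fS t l2 (θ + (n : ℝ) * Φ) : ℂ) * y n -
        (starRingEnd ℂ) (gS t l2 (θ + (n : ℝ) * Φ)) * x (n + 1)] with hψ
  have hu0 : ∀ n, coinField t l2 Φ θ ψ n 0 = x n := fun n => by
    have hq := fS_sq_add (t := t) hl2 (θ + ((n : ℝ) - 1) * Φ)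
    have hc : ((n - 1 : ℤ) : ℝ) = (n : ℝ) - 1 := by push_cast; rfl
    have hs : n - 1 + 1 = n := by ring
    simp only [hψ, coinField, Matrix.cons_val_zero, Matrix.cons_val_one,
      Matrix.cons_val_fin_one, hc, hs]
    linear_combination x n * hq
  have hu1 : ∀ n, coinField t l2 Φ θ ψ n 1 = y n := fun n => by
    have hq := fS_sq_add (t := t) hl2 (θ + (n : ℝ) * Φ)
    simp only [hψ, coinField, Matrix.cons_val_zero, Matrix.cons_val_one,
      Matrix.cons_val_fin_one]
    linear_combination y n * hq
  have hk := shift_coin_sq hl1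
  rw [Complex.conj_ofReal] at hk
  refine ⟨ψ, funext fun n => ?_⟩
  ext i
  fin_cases i
  · change wPlus t l1 l2 Φ θ ψ n = χ n 0
    rw [wPlus_eq, hu0, hu1, hx, hy]
    linear_combination χ n 0 * hk
  · change wMinus t l1 l2 Φ θ ψ n = χ n 1
    have hs : n + 1 - 1 = n := by ring
    rw [wMinus_eq, hu0, hu1, hx, hy, Complex.conj_ofReal]
    simp only [hs]
    linear_combination χ n 1 * hk

/-- The quantum walk as a unitary operator. -/
def walk (hl1 : l1 ∈ Set.Ioo (0 : ℝ) 1) (hl2 : l2 ∈ Set.Ioo (0 : ℝ) 1) (t Φ θ : ℝ) :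
    H2 ≃ₗᵢ[ℂ] H2 :=
  H2.isometryEquiv (walkFun t l1 l2 Φ θ) (tsum_enorm_sq_walkFun Φ θ hl1 hl2)
    (walkFun_surjective Φ θ hl1 hl2)

lemma walk_apply (hl1 : l1 ∈ Set.Ioo (0 : ℝ) 1) (hl2 : l2 ∈ Set.Ioo (0 : ℝ) 1) (t Φ θ : ℝ)
    (v : H2) (n : ℤ) : walk hl1 hl2 t Φ θ v n =
      !₂[wPlus t l1 l2 Φ θ v n, wMinus t l1 l2 Φ θ v n] := rfl

lemma walk_eq_smul_iff (hl1 : l1 ∈ Set.Ioo (0 : ℝ) 1) (hl2 : l2 ∈ Set.Ioo (0 : ℝ) 1) (t Φ θ : ℝ)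
    (v : H2) (z : ℂ) : walk hl1 hl2 t Φ θ v = z • v ↔ IsEigen t l1 l2 Φ θ z fun n => v n := by
  constructor
  · intro h n
    have h1 : walk hl1 hl2 t Φ θ v n = z • v n := by rw [h]; rfl
    rw [walk_apply] at h1
    exact ⟨congrArg (fun w : EuclideanSpace ℂ (Fin 2) => w 0) h1,
      congrArg (fun w : EuclideanSpace ℂ (Fin 2) => w 1) h1⟩
  · intro h
    refine lp.ext (funext fun n => ?_)
    rw [walk_apply]
    ext i
    fin_cases i
    · exact (h n).1
    · exact (h n).2
end

section
variable {H : Type*} [NormedAddCommGroup H] [InnerProductSpace ℂ H]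

/-- Bessel: an orthonormal family is countable if countably many vectors separate points. -/
lemma Orthonormal.countable_of_separating {ι κ : Type*} [Countable κ] {v : ι → H}
    (hv : Orthonormal ℂ v) (δ : κ → H) (hδ : ∀ w, (∀ k, inner ℂ w (δ k) = 0) → w = 0) :
    Countable ι := by
  have h : (⋃ k, Function.support fun i => ‖inner ℂ (v i) (δ k)‖ ^ 2).Countable :=
    Set.countable_iUnion fun k => (hv.inner_products_summable (δ k)).countable_support
  refine Set.countable_univ_iff.1 (h.mono fun i _ => ?_)
  by_contra hi
  simp only [Set.mem_iUnion, Function.mem_support, ne_eq, not_exists, not_not] at hi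
  exact hv.ne_zero i (hδ _ fun k => by simpa using hi k)

lemma LinearIsometryEquiv.norm_eigenvalue {W : H ≃ₗᵢ[ℂ] H} {v : H} {z : ℂ} (hv : v ≠ 0)
    (h : W v = z • v) : ‖z‖ = 1 := by
  have h1 := W.norm_map v
  rw [h, norm_smul] at h1
  exact mul_right_cancel₀ (norm_ne_zero_iff.2 hv) (h1.trans (one_mul _).symm)

lemma LinearIsometryEquiv.inner_eigenvector_eq_zero {W : H ≃ₗᵢ[ℂ] H} {v w : H} {z y : ℂ}
    (hzy : z ≠ y) (hv : W v = z • v) (hw : W w = y • w) : inner ℂ v w = 0 := by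
  rcases eq_or_ne v 0 with rfl | hv0
  · simp
  have hz := W.norm_eigenvalue hv0 hv
  have h1 := W.inner_map_map v w
  rw [hv, hw, inner_smul_left, inner_smul_right] at h1
  by_contra h0
  have h2 : (starRingEnd ℂ) z * y = 1 := mul_right_cancel₀ h0 (by rw [mul_assoc, h1, one_mul])
  have h3 : z * (starRingEnd ℂ) z = 1 := by
    rw [Complex.mul_conj, Complex.normSq_eq_norm_sq, hz]; simp
  exact hzy (by linear_combination (-z) * h2 + y * h3)

lemma LinearIsometryEquiv.countable_eigenvalues (W : H ≃ₗᵢ[ℂ] H) {κ : Type*} [Countable κ]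
    (δ : κ → H) (hδ : ∀ w, (∀ k, inner ℂ w (δ k) = 0) → w = 0) :
    {z : ℂ | ∃ v, v ≠ 0 ∧ W v = z • v}.Countable := by
  set E := {z : ℂ | ∃ v, v ≠ 0 ∧ W v = z • v} with hE
  have : ∀ z : E, ∃ v : H, ‖v‖ = 1 ∧ W v = (z : ℂ) • v := by
    rintro ⟨z, v, hv, h⟩
    refine ⟨((‖v‖⁻¹ : ℝ) : ℂ) • v, ?_, ?_⟩
    · rw [norm_smul, Complex.norm_real, norm_inv, norm_norm,
        inv_mul_cancel₀ (norm_ne_zero_iff.2 hv)]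
    · rw [map_smul]
      exact (congrArg _ h).trans (smul_comm _ _ _)
  choose v hv1 hv using this
  have ho : Orthonormal ℂ v := ⟨hv1, fun x y hxy =>
    W.inner_eigenvector_eq_zero (fun h => hxy (Subtype.ext h)) (hv x) (hv y)⟩
  exact ho.countable_of_separating δ hδ

lemma LinearIsometryEquiv.coe_mem_unitary [CompleteSpace H] (W : H ≃ₗᵢ[ℂ] H) :
    (W : H →L[ℂ] H) ∈ unitary (H →L[ℂ] H) :=
  (Unitary.linearIsometryEquiv.symm W).2
variable [CompleteSpace H]

lemma LinearIsometryEquiv.exists_eigenvector_inner_ne_zero (W : H ≃ₗᵢ[ℂ] H) {δ : ℤ × Fin 2 → H}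
    (hδ1 : ∀ p, ‖δ p‖ ≤ 1) (hδ : ∀ w, (∀ p, inner ℂ w (δ p) = 0) → w = 0)
    {c : ℤ × Fin 2 → Fin 4 → ℂ} {N : ℤ × Fin 2 → Fin 4 → ℤ × Fin 2}
    (hW : ∀ p v, inner ℂ (δ p) (W v) = c p 0 * inner ℂ (δ (N p 0)) v +
      c p 1 * inner ℂ (δ (N p 1)) v + c p 2 * inner ℂ (δ (N p 2)) v +
      c p 3 * inner ℂ (δ (N p 3)) v)
    (hloc : ∀ z : ℂ, ‖z‖ = 1 → ∀ a : ℤ × Fin 2 → ℂ,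
      (∀ p, c p 0 * a (N p 0) + c p 1 * a (N p 1) + c p 2 * a (N p 2) + c p 3 * a (N p 3) =
        z * a p) →
      ∀ A : ℝ, 0 ≤ A → (∀ n i, ‖a (n, i)‖ ≤ A * (1 + |(n : ℝ)|)) → a ≠ 0 →
      ∃ v, v ≠ 0 ∧ W v = z • v) {ξ : H} (hξ : ξ ≠ 0) :
    ∃ (η : H) (z : ℂ), W η = z • η ∧ inner ℂ η ξ ≠ 0 := by
  set V : H →L[ℂ] H := (W : H →L[ℂ] H)
  have hVu : V ∈ unitary (H →L[ℂ] H) := W.coe_mem_unitary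
  obtain ⟨μ, _, U, hU1, hU⟩ := exists_spectral_representation (W := V)
    (isStarNormal_of_mem_unitary hVu) ξ
  by_contra! hno
  have hatom : ∀ x : spectrum ℂ V, μ {x} = 0 := by
    intro x
    by_contra hx
    obtain ⟨η, h1, h2⟩ := exists_eigenvector_of_atom hU hx
    rw [hU1] at h2
    exact h2 (hno η x h1)
  set F := ContinuousLinearMap.adjoint U.toContinuousLinearMap with hF
  have hFn : ∀ p, ‖F (δ p)‖ ≤ 1 := fun p => by
    refine (F.le_opNorm _).trans (mul_le_one₀ ?_ (norm_nonneg _) (hδ1 p))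
    rw [hF, LinearIsometryEquiv.norm_map]
    exact U.norm_toContinuousLinearMap_le
  set E := {z : ℂ | ∃ v, v ≠ 0 ∧ W v = z • v} with hE
  have hE0 : ∀ᵐ x : spectrum ℂ V ∂μ, (x : ℂ) ∉ E := by
    set P : Set (spectrum ℂ V) := {x | (x : ℂ) ∈ E} with hP
    have h1 : P.Countable := (W.countable_eigenvalues δ hδ).preimage Subtype.val_injective
    rw [ae_iff]
    simp only [not_not]
    rw [← hP, ← Set.biUnion_of_singleton P, measure_biUnion_null_iff h1]
    exact fun x _ => hatom x
  have hrec := ae_all_iff.2 fun p => ae_adjoint_relation hU (hW p) hF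
  have hzero : ∀ᵐ x ∂μ, ∀ p, F (δ p) x = 0 := by
    filter_upwards [hE0, hrec,
      ae_exists_linear_bound (fun n => F (δ (n, 0))) (fun n => hFn (n, 0)),
      ae_exists_linear_bound (fun n => F (δ (n, 1))) (fun n => hFn (n, 1))]
      with x hxE hx ⟨A, hA, hxA⟩ ⟨B, hB, hxB⟩
    by_contra! ⟨p, hp⟩
    refine hxE (hloc x (spectrum.norm_eq_one_of_unitary hVu x.2) (fun p => star (F (δ p) x)) hx
      (A + B) (by positivity) (fun n i => ?_) fun h0 => hp (star_eq_zero.1 (congrFun h0 p)))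
    rw [norm_star, add_mul]
    have h1 : 0 ≤ A * (1 + |(n : ℝ)|) := by positivity
    have h2 : 0 ≤ B * (1 + |(n : ℝ)|) := by positivity
    fin_cases i
    · exact (hxA n).trans (le_add_of_nonneg_right h2)
    · exact (hxB n).trans (le_add_of_nonneg_left h1)
  refine hξ (hδ _ fun p => ?_)
  have h1 : F (δ p) = 0 := by
    refine Lp.ext ?_
    filter_upwards [hzero, Lp.coeFn_zero ℂ 2 μ] with x hx hx0
    rw [hx, hx0]; rfl
  have h2 : inner ℂ (F (δ p)) (ContinuousMap.toLp 2 μ ℂ 1) = inner ℂ (δ p) ξ := by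
    rw [hF, ContinuousLinearMap.adjoint_inner_left]
    exact congrArg _ hU1
  rw [inner_eq_zero_symm, ← h2, h1, inner_zero_left]
end

/-- The standard basis vector of `ℓ²(ℤ; ℂ²)` at site `p.1` with spin `p.2`. -/
def siteVector (p : ℤ × Fin 2) : H2 := lp.single 2 p.1 (EuclideanSpace.single p.2 1)

lemma inner_siteVector (p : ℤ × Fin 2) (v : H2) : inner ℂ (siteVector p) v = v p.1 p.2 := by
  rw [siteVector, lp.inner_single_left, EuclideanSpace.inner_single_left]
  simp

lemma norm_siteVector (p : ℤ × Fin 2) : ‖siteVector p‖ = 1 := by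
  rw [siteVector, lp.norm_single (by norm_num)]
  simp

lemma H2.ext_siteVector {v : H2} (h : ∀ p, inner ℂ v (siteVector p) = 0) : v = 0 := by
  refine lp.ext (funext fun n => ?_)
  ext i
  have := inner_eq_zero_symm.1 (h (n, i))
  rwa [inner_siteVector] at this

/-- The coefficients of the walk in the basis of site vectors. -/
def walkCoeff (t l1 l2 Φ θ : ℝ) (p : ℤ × Fin 2) : Fin 4 → ℂ :=
  ![![(l1 : ℂ) * fS t l2 (θ + ((p.1 : ℝ) - 1) * Φ), -(l1 * gS t l2 (θ + ((p.1 : ℝ) - 1) * Φ)),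
      -(sq1 l1 * (starRingEnd ℂ) (gS t l2 (θ + (p.1 : ℝ) * Φ))),
      -(sq1 l1 * fS t l2 (θ + (p.1 : ℝ) * Φ))],
    ![(l1 : ℂ) * (starRingEnd ℂ) (gS t l2 (θ + ((p.1 : ℝ) + 1) * Φ)),
      l1 * fS t l2 (θ + ((p.1 : ℝ) + 1) * Φ), sq1 l1 * fS t l2 (θ + (p.1 : ℝ) * Φ),
      -(sq1 l1 * gS t l2 (θ + (p.1 : ℝ) * Φ))]] p.2

/-- The sites coupled to `p` by the walk. -/
def walkNeighbor (p : ℤ × Fin 2) : Fin 4 → ℤ × Fin 2 :=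
  ![(![p.1 - 1, p.1 + 1] p.2, 0), (![p.1 - 1, p.1 + 1] p.2, 1), (p.1, 0), (p.1, 1)]

lemma walkFun_apply (t l1 l2 Φ θ : ℝ) (ψ : ℤ → EuclideanSpace ℂ (Fin 2)) (p : ℤ × Fin 2) :
    walkFun t l1 l2 Φ θ ψ p.1 p.2 =
      walkCoeff t l1 l2 Φ θ p 0 * ψ (walkNeighbor p 0).1 (walkNeighbor p 0).2 +
      walkCoeff t l1 l2 Φ θ p 1 * ψ (walkNeighbor p 1).1 (walkNeighbor p 1).2 +
      walkCoeff t l1 l2 Φ θ p 2 * ψ (walkNeighbor p 2).1 (walkNeighbor p 2).2 +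
      walkCoeff t l1 l2 Φ θ p 3 * ψ (walkNeighbor p 3).1 (walkNeighbor p 3).2 := by
  obtain ⟨n, i⟩ := p
  fin_cases i <;>
  · simp [walkFun, wPlus, wMinus, walkCoeff, walkNeighbor]
    ring

/-- If all linearly bounded generalized eigenfunctions of the walk are square summable, then its
eigenvectors are total. -/
lemma exists_eigenvector_inner_ne_zero {l1 l2 : ℝ} (hl1 : l1 ∈ Set.Ioo (0 : ℝ) 1)
    (hl2 : l2 ∈ Set.Ioo (0 : ℝ) 1) (t Φ θ : ℝ)
    (hloc : ∀ z : ℂ, ‖z‖ = 1 → ∀ ψ, IsEigen t l1 l2 Φ θ z ψ → ∀ A : ℝ, 0 ≤ A →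
      (∀ n : ℤ, ‖ψ n‖ ≤ A * (1 + |(n : ℝ)|)) → Memℓp ψ 2) {ξ : H2} (hξ : ξ ≠ 0) :
    ∃ (η : H2) (z : ℂ), walk hl1 hl2 t Φ θ η = z • η ∧ inner ℂ η ξ ≠ 0 := by
  refine (walk hl1 hl2 t Φ θ).exists_eigenvector_inner_ne_zero (δ := siteVector)
    (fun p => (norm_siteVector p).le) (fun _ => H2.ext_siteVector)
    (c := walkCoeff t l1 l2 Φ θ) (N := walkNeighbor) (fun p v => ?_)
    (fun z hz a ha A hA hb ha0 => ?_) hξ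
  · simp only [inner_siteVector]
    exact walkFun_apply t l1 l2 Φ θ v p
  · set ψ : ℤ → EuclideanSpace ℂ (Fin 2) := fun n => !₂[a (n, 0), a (n, 1)] with hψ
    have hψa : ∀ p : ℤ × Fin 2, ψ p.1 p.2 = a p := by
      rintro ⟨n, i⟩
      fin_cases i <;> rfl
    have hψe : IsEigen t l1 l2 Φ θ z ψ := fun n => by
      have h : ∀ p : ℤ × Fin 2, walkFun t l1 l2 Φ θ ψ p.1 p.2 = z * ψ p.1 p.2 := fun p => by
        rw [walkFun_apply]
        simp only [hψa]
        exact ha p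
      exact ⟨h (n, 0), h (n, 1)⟩
    have hmem : Memℓp ψ 2 := hloc z hz ψ hψe (A + A) (by positivity) fun n => by
      refine (norm_fiber_le _).trans ?_
      rw [add_mul]
      exact add_le_add (hb n 0) (hb n 1)
    refine ⟨⟨ψ, hmem⟩, fun h0 => ha0 (funext fun p => ?_),
      (walk_eq_smul_iff hl1 hl2 t Φ θ _ _).2 hψe⟩
    have h1 : ψ p.1 = 0 := congrFun (congrArg Subtype.val h0) p.1
    rw [← hψa, h1]; rfl

section
universe u
variable {H : Type u} [NormedAddCommGroup H] [InnerProductSpace ℂ H] [CompleteSpace H]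

/-- A unitary with a total set of eigenvectors has an orthonormal basis of eigenvectors. -/
lemma LinearIsometryEquiv.exists_hilbertBasis_eigenvectors (W : H ≃ₗᵢ[ℂ] H)
    (hW : ∀ ξ : H, ξ ≠ 0 → ∃ (η : H) (z : ℂ), W η = z • η ∧ inner ℂ η ξ ≠ 0) :
    ∃ (ι : Type u) (e : HilbertBasis ι ℂ H), ∀ i, ∃ z : ℂ, W (e i) = z • e i := by
  set V : ℂ → Submodule ℂ H := fun z =>
    ((W : H →L[ℂ] H) - z • ContinuousLinearMap.id ℂ H).ker with hV
  have hmem : ∀ {z v}, v ∈ V z ↔ W v = z • v := fun {z v} => sub_eq_zero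
  have hcomp : ∀ z, CompleteSpace (V z) := fun z =>
    ((W : H →L[ℂ] H) - z • ContinuousLinearMap.id ℂ H).completeSpace_ker
  have hort : OrthogonalFamily ℂ (fun z => V z) fun z => (V z).subtypeₗᵢ := fun z y hzy v w =>
    W.inner_eigenvector_eq_zero hzy (hmem.1 v.2) (hmem.1 w.2)
  choose w b _ using fun z => exists_hilbertBasis ℂ (V z)
  have ho := hort.orthonormal_sigma_orthonormal fun z => (b z).orthonormal
  refine ⟨_, HilbertBasis.mkOfOrthogonalEqBot ho ?_, fun i => ⟨i.1, ?_⟩⟩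
  · refine (Submodule.eq_bot_iff _).2 fun ξ hξ => ?_
    by_contra h0
    obtain ⟨η, z, hη, hne⟩ := hW ξ h0
    refine hne (inner_eq_zero_symm.1 ?_)
    have hs := ((innerSL ℂ ξ).comp (V z).subtypeL).hasSum ((b z).hasSum_repr ⟨η, hmem.2 hη⟩)
    refine hs.unique (hasSum_zero.congr_fun fun i => ?_)
    have h1 : inner ℂ (b z i : H) ξ = 0 :=
      (Submodule.mem_orthogonal _ _).1 hξ _ (Submodule.subset_span ⟨⟨z, i⟩, rfl⟩)
    exact (ContinuousLinearMap.map_smul _ _ _).trans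
      (smul_eq_zero_of_right _ (inner_eq_zero_symm.1 h1))
  · rw [HilbertBasis.coe_mkOfOrthogonalEqBot]
    exact hmem.1 (b i.1 i.2).2

lemma HilbertBasis.exists_reindex_nat {ι : Type*} (e : HilbertBasis ι ℂ H) {κ : Type*} [Countable κ]
    (δ : κ → H) (hδ : ∀ w, (∀ k, inner ℂ w (δ k) = 0) → w = 0) (hH : ¬ FiniteDimensional ℂ H) :
    ∃ (b : HilbertBasis ℕ ℂ H) (f : ℕ → ι), ∀ n, b n = e (f n) := by
  have hc : Countable ι := e.orthonormal.countable_of_separating δ hδ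
  have hi : Infinite ι := by
    by_contra hfin
    rw [not_infinite_iff_finite] at hfin
    have := Fintype.ofFinite ι
    exact hH (Module.Basis.finiteDimensional_of_finite e.toOrthonormalBasis.toBasis)
  obtain ⟨f⟩ : Nonempty (ℕ ≃ ι) := nonempty_equiv_of_countable
  refine ⟨HilbertBasis.mk (e.orthonormal.comp f f.injective) ?_, f, fun n => ?_⟩
  · rw [Set.range_comp, f.surjective.range_eq, Set.image_univ, e.dense_span]
  · rw [HilbertBasis.coe_mk]; rfl
end

lemma H2.not_finiteDimensional : ¬ FiniteDimensional ℂ H2 := by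
  intro h
  have ho : Orthonormal ℂ fun n : ℤ => siteVector (n, 0) := by
    refine ⟨fun n => norm_siteVector _, fun m n hmn => ?_⟩
    refine (inner_siteVector _ _).trans ?_
    simp [siteVector, lp.single_apply, hmn]
  have := ho.linearIndependent.finite
  exact not_finite ℤ

lemma memℓp_two_of_exp_decay {ψ : ℤ → EuclideanSpace ℂ (Fin 2)} {C c : ℝ} (hc : 0 < c)
    (h : ∀ n : ℤ, ‖ψ n‖ ≤ C * Real.exp (-c * |(n : ℝ)|)) : Memℓp ψ 2 := by
  rw [memℓp_gen_iff (by norm_num)]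
  have hs : Summable fun n : ℤ => C ^ 2 * Real.exp (-(2 * c) * |(n : ℝ)|) := by
    have h0 : Summable fun n : ℕ => Real.exp (n * (-(2 * c))) :=
      Real.summable_exp_nat_mul_iff.2 (by linarith)
    refine Summable.mul_left _ (Summable.of_nat_of_neg ?_ ?_) <;> simpa [mul_comm] using h0
  refine hs.of_nonneg_of_le (fun n => by positivity) fun n => ?_
  simp only [ENNReal.toReal_ofNat, Real.rpow_ofNat]
  refine (pow_le_pow_left₀ (norm_nonneg _) (h n) 2).trans (le_of_eq ?_)
  rw [mul_pow, ← Real.exp_nat_mul]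
  congr 2
  push_cast; ring

/-- Anderson localization in the supercritical region: under a Diophantine condition on `Φ`
and non-resonance of `θ`, if `λ₁ < (1−t²)/(1+t²)` and `λ₁ < λ₂`, the walk operator has a
Hilbert basis of exponentially decaying eigenvectors. -/
theorem anderson_localization
    (t l1 l2 Φ θ τ κ : ℝ)
    (ht : t ∈ Set.Ioo (-1 : ℝ) 1)
    (hl1 : l1 ∈ Set.Ioo (0 : ℝ) 1) (hl2 : l2 ∈ Set.Ioo (0 : ℝ) 1)
    (hsub : l1 < (1 - t ^ 2) / (1 + t ^ 2)) (hlt : l1 < l2)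
    (hτ : 1 < τ) (hκ : 0 < κ)
    (hdio : ∀ n : ℤ, n ≠ 0 → ∀ j : ℤ, κ / |(n : ℝ)| ^ τ ≤ |(j : ℝ) - (n : ℝ) * Φ|)
    (hres : {m : ℤ | |Real.sin (2 * Real.pi * (θ + ((m : ℝ) / 2) * Φ))| <
        Real.exp (-(|(m : ℝ)| / 2) ^ (1 / (2 * τ)))}.Finite) :
    ∃ e : HilbertBasis ℕ ℂ H2, ∀ i : ℕ,
      (∃ z : ℂ, IsEigen t l1 l2 Φ θ z (fun n => e i n)) ∧
      ∃ C c : ℝ, 0 < C ∧ 0 < c ∧ ∀ n : ℤ, ‖e i n‖ ≤ C * Real.exp (-c * |(n : ℝ)|) := by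
  have htot := fun (ξ : H2) (hξ : ξ ≠ 0) => exists_eigenvector_inner_ne_zero hl1 hl2 t Φ θ
    (fun z hz ψ hψ A hA hb => by
      by_cases h0 : ∀ n, ψ n = 0
      · rw [show ψ = 0 from funext h0]
        exact zero_memℓp
      push Not at h0
      obtain ⟨n₀, hn₀⟩ := h0
      obtain ⟨C, c, -, hc, hdec⟩ := hψ.exists_decay ht hl1 hl2 hsub hlt hτ hκ hdio hres hz
        (K := 1) hA (by simpa using hb) hn₀
      exact memℓp_two_of_exp_decay hc hdec) hξ
  obtain ⟨ι, e, he⟩ := (walk hl1 hl2 t Φ θ).exists_hilbertBasis_eigenvectors htot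
  obtain ⟨b, f, hbf⟩ := e.exists_reindex_nat siteVector (fun _ => H2.ext_siteVector)
    H2.not_finiteDimensional
  refine ⟨b, fun i => ?_⟩
  obtain ⟨z, hz⟩ := he (f i)
  rw [← hbf i] at hz
  have hne := b.orthonormal.ne_zero i
  have hE := (walk_eq_smul_iff hl1 hl2 t Φ θ (b i) z).1 hz
  obtain ⟨n₀, hn₀⟩ : ∃ n, b i n ≠ 0 := by
    by_contra! h
    exact hne (lp.ext (funext h))
  refine ⟨⟨z, hE⟩, hE.exists_decay ht hl1 hl2 hsub hlt hτ hκ hdio hres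
    ((walk hl1 hl2 t Φ θ).norm_eigenvalue hne hz) (A := 1) (K := 0) zero_le_one (fun n => ?_) hn₀⟩
  have h1 := lp.norm_apply_le_norm two_ne_zero (b i) n
  rw [b.orthonormal.1 i] at h1
  simpa using h1

end
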